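/- (Local energy estimate (2.3).) There is a universal constant c > 0 such that for every suitable weak solution (v,p) of the Navier–Stokes equations in Q and every 0 < R ≤ 1 one has A(R/2) + E(R/2) ≤ c [ C^{2/3}(R) + C^{1/3}(R) D₀^{2/3}(R) + A^{1/2}(R) C^{1/3}(R) E^{1/2}(R) ]. -/

import Mathlib

open MeasureTheory Metric Set

noncomputable section

/-- Three-dimensional Euclidean space. -/
abbrev E3 := EuclideanSpace ℝ (Fin 3)

/-- The open ball `B(r) ⊆ ℝ³` of radius `r` centered at the origin. -/
def ballB (r : ℝ) : Set E3 := Metric.ball (0 : E3) r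

/-- The time interval `(-r², 0)`. -/
def timeI (r : ℝ) : Set ℝ := Set.Ioo (-r ^ 2) 0

/-- The parabolic cylinder `Q(r) = B(r) × (-r², 0)`. -/
def QSet (r : ℝ) : Set (E3 × ℝ) := ballB r ×ˢ timeI r

/-- The mean value `[f]_{B(r)}` of a function over the ball `B(r)`. -/
def avgB (r : ℝ) (f : E3 → ℝ) : ℝ := ⨍ x in ballB r, f x

/-- `A(r) = ess sup_{-r²<t<0} (1/r) ∫_{B(r)} |v(x,t)|² dx`. -/
def funA (v : E3 → ℝ → E3) (r : ℝ) : ℝ :=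
  essSup (fun t => (1 / r) * ∫ x in ballB r, ‖v x t‖ ^ 2)
    (volume.restrict (timeI r))

/-- `E(r) = (1/r) ∫_{Q(r)} |∇v|² dz`, where `gv` is the (weak) spatial gradient of `v`. -/
def funE (gv : E3 → ℝ → Fin 3 → Fin 3 → ℝ) (r : ℝ) : ℝ :=
  (1 / r) * ∫ t in timeI r, ∫ x in ballB r, ∑ i, ∑ j, (gv x t i j) ^ 2

/-- `C(r) = (1/r²) ∫_{Q(r)} |v|³ dz`. -/
def funC (v : E3 → ℝ → E3) (r : ℝ) : ℝ :=
  (1 / r ^ 2) * ∫ t in timeI r, ∫ x in ballB r, ‖v x t‖ ^ 3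

/-- `D₀(r) = (1/r²) ∫_{Q(r)} |p - [p]_{B(r)}|^{3/2} dz`. -/
def funD0 (p : E3 → ℝ → ℝ) (r : ℝ) : ℝ :=
  (1 / r ^ 2) * ∫ t in timeI r, ∫ x in ballB r,
    |p x t - avgB r (fun y => p y t)| ^ ((3 : ℝ) / 2)

/-- The `j`-th spatial coordinate direction in space-time `ℝ³ × ℝ`. -/
def spaceDir (j : Fin 3) : E3 × ℝ := (EuclideanSpace.single j (1 : ℝ), 0)

/-- The time direction in space-time `ℝ³ × ℝ`. -/
def timeDir : E3 × ℝ := (0, 1)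

/-- The spatial Laplacian of a space-time test function. -/
def lapSpace (φ : E3 × ℝ → ℝ) (z : E3 × ℝ) : ℝ :=
  ∑ j, fderiv ℝ (fun w => fderiv ℝ φ w (spaceDir j)) z (spaceDir j)

/-- `gv` is the weak spatial gradient of `v` on `B(ϱ)`, for a.e. time in `(-ϱ², 0)`:
integration by parts against smooth test functions compactly supported in `B(ϱ)`. -/
def IsWeakSpatialGradient (v : E3 → ℝ → E3) (gv : E3 → ℝ → Fin 3 → Fin 3 → ℝ)
    (ϱ : ℝ) : Prop :=
  ∀ᵐ t ∂(volume.restrict (timeI ϱ)),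
    ∀ φ : E3 → ℝ, ContDiff ℝ (⊤ : ℕ∞) φ → tsupport φ ⊆ ballB ϱ →
      ∀ i j, ∫ x in ballB ϱ, v x t i * fderiv ℝ φ x (EuclideanSpace.single j (1 : ℝ))
        = - ∫ x in ballB ϱ, gv x t i j * φ x

/-- The regularity class `v ∈ L_∞(-ϱ²,0;L₂(B(ϱ))) ∩ L₂(-ϱ²,0;W¹₂(B(ϱ)))`,
with weak spatial gradient `gv ∈ L₂(Q(ϱ))`. -/
structure VelocityClass (v : E3 → ℝ → E3) (gv : E3 → ℝ → Fin 3 → Fin 3 → ℝ)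
    (ϱ : ℝ) : Prop where
  v_meas : AEMeasurable (fun z : E3 × ℝ => v z.1 z.2) (volume.restrict (QSet ϱ))
  v_L2 : IntegrableOn (fun z : E3 × ℝ => ‖v z.1 z.2‖ ^ 2) (QSet ϱ)
  v_Linfty : ∃ M : ℝ, ∀ᵐ t ∂(volume.restrict (timeI ϱ)),
      (∫ x in ballB ϱ, ‖v x t‖ ^ 2) ≤ M
  grad_L2 : IntegrableOn (fun z : E3 × ℝ => ∑ i, ∑ j, (gv z.1 z.2 i j) ^ 2) (QSet ϱ)
  isGrad : IsWeakSpatialGradient v gv ϱ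

/-- The Navier–Stokes equations hold in `Q = Q(1)` in the sense of distributions. -/
def NSEDistrib (v : E3 → ℝ → E3) (gv : E3 → ℝ → Fin 3 → Fin 3 → ℝ)
    (p : E3 → ℝ → ℝ) : Prop :=
  (∀ φ : E3 × ℝ → E3, ContDiff ℝ (⊤ : ℕ∞) φ → tsupport φ ⊆ QSet 1 →
    (∫ z in QSet 1,
      ((∑ i, v z.1 z.2 i * fderiv ℝ (fun w => φ w i) z timeDir)
        + (∑ i, ∑ j, v z.1 z.2 i * v z.1 z.2 j * fderiv ℝ (fun w => φ w i) z (spaceDir j))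
        - (∑ i, ∑ j, gv z.1 z.2 i j * fderiv ℝ (fun w => φ w i) z (spaceDir j))
        + p z.1 z.2 * (∑ i, fderiv ℝ (fun w => φ w i) z (spaceDir i)))) = 0)
  ∧
  (∀ q : E3 × ℝ → ℝ, ContDiff ℝ (⊤ : ℕ∞) q → tsupport q ⊆ QSet 1 →
    (∫ z in QSet 1, ∑ i, v z.1 z.2 i * fderiv ℝ q z (spaceDir i)) = 0)

/-- The parabolic boundary of `Q = B(1) × (-1,0)`. -/
def parabBdry : Set (E3 × ℝ) :=
  (Metric.sphere (0 : E3) 1 ×ˢ Set.Icc (-1 : ℝ) 0)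
    ∪ (Metric.closedBall (0 : E3) 1 ×ˢ {(-1 : ℝ)})

/-- The local energy inequality for a suitable weak solution on `Q = Q(1)`. -/
def LocalEnergyIneq (v : E3 → ℝ → E3) (gv : E3 → ℝ → Fin 3 → Fin 3 → ℝ)
    (p : E3 → ℝ → ℝ) : Prop :=
  ∀ᵐ t ∂(volume.restrict (Set.Ioo (-1 : ℝ) 0)),
    ∀ φ : E3 × ℝ → ℝ, ContDiff ℝ (⊤ : ℕ∞) φ → (∀ z, 0 ≤ φ z) →
      (∃ U : Set (E3 × ℝ), IsOpen U ∧ parabBdry ⊆ U ∧ ∀ z ∈ U, φ z = 0) →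
      (∫ x in ballB 1, φ (x, t) * ‖v x t‖ ^ 2)
        + 2 * ∫ s in Set.Ioo (-1 : ℝ) t, ∫ x in ballB 1,
            φ (x, s) * ∑ i, ∑ j, (gv x s i j) ^ 2
      ≤ ∫ s in Set.Ioo (-1 : ℝ) t, ∫ x in ballB 1,
          (‖v x s‖ ^ 2 * (lapSpace φ (x, s) + fderiv ℝ φ (x, s) timeDir)
            + (∑ i, v x s i * fderiv ℝ φ (x, s) (spaceDir i)) * (‖v x s‖ ^ 2 + 2 * p x s))

/-- `(v, p)` is a suitable weak solution of the Navier–Stokes equations in `Q = Q(1)`,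
with `gv` the weak spatial gradient of `v`. -/
structure SuitableWeakSolution (v : E3 → ℝ → E3) (gv : E3 → ℝ → Fin 3 → Fin 3 → ℝ)
    (p : E3 → ℝ → ℝ) : Prop where
  vel : VelocityClass v gv 1
  p_meas : AEMeasurable (fun z : E3 × ℝ => p z.1 z.2) (volume.restrict (QSet 1))
  p_L32 : IntegrableOn (fun z : E3 × ℝ => |p z.1 z.2| ^ ((3 : ℝ) / 2)) (QSet 1)
  nse : NSEDistrib v gv p
  lei : LocalEnergyIneq v gv p

open scoped ENNReal Topology
open Filter

lemma lintegral_comp_add_smul {s : ℝ} (hs : 0 < s) (c : E3) {h : E3 → ℝ≥0∞}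
    (hh : Measurable h) :
    ∫⁻ y, h (c + s • y) = ENNReal.ofReal (s ^ 3)⁻¹ * ∫⁻ y, h y := by
  have h1 : ∫⁻ y, h (c + s • y) = ∫⁻ y, h (c + y) ∂(Measure.map (s • ·) (volume : Measure E3)) := by
    rw [lintegral_map (by fun_prop) (by fun_prop)]
  rw [h1, Measure.map_addHaar_smul _ hs.ne', lintegral_smul_measure, smul_eq_mul,
    lintegral_add_left_eq_self]
  simp [abs_of_pos hs]

lemma segment_mem_ball {R s : ℝ} (hs0 : 0 ≤ s) (hs1 : s ≤ 1) {x y : E3}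
    (hx : x ∈ ball (0 : E3) R) (hy : y ∈ ball (0 : E3) R) :
    x + s • (y - x) ∈ ball (0 : E3) R :=
  (convex_ball (0 : E3) R).add_smul_sub_mem hx hy ⟨hs0, hs1⟩

/-- Averaging over homothetic images of a ball gains integrability. -/
lemma lintegral_ball_segment_le {R s : ℝ} (hs0 : 0 < s) (hs1 : s ≤ 1) {x : E3}
    (hx : x ∈ ball (0 : E3) R) {h : E3 → ℝ≥0∞} (hh : Measurable h) :
    ∫⁻ y in ball (0 : E3) R, h (x + s • (y - x))
      ≤ ENNReal.ofReal (s ^ 3)⁻¹ * ∫⁻ y in ball (0 : E3) R, h y := by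
  rw [← lintegral_indicator measurableSet_ball, ← lintegral_indicator measurableSet_ball,
    ← lintegral_comp_add_smul hs0 ((1 - s) • x) (hh.indicator measurableSet_ball)]
  refine lintegral_mono fun y => ?_
  have e : (1 - s) • x + s • y = x + s • (y - x) := by module
  by_cases hy : y ∈ ball (0 : E3) R
  · rw [e, indicator_of_mem hy, indicator_of_mem (segment_mem_ball hs0.le hs1 hx hy)]
  · rw [indicator_of_notMem hy]; exact zero_le

lemma lintegral_lintegral_ball_segment_le {R s : ℝ} (hs0 : 0 < s) (hs1 : s ≤ 1)
    {h : E3 → ℝ≥0∞} (hh : Measurable h) :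
    ∫⁻ x in ball (0 : E3) R, ∫⁻ y in ball (0 : E3) R, h (x + s • (y - x))
      ≤ 8 * volume (ball (0 : E3) R) * ∫⁻ y in ball (0 : E3) R, h y := by
  have key : ∀ r : ℝ, 1 / 2 ≤ r → r ≤ 1 →
      ∫⁻ x in ball (0 : E3) R, ∫⁻ y in ball (0 : E3) R, h (x + r • (y - x))
      ≤ 8 * volume (ball (0 : E3) R) * ∫⁻ y in ball (0 : E3) R, h y := by
    intro r hr hr1
    have h8 : ENNReal.ofReal (r ^ 3)⁻¹ ≤ 8 := by
      rw [show (8 : ℝ≥0∞) = ENNReal.ofReal 8 by norm_num]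
      apply ENNReal.ofReal_le_ofReal
      rw [inv_le_comm₀ (by positivity) (by norm_num)]
      calc (8 : ℝ)⁻¹ = (1 / 2) ^ 3 := by norm_num
        _ ≤ r ^ 3 := by gcongr
    calc ∫⁻ x in ball (0 : E3) R, ∫⁻ y in ball (0 : E3) R, h (x + r • (y - x))
        ≤ ∫⁻ x in ball (0 : E3) R, 8 * ∫⁻ y in ball (0 : E3) R, h y := by
          refine setLIntegral_mono' measurableSet_ball fun x hx => ?_
          refine (lintegral_ball_segment_le (by linarith) hr1 hx hh).trans ?_
          gcongr
      _ = _ := by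
          rw [setLIntegral_const]; ring
  rcases le_total (1 / 2) s with h2 | h2
  · exact key s h2 hs1
  · rw [lintegral_lintegral_swap (by
      apply Measurable.aemeasurable
      simp only [Function.uncurry_def]
      fun_prop)]
    refine le_trans (le_of_eq ?_) (key (1 - s) (by linarith) (by linarith))
    refine lintegral_congr fun x => lintegral_congr fun y => ?_
    congr 1
    module

/-- The `L²–L¹` bilinear bound for averages along segments in a ball. -/
lemma lintegral_mul_segment_le {R s : ℝ} (hs0 : 0 < s) (hs1 : s ≤ 1)
    {f h : E3 → ℝ≥0∞} (hf : Measurable f) (hh : Measurable h) :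
    ∫⁻ x in ball (0 : E3) R, ∫⁻ y in ball (0 : E3) R, f x * h (x + s • (y - x))
      ≤ (8 * volume (ball (0 : E3) R)) ^ (1 / 2 : ℝ) * ENNReal.ofReal (s ^ (-(3 / 2) : ℝ)) *
        (∫⁻ x in ball (0 : E3) R, f x ^ 2) ^ (1 / 2 : ℝ) * ∫⁻ y in ball (0 : E3) R, h y := by
  set μ := (volume : Measure E3).restrict (ball (0 : E3) R) with hμ
  set H : E3 → ℝ≥0∞ := fun x => ∫⁻ y, h (x + s • (y - x)) ∂μ with hH
  have hHm : Measurable H := by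
    apply Measurable.lintegral_prod_right' (f := fun z : E3 × E3 => h (z.1 + s • (z.2 - z.1)))
    fun_prop
  have e1 : ∀ x, ∫⁻ y, f x * h (x + s • (y - x)) ∂μ = f x * H x := by
    intro x
    rw [lintegral_const_mul]
    fun_prop
  simp_rw [e1]
  have cs := ENNReal.lintegral_mul_norm_pow_le (μ := μ) (f := fun x => f x ^ 2)
    (g := fun x => H x ^ 2) (by fun_prop) (by fun_prop) (p := 1 / 2) (q := 1 / 2)
    (by norm_num) (by norm_num) (by norm_num)
  have e2 : ∀ a : ℝ≥0∞, (a ^ 2) ^ (1 / 2 : ℝ) = a := fun a => by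
    rw [← ENNReal.rpow_natCast, ← ENNReal.rpow_mul]; norm_num
  simp only [e2] at cs
  have hH2 : ∫⁻ x, H x ^ 2 ∂μ ≤ (ENNReal.ofReal (s ^ 3)⁻¹ * ∫⁻ y, h y ∂μ) *
      (8 * volume (ball (0 : E3) R) * ∫⁻ y, h y ∂μ) := by
    calc ∫⁻ x, H x ^ 2 ∂μ ≤ ∫⁻ x, (ENNReal.ofReal (s ^ 3)⁻¹ * ∫⁻ y, h y ∂μ) * H x ∂μ := by
          refine setLIntegral_mono' measurableSet_ball fun x hx => ?_
          rw [sq]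
          gcongr
          exact lintegral_ball_segment_le hs0 hs1 hx hh
      _ = (ENNReal.ofReal (s ^ 3)⁻¹ * ∫⁻ y, h y ∂μ) * ∫⁻ x, H x ∂μ :=
          lintegral_const_mul _ hHm
      _ ≤ _ := by
          gcongr
          exact lintegral_lintegral_ball_segment_le hs0 hs1 hh
  refine cs.trans ?_
  have e3 : ((ENNReal.ofReal (s ^ 3)⁻¹ * ∫⁻ y, h y ∂μ) *
      (8 * volume (ball (0 : E3) R) * ∫⁻ y, h y ∂μ)) ^ (1 / 2 : ℝ)
      = (8 * volume (ball (0 : E3) R)) ^ (1 / 2 : ℝ) * ENNReal.ofReal (s ^ (-(3 / 2) : ℝ)) *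
       ∫⁻ y, h y ∂μ := by
    have : (ENNReal.ofReal (s ^ 3)⁻¹ * ∫⁻ y, h y ∂μ) *
      (8 * volume (ball (0 : E3) R) * ∫⁻ y, h y ∂μ) = (8 * volume (ball (0 : E3) R)) *
        ENNReal.ofReal (s ^ 3)⁻¹ * (∫⁻ y, h y ∂μ) ^ 2 := by ring
    rw [this, ENNReal.mul_rpow_of_nonneg _ _ (by norm_num),
      ENNReal.mul_rpow_of_nonneg _ _ (by norm_num), e2,
      ENNReal.ofReal_rpow_of_nonneg (by positivity) (by norm_num)]
    congr 3
    rw [← Real.rpow_natCast, ← Real.rpow_neg hs0.le, ← Real.rpow_mul hs0.le]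
    norm_num
  calc _ ≤ (∫⁻ x, f x ^ 2 ∂μ) ^ (1 / 2 : ℝ) * _ :=
        mul_le_mul_right (ENNReal.rpow_le_rpow hH2 (by norm_num)) _
    _ = _ := by rw [e3]; ring

lemma lintegral_rpow_Ioc {r τ : ℝ} (hr : -1 < r) (hτ : 0 ≤ τ) :
    ∫⁻ s in Ioc 0 τ, ENNReal.ofReal (s ^ r) = ENNReal.ofReal (τ ^ (r + 1) / (r + 1)) := by
  have hi : IntervalIntegrable (fun s : ℝ => s ^ r) volume 0 τ :=
    intervalIntegral.intervalIntegrable_rpow' hr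
  rw [intervalIntegrable_iff_integrableOn_Ioc_of_le hτ] at hi
  rw [← ofReal_integral_eq_lintegral_ofReal hi, ← intervalIntegral.integral_of_le hτ,
    integral_rpow (Or.inl hr), Real.zero_rpow (by linarith), sub_zero]
  filter_upwards [ae_restrict_mem measurableSet_Ioc] with s hs
  exact Real.rpow_nonneg hs.1.le _

lemma ENNReal.sq_rpow_half (a : ℝ≥0∞) : (a ^ 2) ^ (1 / 2 : ℝ) = a := by
  rw [← ENNReal.rpow_natCast, ← ENNReal.rpow_mul]; norm_num

lemma ENNReal.rpow_half_sq (a : ℝ≥0∞) : (a ^ (1 / 2 : ℝ)) ^ 2 = a := by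
  rw [← ENNReal.rpow_natCast, ← ENNReal.rpow_mul]; norm_num

lemma sq_lintegral_mul_le {α : Type*} [MeasurableSpace α] {μ : Measure α} {f g : α → ℝ≥0∞}
    (hf : AEMeasurable f μ) (hg : AEMeasurable g μ) :
    (∫⁻ a, f a * g a ∂μ) ^ 2 ≤ (∫⁻ a, f a ^ 2 ∂μ) * ∫⁻ a, g a ^ 2 ∂μ := by
  have cs := ENNReal.lintegral_mul_norm_pow_le (μ := μ) (f := fun x => f x ^ 2)
    (g := fun x => g x ^ 2) (by fun_prop) (by fun_prop) (p := 1 / 2) (q := 1 / 2)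
    (by norm_num) (by norm_num) (by norm_num)
  simp only [ENNReal.sq_rpow_half] at cs
  calc (∫⁻ a, f a * g a ∂μ) ^ 2
      ≤ ((∫⁻ a, f a ^ 2 ∂μ) ^ (1 / 2 : ℝ) * (∫⁻ a, g a ^ 2 ∂μ) ^ (1 / 2 : ℝ)) ^ 2 := by gcongr
    _ = _ := by rw [mul_pow, ENNReal.rpow_half_sq, ENNReal.rpow_half_sq]

/-- Weighted Cauchy–Schwarz for the increment of a `C¹` function along a segment. -/
lemma enorm_sub_sq_le_lintegral_segment {u : E3 → ℝ} (hu : ContDiff ℝ 1 u) {τ : ℝ} (hτ : 0 < τ)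
    (x y : E3) :
    ‖u (x + τ • (y - x)) - u x‖ₑ ^ 2 ≤ 4 * ENNReal.ofReal (τ ^ (1 / 4 : ℝ)) * ‖y - x‖ₑ ^ 2 *
      ∫⁻ s in Ioc 0 τ, ENNReal.ofReal (s ^ (3 / 4 : ℝ)) * ‖fderiv ℝ u (x + s • (y - x))‖ₑ ^ 2 := by
  have hd : ∀ s ∈ uIcc 0 τ, HasDerivAt (fun s : ℝ => u (x + s • (y - x)))
      (fderiv ℝ u (x + s • (y - x)) (y - x)) s := by
    intro s _
    have h1 : HasDerivAt (fun s : ℝ => x + s • (y - x)) (y - x) s := by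
      simpa using ((hasDerivAt_id s).smul_const (y - x)).const_add x
    exact ((hu.differentiable (by norm_num)) _).hasFDerivAt.comp_hasDerivAt s h1
  have hfd : Continuous (fderiv ℝ u) := hu.continuous_fderiv (by norm_num)
  have hc : Continuous fun s : ℝ => fderiv ℝ u (x + s • (y - x)) := by fun_prop
  have hint := intervalIntegral.integral_eq_sub_of_hasDerivAt hd
    ((hc.clm_apply continuous_const).intervalIntegrable _ _)
  simp only [zero_smul, add_zero] at hint
  rw [← hint, intervalIntegral.integral_of_le hτ.le]
  have h1 : ‖∫ s in Ioc 0 τ, fderiv ℝ u (x + s • (y - x)) (y - x)‖ₑ ≤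
      ‖y - x‖ₑ * ∫⁻ s in Ioc 0 τ, ENNReal.ofReal (s ^ (-(3 / 8) : ℝ)) *
        (ENNReal.ofReal (s ^ (3 / 8 : ℝ)) * ‖fderiv ℝ u (x + s • (y - x))‖ₑ) := by
    rw [← lintegral_const_mul _ (by fun_prop)]
    refine (enorm_integral_le_lintegral_enorm _).trans ?_
    refine setLIntegral_mono' measurableSet_Ioc fun s hs => ?_
    rw [← mul_assoc (ENNReal.ofReal _), ← ENNReal.ofReal_mul (Real.rpow_nonneg hs.1.le _),
      ← Real.rpow_add hs.1]
    rw [show (-(3 / 8) + 3 / 8 : ℝ) = 0 by norm_num, Real.rpow_zero, ENNReal.ofReal_one, one_mul,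
      mul_comm]
    exact (fderiv ℝ u (x + s • (y - x))).le_opENorm (y - x)
  calc _ ≤ (‖y - x‖ₑ * ∫⁻ s in Ioc 0 τ, ENNReal.ofReal (s ^ (-(3 / 8) : ℝ)) *
        (ENNReal.ofReal (s ^ (3 / 8 : ℝ)) * ‖fderiv ℝ u (x + s • (y - x))‖ₑ)) ^ 2 := by gcongr
    _ ≤ ‖y - x‖ₑ ^ 2 * ((∫⁻ s in Ioc 0 τ, ENNReal.ofReal (s ^ (-(3 / 8) : ℝ)) ^ 2) *
        ∫⁻ s in Ioc 0 τ,
          (ENNReal.ofReal (s ^ (3 / 8 : ℝ)) * ‖fderiv ℝ u (x + s • (y - x))‖ₑ) ^ 2) := by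
        rw [mul_pow]
        gcongr
        exact sq_lintegral_mul_le (by fun_prop) (by fun_prop)
    _ = _ := by
        have e1 : ∫⁻ s in Ioc 0 τ, ENNReal.ofReal (s ^ (-(3 / 8) : ℝ)) ^ 2
            = 4 * ENNReal.ofReal (τ ^ (1 / 4 : ℝ)) := by
          rw [setLIntegral_congr_fun (g := fun s => ENNReal.ofReal (s ^ (-(3 / 4) : ℝ)))
            measurableSet_Ioc, lintegral_rpow_Ioc (by norm_num) hτ.le]
          · rw [show τ ^ (-(3 / 4) + 1 : ℝ) / (-(3 / 4) + 1) = 4 * τ ^ (1 / 4 : ℝ) by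
              norm_num; ring, ENNReal.ofReal_mul (by norm_num)]
            norm_num
          · intro s hs
            dsimp only
            rw [← ENNReal.ofReal_pow (Real.rpow_nonneg hs.1.le _), ← Real.rpow_natCast,
              ← Real.rpow_mul hs.1.le]
            norm_num
        have e2 : ∫⁻ s in Ioc 0 τ,
            (ENNReal.ofReal (s ^ (3 / 8 : ℝ)) * ‖fderiv ℝ u (x + s • (y - x))‖ₑ) ^ 2
            = ∫⁻ s in Ioc 0 τ, ENNReal.ofReal (s ^ (3 / 4 : ℝ)) *
              ‖fderiv ℝ u (x + s • (y - x))‖ₑ ^ 2 := by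
          refine setLIntegral_congr_fun measurableSet_Ioc fun s hs => ?_
          rw [mul_pow, ← ENNReal.ofReal_pow (Real.rpow_nonneg hs.1.le _), ← Real.rpow_natCast,
            ← Real.rpow_mul hs.1.le]
          norm_num
        rw [e1, e2]; ring

lemma lintegral_mul_increment_sq_le {u : E3 → ℝ} (hu : ContDiff ℝ 1 u) {R τ : ℝ} (hR : 0 < R)
    (hτ : 0 < τ) {f : E3 → ℝ≥0∞} (hf : Measurable f) :
    ∫⁻ x in ball (0 : E3) R, ∫⁻ y in ball (0 : E3) R,
        f x * ‖u (x + τ • (y - x)) - u x‖ₑ ^ 2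
      ≤ 16 * ENNReal.ofReal (R ^ 2) * ENNReal.ofReal (τ ^ (1 / 4 : ℝ)) *
        ∫⁻ s in Ioc 0 τ, ENNReal.ofReal (s ^ (3 / 4 : ℝ)) *
          ∫⁻ x in ball (0 : E3) R, ∫⁻ y in ball (0 : E3) R,
            f x * ‖fderiv ℝ u (x + s • (y - x))‖ₑ ^ 2 := by
  set μ := (volume : Measure E3).restrict (ball (0 : E3) R) with hμ
  set ν := (volume : Measure ℝ).restrict (Ioc 0 τ) with hν
  have hfd : Continuous (fderiv ℝ u) := hu.continuous_fderiv (by norm_num)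
  set K := 16 * ENNReal.ofReal (R ^ 2) * ENNReal.ofReal (τ ^ (1 / 4 : ℝ)) with hK
  set F : E3 → E3 → ℝ → ℝ≥0∞ := fun x y s =>
    ENNReal.ofReal (s ^ (3 / 4 : ℝ)) * (f x * ‖fderiv ℝ u (x + s • (y - x))‖ₑ ^ 2) with hF
  have hFm : Measurable fun z : (E3 × E3) × ℝ => F z.1.1 z.1.2 z.2 := by
    simp only [hF]; fun_prop
  have step : ∀ x ∈ ball (0 : E3) R, ∀ y ∈ ball (0 : E3) R,
      f x * ‖u (x + τ • (y - x)) - u x‖ₑ ^ 2 ≤ K * ∫⁻ s, F x y s ∂ν := by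
    intro x hx y hy
    have h2 : ‖y - x‖ₑ ^ 2 ≤ 4 * ENNReal.ofReal (R ^ 2) := by
      have : ‖y - x‖ ≤ 2 * R := by
        have := norm_sub_le y x
        rw [mem_ball_zero_iff] at hx hy
        linarith
      rw [← ofReal_norm, ← ENNReal.ofReal_pow (norm_nonneg _),
        show (4 : ℝ≥0∞) = ENNReal.ofReal 4 by norm_num, ← ENNReal.ofReal_mul (by norm_num)]
      apply ENNReal.ofReal_le_ofReal
      nlinarith [norm_nonneg (y - x)]
    have e : ∫⁻ s, F x y s ∂ν = f x * ∫⁻ s, ENNReal.ofReal (s ^ (3 / 4 : ℝ)) *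
        ‖fderiv ℝ u (x + s • (y - x))‖ₑ ^ 2 ∂ν := by
      rw [← lintegral_const_mul _ (by fun_prop)]
      refine lintegral_congr fun s => ?_
      simp only [hF]; ring
    calc _ ≤ f x * (4 * ENNReal.ofReal (τ ^ (1 / 4 : ℝ)) * ‖y - x‖ₑ ^ 2 *
          ∫⁻ s, ENNReal.ofReal (s ^ (3 / 4 : ℝ)) * ‖fderiv ℝ u (x + s • (y - x))‖ₑ ^ 2 ∂ν) := by
          gcongr
          exact enorm_sub_sq_le_lintegral_segment hu hτ x y
      _ ≤ f x * (4 * ENNReal.ofReal (τ ^ (1 / 4 : ℝ)) * (4 * ENNReal.ofReal (R ^ 2)) *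
          ∫⁻ s, ENNReal.ofReal (s ^ (3 / 4 : ℝ)) * ‖fderiv ℝ u (x + s • (y - x))‖ₑ ^ 2 ∂ν) := by
          gcongr
      _ = _ := by rw [e, hK]; ring
  calc _ ≤ ∫⁻ x, ∫⁻ y, K * ∫⁻ s, F x y s ∂ν ∂μ ∂μ :=
        setLIntegral_mono' measurableSet_ball fun x hx =>
          setLIntegral_mono' measurableSet_ball fun y hy => step x hx y hy
    _ = K * ∫⁻ z, ∫⁻ s, F z.1 z.2 s ∂ν ∂(μ.prod μ) := by
        rw [lintegral_prod _ (by
          apply Measurable.aemeasurable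
          exact hFm.lintegral_prod_right')]
        have hm : Measurable fun z : E3 × E3 => ∫⁻ s, F z.1 z.2 s ∂ν := hFm.lintegral_prod_right'
        rw [← lintegral_const_mul _ (hm.lintegral_prod_right' (ν := μ))]
        refine lintegral_congr fun x => ?_
        exact lintegral_const_mul _ (hm.comp measurable_prodMk_left)
    _ = K * ∫⁻ s, ∫⁻ z, F z.1 z.2 s ∂(μ.prod μ) ∂ν := by
        rw [lintegral_lintegral_swap hFm.aemeasurable]
    _ = _ := by
        congr 1
        refine lintegral_congr fun s => ?_
        have h3 : Measurable fun z : E3 × E3 => F z.1 z.2 s := by simp only [hF]; fun_prop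
        have h4 : Measurable fun z : E3 × E3 =>
          f z.1 * ‖fderiv ℝ u (z.1 + s • (z.2 - z.1))‖ₑ ^ 2 := by fun_prop
        rw [lintegral_prod _ h3.aemeasurable, ← lintegral_const_mul _ (h4.lintegral_prod_right')]
        refine lintegral_congr fun x => ?_
        exact lintegral_const_mul _ (h4.comp measurable_prodMk_left)

lemma lintegral_lintegral_sub_sq_le {u : E3 → ℝ} (hu : ContDiff ℝ 1 u) {R : ℝ} (hR : 0 < R) :
    ∫⁻ x in ball (0 : E3) R, ∫⁻ y in ball (0 : E3) R, ‖u y - u x‖ₑ ^ 2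
      ≤ 128 * ENNReal.ofReal (R ^ 2) * volume (ball (0 : E3) R) *
        ∫⁻ x in ball (0 : E3) R, ‖fderiv ℝ u x‖ₑ ^ 2 := by
  have hfd : Continuous (fderiv ℝ u) := hu.continuous_fderiv (by norm_num)
  have h := lintegral_mul_increment_sq_le hu hR one_pos (f := fun _ => 1) measurable_const
  simp only [one_mul, one_smul, add_sub_cancel, Real.one_rpow, ENNReal.ofReal_one, mul_one] at h
  refine h.trans ?_
  have hs : ∫⁻ s in Ioc (0 : ℝ) 1, ENNReal.ofReal (s ^ (3 / 4 : ℝ)) *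
      ∫⁻ x in ball (0 : E3) R, ∫⁻ y in ball (0 : E3) R, ‖fderiv ℝ u (x + s • (y - x))‖ₑ ^ 2
      ≤ 8 * volume (ball (0 : E3) R) * ∫⁻ x in ball (0 : E3) R, ‖fderiv ℝ u x‖ₑ ^ 2 := by
    calc _ ≤ ∫⁻ s in Ioc (0 : ℝ) 1, 8 * volume (ball (0 : E3) R) *
          ∫⁻ x in ball (0 : E3) R, ‖fderiv ℝ u x‖ₑ ^ 2 := by
          refine setLIntegral_mono' measurableSet_Ioc fun s hs => ?_
          rw [← one_mul (8 * _ * _)]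
          refine mul_le_mul' ?_ ?_
          · rw [ENNReal.ofReal_le_one]
            exact Real.rpow_le_one hs.1.le hs.2 (by norm_num)
          · exact lintegral_lintegral_ball_segment_le hs.1 hs.2
              (h := fun x => ‖fderiv ℝ u x‖ₑ ^ 2) (by fun_prop)
      _ = _ := by simp
  calc _ ≤ 16 * ENNReal.ofReal (R ^ 2) * (8 * volume (ball (0 : E3) R) *
        ∫⁻ x in ball (0 : E3) R, ‖fderiv ℝ u x‖ₑ ^ 2) := by gcongr
    _ = _ := by ring

lemma ENNReal.add_sq_le_two (a b : ℝ≥0∞) : (a + b) ^ 2 ≤ 2 * a ^ 2 + 2 * b ^ 2 := by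
  have := ENNReal.rpow_add_le_mul_rpow_add_rpow a b (p := 2) (by norm_num)
  norm_num at this
  rw [mul_add] at this
  exact_mod_cast this

lemma volume_mul_lintegral_cube_le {u : E3 → ℝ} (hu : ContDiff ℝ 1 u) {R τ : ℝ} (hR : 0 < R)
    (hτ : 0 < τ) (hτ1 : τ ≤ 1) :
    volume (ball (0 : E3) R) * ∫⁻ x in ball (0 : E3) R, ‖u x‖ₑ ^ 3
      ≤ (8 * volume (ball (0 : E3) R)) ^ (1 / 2 : ℝ) *
        (∫⁻ x in ball (0 : E3) R, ‖u x‖ₑ ^ 2) ^ (1 / 2 : ℝ) *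
        (128 * ENNReal.ofReal (R ^ 2) * ENNReal.ofReal (τ ^ (1 / 2 : ℝ)) *
          (∫⁻ x in ball (0 : E3) R, ‖fderiv ℝ u x‖ₑ ^ 2) +
        2 * ENNReal.ofReal (τ ^ (-(3 / 2) : ℝ)) * ∫⁻ x in ball (0 : E3) R, ‖u x‖ₑ ^ 2) := by
  have hfd : Continuous (fderiv ℝ u) := hu.continuous_fderiv (by norm_num)
  have huc : Continuous u := hu.continuous
  set μ := (volume : Measure E3).restrict (ball (0 : E3) R) with hμ
  set V := volume (ball (0 : E3) R) with hV
  set a2 := ∫⁻ x, ‖u x‖ₑ ^ 2 ∂μ with ha2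
  set b2 := ∫⁻ x, ‖fderiv ℝ u x‖ₑ ^ 2 ∂μ with hb2
  have hI2 := lintegral_mul_segment_le (R := R) hτ hτ1 (f := fun x => ‖u x‖ₑ)
    (h := fun x => ‖u x‖ₑ ^ 2) (by fun_prop) (by fun_prop)
  have hI1 := lintegral_mul_increment_sq_le hu hR hτ (f := fun x => ‖u x‖ₑ) (by fun_prop)
  rw [← hμ] at hI1
  rw [← hμ, ← hV] at hI2
  have hs : ∫⁻ s in Ioc 0 τ, ENNReal.ofReal (s ^ (3 / 4 : ℝ)) *
          ∫⁻ x, ∫⁻ y, ‖u x‖ₑ * ‖fderiv ℝ u (x + s • (y - x))‖ₑ ^ 2 ∂μ ∂μ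
      ≤ 4 * ENNReal.ofReal (τ ^ (1 / 4 : ℝ)) * ((8 * V) ^ (1 / 2 : ℝ) * a2 ^ (1 / 2 : ℝ) * b2) := by
    calc _ ≤ ∫⁻ s in Ioc 0 τ, ENNReal.ofReal (s ^ (-(3 / 4) : ℝ)) *
          ((8 * V) ^ (1 / 2 : ℝ) * a2 ^ (1 / 2 : ℝ) * b2) := by
          refine setLIntegral_mono' measurableSet_Ioc fun s hs => ?_
          have h := lintegral_mul_segment_le (R := R) hs.1 (hs.2.trans hτ1) (f := fun x => ‖u x‖ₑ)
            (h := fun x => ‖fderiv ℝ u x‖ₑ ^ 2) (by fun_prop) (by fun_prop)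
          calc _ ≤ ENNReal.ofReal (s ^ (3 / 4 : ℝ)) * _ := mul_le_mul_right h _
            _ = (ENNReal.ofReal (s ^ (3 / 4 : ℝ)) * ENNReal.ofReal (s ^ (-(3 / 2) : ℝ))) *
                ((8 * V) ^ (1 / 2 : ℝ) * a2 ^ (1 / 2 : ℝ) * b2) := by ring
            _ = _ := by
              rw [← ENNReal.ofReal_mul (Real.rpow_nonneg hs.1.le _), ← Real.rpow_add hs.1]
              norm_num
      _ = _ := by
          rw [lintegral_mul_const _ (by fun_prop), lintegral_rpow_Ioc (by norm_num) hτ.le,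
            show τ ^ (-(3 / 4) + 1 : ℝ) / (-(3 / 4) + 1) = 4 * τ ^ (1 / 4 : ℝ) by
              norm_num; ring, ENNReal.ofReal_mul (by norm_num)]
          norm_num
  have hsplit : V * ∫⁻ x, ‖u x‖ₑ ^ 3 ∂μ ≤
      2 * ∫⁻ x, ∫⁻ y, ‖u x‖ₑ * ‖u (x + τ • (y - x)) - u x‖ₑ ^ 2 ∂μ ∂μ +
      2 * ∫⁻ x, ∫⁻ y, ‖u x‖ₑ * ‖u (x + τ • (y - x))‖ₑ ^ 2 ∂μ ∂μ := by
    have h1 : V * ∫⁻ x, ‖u x‖ₑ ^ 3 ∂μ = ∫⁻ x, ∫⁻ y, ‖u x‖ₑ ^ 3 ∂μ ∂μ := by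
      simp_rw [lintegral_const]
      rw [lintegral_mul_const _ (by fun_prop), hμ, Measure.restrict_apply_univ, mul_comm]
    have m1 : Measurable fun z : E3 × E3 =>
      ‖u z.1‖ₑ * ‖u (z.1 + τ • (z.2 - z.1)) - u z.1‖ₑ ^ 2 := by fun_prop
    have m2 : Measurable fun z : E3 × E3 =>
      ‖u z.1‖ₑ * ‖u (z.1 + τ • (z.2 - z.1))‖ₑ ^ 2 := by fun_prop
    rw [h1, ← lintegral_const_mul _ m1.lintegral_prod_right',
      ← lintegral_const_mul _ m2.lintegral_prod_right',
      ← lintegral_add_left (m1.lintegral_prod_right'.const_mul 2)]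
    refine lintegral_mono fun x => ?_
    dsimp only
    have n1 : Measurable fun y : E3 => ‖u x‖ₑ * ‖u (x + τ • (y - x)) - u x‖ₑ ^ 2 :=
      m1.comp measurable_prodMk_left
    have n2 : Measurable fun y : E3 => ‖u x‖ₑ * ‖u (x + τ • (y - x))‖ₑ ^ 2 :=
      m2.comp measurable_prodMk_left
    rw [← lintegral_const_mul _ n1, ← lintegral_const_mul _ n2,
      ← lintegral_add_left (n1.const_mul 2)]
    refine lintegral_mono fun y => ?_
    have h2 : ‖u x‖ₑ ^ 2 ≤ 2 * ‖u (x + τ • (y - x)) - u x‖ₑ ^ 2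
        + 2 * ‖u (x + τ • (y - x))‖ₑ ^ 2 := by
      refine le_trans ?_ (ENNReal.add_sq_le_two _ _)
      gcongr
      rw [add_comm, ← enorm_sub_rev]
      refine le_trans (le_of_eq ?_) (enorm_add_le _ _)
      congr 1; ring
    calc ‖u x‖ₑ ^ 3 = ‖u x‖ₑ * ‖u x‖ₑ ^ 2 := by ring
      _ ≤ ‖u x‖ₑ * _ := mul_le_mul_right h2 _
      _ = _ := by ring
  have hq : ENNReal.ofReal (τ ^ (1 / 4 : ℝ)) * ENNReal.ofReal (τ ^ (1 / 4 : ℝ))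
      = ENNReal.ofReal (τ ^ (1 / 2 : ℝ)) := by
    rw [← ENNReal.ofReal_mul (Real.rpow_nonneg hτ.le _), ← Real.rpow_add hτ]; norm_num
  calc _ ≤ _ := hsplit
    _ ≤ 2 * (16 * ENNReal.ofReal (R ^ 2) * ENNReal.ofReal (τ ^ (1 / 4 : ℝ)) *
        (4 * ENNReal.ofReal (τ ^ (1 / 4 : ℝ)) * ((8 * V) ^ (1 / 2 : ℝ) * a2 ^ (1 / 2 : ℝ) * b2))) +
        2 * ((8 * V) ^ (1 / 2 : ℝ) * ENNReal.ofReal (τ ^ (-(3 / 2) : ℝ)) *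
          a2 ^ (1 / 2 : ℝ) * a2) := by
        gcongr
        exact hI1.trans (mul_le_mul_right hs _)
    _ = _ := by rw [← hq]; ring

/-- `G` dominates the weak gradient of `u` on the ball of radius `R`. -/
def HasWeakGradBound (u G : E3 → ℝ) (R : ℝ) : Prop :=
  ∀ φ : E3 → ℝ, ContDiff ℝ (⊤ : ℕ∞) φ → tsupport φ ⊆ ball 0 R →
    ∀ j : Fin 3, |∫ x in ball 0 R, u x * fderiv ℝ φ x (EuclideanSpace.single j (1 : ℝ))|
      ≤ ∫ x in ball 0 R, G x * |φ x|

lemma lintegral_sq_average_translate_le {ψ H : E3 → ℝ≥0∞} (hψ : Measurable ψ)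
    (hψ1 : ∫⁻ y, ψ y = 1) (hH : AEMeasurable H) :
    ∫⁻ x, (∫⁻ y, ψ y * H (x - y)) ^ 2 ≤ ∫⁻ x, H x ^ 2 := by
  wlog hHm : Measurable H generalizing H
  · have e1 : ∀ x, ∫⁻ y, ψ y * H (x - y) = ∫⁻ y, ψ y * hH.mk H (x - y) := by
      intro x
      refine lintegral_congr_ae ?_
      have := (Measure.measurePreserving_sub_left (volume : Measure E3) x).quasiMeasurePreserving.ae_eq
        hH.ae_eq_mk
      filter_upwards [this] with y hy
      simp only [Function.comp] at hy
      rw [hy]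
    have e2 : ∫⁻ x, H x ^ 2 = ∫⁻ x, hH.mk H x ^ 2 := by
      refine lintegral_congr_ae ?_
      filter_upwards [hH.ae_eq_mk] with y hy
      rw [hy]
    simp_rw [e1, e2]
    exact this hH.measurable_mk.aemeasurable hH.measurable_mk
  calc ∫⁻ x, (∫⁻ y, ψ y * H (x - y)) ^ 2
      ≤ ∫⁻ x, ∫⁻ y, ψ y * H (x - y) ^ 2 := by
        refine lintegral_mono fun x => ?_
        have := ENNReal.lintegral_mul_norm_pow_le (μ := (volume : Measure E3)) (f := ψ)
          (g := fun y => ψ y * H (x - y) ^ 2) (by fun_prop) (by fun_prop) (p := 1 / 2) (q := 1 / 2)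
          (by norm_num) (by norm_num) (by norm_num)
        rw [hψ1, ENNReal.one_rpow, one_mul] at this
        calc (∫⁻ y, ψ y * H (x - y)) ^ 2
            ≤ ((∫⁻ y, ψ y * H (x - y) ^ 2) ^ (1 / 2 : ℝ)) ^ 2 := by
              gcongr
              refine le_trans (lintegral_mono fun y => ?_) this
              rw [ENNReal.mul_rpow_of_nonneg _ _ (by norm_num), ENNReal.sq_rpow_half, ← mul_assoc,
                ← sq, ENNReal.rpow_half_sq]
          _ = _ := ENNReal.rpow_half_sq _
    _ = ∫⁻ y, ∫⁻ x, ψ y * H (x - y) ^ 2 := by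
        rw [lintegral_lintegral_swap]
        apply Measurable.aemeasurable
        simp only [Function.uncurry_def]
        fun_prop
    _ = ∫⁻ y, ψ y * ∫⁻ x, H x ^ 2 := by
        refine lintegral_congr fun y => ?_
        rw [lintegral_const_mul _ (by fun_prop), lintegral_sub_right_eq_self (fun x => H x ^ 2)]
    _ = _ := by rw [lintegral_mul_const _ hψ, hψ1, one_mul]

lemma enorm_clm_le_of_basis {L : E3 →L[ℝ] ℝ} {M : ℝ≥0∞}
    (h : ∀ j, ‖L (EuclideanSpace.single j (1 : ℝ))‖ₑ ≤ M) : ‖L‖ₑ ≤ 3 * M := by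
  rcases eq_or_ne M ∞ with rfl | hM
  · simp
  have h' : ∀ j, ‖L (EuclideanSpace.single j (1 : ℝ))‖ ≤ M.toReal := fun j => by
    rw [← toReal_enorm]; exact ENNReal.toReal_mono hM (h j)
  have hL : ‖L‖ ≤ 3 * M.toReal := by
    refine L.opNorm_le_bound (by positivity) fun x => ?_
    have hx : L x = ∑ j, x j * L (EuclideanSpace.single j (1 : ℝ)) := by
      conv_lhs => rw [← (EuclideanSpace.basisFun (Fin 3) ℝ).sum_repr x]
      simp
    rw [hx]
    calc ‖∑ j, x j * L (EuclideanSpace.single j (1 : ℝ))‖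
        ≤ ∑ j, ‖x j * L (EuclideanSpace.single j (1 : ℝ))‖ := norm_sum_le _ _
      _ ≤ ∑ _j : Fin 3, ‖x‖ * M.toReal := by
          refine Finset.sum_le_sum fun j _ => ?_
          rw [norm_mul]
          exact mul_le_mul (PiLp.norm_apply_le x j) (h' j) (norm_nonneg _) (norm_nonneg _)
      _ = _ := by simp; ring
  rw [← ofReal_norm, ← ENNReal.ofReal_toReal hM, show (3 : ℝ≥0∞) = ENNReal.ofReal 3 by norm_num,
    ← ENNReal.ofReal_mul (by norm_num)]
  exact ENNReal.ofReal_le_ofReal hL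

open scoped Convolution in
lemma exists_smooth_approx {u G : E3 → ℝ} {R : ℝ} (hR : 0 < R)
    (hum : AEStronglyMeasurable u (volume.restrict (ball 0 R)))
    (hu2 : ∫⁻ x in ball 0 R, ‖u x‖ₑ ^ 2 ≠ ∞)
    (hGm : AEStronglyMeasurable G (volume.restrict (ball 0 R)))
    (hG2 : ∫⁻ x in ball 0 R, ‖G x‖ₑ ^ 2 ≠ ∞)
    (hw : HasWeakGradBound u G R) :
    ∃ (w : ℕ → E3 → ℝ) (ρ : ℕ → ℝ), (∀ n, ContDiff ℝ 1 (w n)) ∧ (∀ n, R / 2 ≤ ρ n ∧ ρ n < R) ∧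
      Filter.Tendsto ρ Filter.atTop (𝓝 R) ∧
      (∀ᵐ x ∂(volume.restrict (ball (0 : E3) R)),
        Filter.Tendsto (fun n => w n x) Filter.atTop (𝓝 (u x))) ∧
      (∀ n, ∫⁻ x in ball 0 (ρ n), ‖w n x‖ₑ ^ 2 ≤ ∫⁻ x in ball 0 R, ‖u x‖ₑ ^ 2) ∧
      (∀ n, ∫⁻ x in ball 0 (ρ n), ‖fderiv ℝ (w n) x‖ₑ ^ 2
        ≤ 9 * ∫⁻ x in ball 0 R, ‖G x‖ₑ ^ 2) := by
  have int_of : ∀ f : E3 → ℝ, AEStronglyMeasurable f (volume.restrict (ball 0 R)) →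
      ∫⁻ x in ball 0 R, ‖f x‖ₑ ^ 2 ≠ ∞ → IntegrableOn f (ball 0 R) := by
    intro f hf hf2
    have : MemLp f 2 (volume.restrict (ball (0 : E3) R)) := by
      refine ⟨hf, ?_⟩
      rw [eLpNorm_lt_top_iff_lintegral_rpow_enorm_lt_top (by norm_num) (by norm_num)]
      simpa using hf2.lt_top
    have hfin : IsFiniteMeasure ((volume : Measure E3).restrict (ball 0 R)) :=
      ⟨by
      simpa using measure_ball_lt_top (μ := (volume : Measure E3)) (x := 0) (r := R)⟩
    exact this.integrable (by norm_num)
  have hui := int_of u hum hu2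
  have hGi := int_of G hGm hG2
  set U : E3 → ℝ := (ball (0 : E3) R).indicator u with hU
  set Γ : E3 → ℝ := (ball (0 : E3) R).indicator G with hΓ
  have hUi : Integrable U := (integrable_indicator_iff measurableSet_ball).2 hui
  have hΓi : Integrable Γ := (integrable_indicator_iff measurableSet_ball).2 hGi
  have sq_ind : ∀ f : E3 → ℝ, ∫⁻ x, ‖(ball (0 : E3) R).indicator f x‖ₑ ^ 2
      = ∫⁻ x in ball 0 R, ‖f x‖ₑ ^ 2 := by
    intro f
    rw [← lintegral_indicator measurableSet_ball]
    refine lintegral_congr fun x => ?_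
    by_cases hx : x ∈ ball (0 : E3) R
    · rw [indicator_of_mem hx, indicator_of_mem hx]
    · rw [indicator_of_notMem hx, indicator_of_notMem hx]; simp
  let r : ℕ → ℝ := fun n => R / (n + 2)
  have hr0 : ∀ n, 0 < r n := fun n => by positivity
  have hrR : ∀ n, r n ≤ R / 2 := fun n => by
    apply div_le_div_of_nonneg_left hR.le (by norm_num)
    have : (0 : ℝ) ≤ n := Nat.cast_nonneg n
    linarith
  have hrt : Filter.Tendsto r Filter.atTop (𝓝 0) :=
    tendsto_const_nhds.div_atTop
      (Filter.tendsto_atTop_add_const_right _ _ tendsto_natCast_atTop_atTop)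
  let b : ℕ → ContDiffBump (0 : E3) := fun n =>
    ⟨r n / 2, r n, by have := hr0 n; positivity, by have := hr0 n; linarith⟩
  let ψ : ℕ → E3 → ℝ := fun n => (b n).normed volume
  have hψs : ∀ n, ContDiff ℝ (⊤ : ℕ∞) (ψ n) := fun n => (b n).contDiff_normed
  have hψc : ∀ n, Continuous (ψ n) := fun n => (hψs n).continuous
  have hψ0 : ∀ n x, 0 ≤ ψ n x := fun n x => (b n).nonneg_normed x
  have hψsupp : ∀ n, HasCompactSupport (ψ n) := fun n => (b n).hasCompactSupport_normed
  have hψ1 : ∀ n, ∫⁻ y, ‖ψ n y‖ₑ = 1 := by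
    intro n
    have h1 : ∫⁻ y, ‖ψ n y‖ₑ = ENNReal.ofReal (∫ y, ψ n y) := by
      rw [ofReal_integral_eq_lintegral_ofReal (b n).integrable_normed
        (Filter.Eventually.of_forall (hψ0 n))]
      exact lintegral_congr fun y => Real.enorm_eq_ofReal (hψ0 n y)
    rw [h1, (b n).integral_normed, ENNReal.ofReal_one]
  let w : ℕ → E3 → ℝ := fun n =>
    ((b n).normed volume ⋆[ContinuousLinearMap.lsmul ℝ ℝ, volume] U)
  have hwd : ∀ n x, HasFDerivAt (w n) ((fderiv ℝ (ψ n) ⋆[(ContinuousLinearMap.lsmul ℝ ℝ).precompL E3,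
      volume] U) x) x := fun n x =>
    (hψsupp n).hasFDerivAt_convolution_left _ ((hψs n).of_le (by exact_mod_cast le_top))
      hUi.locallyIntegrable x
  refine ⟨w, fun n => R - r n, ?_, ?_, ?_, ?_, ?_, ?_⟩
  · intro n
    exact (hψsupp n).contDiff_convolution_left (n := 1) _
      ((hψs n).of_le (by exact_mod_cast le_top)) hUi.locallyIntegrable
  · intro n
    exact ⟨by linarith [hrR n], by linarith [hr0 n]⟩
  · simpa using hrt.const_sub R
  · have := ContDiffBump.ae_convolution_tendsto_right_of_locallyIntegrable (φ := b)
      (l := Filter.atTop) (K := 2) (g := U) (μ := volume) hrt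
      (Filter.Eventually.of_forall fun n => by simp only [b]; linarith) hUi.locallyIntegrable
    filter_upwards [ae_restrict_of_ae this, ae_restrict_mem measurableSet_ball] with x hx hxm
    rwa [hU, indicator_of_mem hxm] at hx
  · intro n
    rw [← sq_ind]
    refine (lintegral_mono' Measure.restrict_le_self le_rfl).trans ?_
    refine le_trans (lintegral_mono fun x => ?_)
      (lintegral_sq_average_translate_le (ψ := fun y => ‖ψ n y‖ₑ) (H := fun y => ‖U y‖ₑ)
        (hψc n).measurable.enorm (hψ1 n) hUi.aestronglyMeasurable.enorm)
    dsimp only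
    gcongr
    refine (enorm_integral_le_lintegral_enorm _).trans (le_of_eq ?_)
    simp [ψ]
  · intro n
    have key : ∀ x ∈ ball (0 : E3) (R - r n), ‖fderiv ℝ (w n) x‖ₑ ≤
        3 * ∫⁻ y, ‖ψ n y‖ₑ * ‖Γ (x - y)‖ₑ := by
      intro x hx
      refine enorm_clm_le_of_basis fun j => ?_
      set e := (EuclideanSpace.single j (1 : ℝ) : E3)
      have hconv := ((hψsupp n).fderiv (𝕜 := ℝ)).convolutionExists_left
        ((ContinuousLinearMap.lsmul ℝ ℝ).precompL E3) (μ := volume)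
        ((hψs n).continuous_fderiv (by simp)) hUi.locallyIntegrable x
      set φ : E3 → ℝ := fun y => ψ n (x - y) with hφ
      have hφd : ∀ y, fderiv ℝ φ y e = - fderiv ℝ (ψ n) (x - y) e := by
        intro y
        have h1 : HasFDerivAt φ ((fderiv ℝ (ψ n) (x - y)).comp (-ContinuousLinearMap.id ℝ E3)) y := by
          have h2 := ((hψs n).differentiable (by simp) (x - y)).hasFDerivAt
          exact h2.comp y ((hasFDerivAt_id y).const_sub x)
        rw [h1.fderiv]; simp
      have hφt : tsupport φ ⊆ ball 0 R := by
        have h1 : tsupport φ ⊆ closedBall x (r n) := by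
          refine closure_minimal (fun y hy => ?_) isClosed_closedBall
          have : x - y ∈ Function.support ((b n).normed volume) := hy
          rw [(b n).support_normed_eq, mem_ball_zero_iff] at this
          rw [mem_closedBall', dist_eq_norm]
          exact this.le
        refine h1.trans fun y hy => ?_
        rw [mem_closedBall', dist_eq_norm] at hy
        rw [mem_ball_zero_iff] at hx ⊢
        have := norm_sub_norm_le y x
        rw [norm_sub_rev] at hy
        linarith
      have hbd := hw φ ((hψs n).comp (contDiff_const.sub contDiff_id)) hφt j
      have e1 : fderiv ℝ (w n) x e = - ∫ y in ball 0 R, u y * fderiv ℝ φ y e := by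
        rw [(hwd n x).fderiv, convolution_def, ContinuousLinearMap.integral_apply hconv,
          ← integral_indicator measurableSet_ball, ← integral_neg,
          ← integral_sub_left_eq_self _ volume x]
        refine integral_congr_ae (Filter.Eventually.of_forall fun y => ?_)
        by_cases hy : y ∈ ball (0 : E3) R
        · simp [hU, hφd, hy, mul_comm]
        · simp [hU, hy]
      have e2 : ∫⁻ y, ‖ψ n y‖ₑ * ‖Γ (x - y)‖ₑ = ∫⁻ y in ball 0 R, ‖G y * |φ y|‖ₑ := by
        rw [← lintegral_indicator measurableSet_ball, ← lintegral_sub_left_eq_self _ x]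
        refine lintegral_congr fun y => ?_
        by_cases hy : y ∈ ball (0 : E3) R
        · simp [hΓ, hy, hφ, mul_comm]
        · simp [hΓ, hy]
      rw [e1, e2, enorm_neg, Real.enorm_eq_ofReal_abs]
      refine (ENNReal.ofReal_le_ofReal hbd).trans ?_
      refine (ENNReal.ofReal_le_ofReal (le_abs_self _)).trans ?_
      rw [← Real.enorm_eq_ofReal_abs]
      exact enorm_integral_le_lintegral_enorm _
    calc _ ≤ ∫⁻ x in ball (0 : E3) (R - r n), 9 * (∫⁻ y, ‖ψ n y‖ₑ * ‖Γ (x - y)‖ₑ) ^ 2 := by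
          refine setLIntegral_mono' measurableSet_ball fun x hx => ?_
          calc _ ≤ (3 * ∫⁻ y, ‖ψ n y‖ₑ * ‖Γ (x - y)‖ₑ) ^ 2 := by gcongr; exact key x hx
            _ = _ := by rw [mul_pow]; norm_num
      _ ≤ ∫⁻ x, 9 * (∫⁻ y, ‖ψ n y‖ₑ * ‖Γ (x - y)‖ₑ) ^ 2 :=
          lintegral_mono' Measure.restrict_le_self le_rfl
      _ = 9 * ∫⁻ x, (∫⁻ y, ‖ψ n y‖ₑ * ‖Γ (x - y)‖ₑ) ^ 2 := lintegral_const_mul' _ _ (by simp)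
      _ ≤ 9 * ∫⁻ x in ball 0 R, ‖G x‖ₑ ^ 2 := by
          rw [← sq_ind]
          exact mul_le_mul_right (lintegral_sq_average_translate_le (ψ := fun y => ‖ψ n y‖ₑ)
            (H := fun y => ‖Γ y‖ₑ) (hψc n).measurable.enorm (hψ1 n)
            hΓi.aestronglyMeasurable.enorm) _

lemma lintegral_le_of_tendsto_of_eventually_mem {α : Type*} [MeasurableSpace α] {μ : Measure α}
    {S : ℕ → Set α} (hS : ∀ n, MeasurableSet (S n)) (hmem : ∀ᵐ x ∂μ, ∀ᶠ n in atTop, x ∈ S n)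
    {f : ℕ → α → ℝ≥0∞} {g : α → ℝ≥0∞} {K : ℝ≥0∞} (hf : ∀ n, Measurable (f n))
    (hlim : ∀ᵐ x ∂μ, Tendsto (fun n => f n x) atTop (𝓝 (g x)))
    (hK : ∀ n, ∫⁻ x in S n, f n x ∂μ ≤ K) : ∫⁻ x, g x ∂μ ≤ K := by
  calc ∫⁻ x, g x ∂μ = ∫⁻ x, liminf (fun n => (S n).indicator (f n) x) atTop ∂μ := by
        refine lintegral_congr_ae ?_
        filter_upwards [hmem, hlim] with x hx hl
        symm
        refine Tendsto.liminf_eq (hl.congr' ?_)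
        filter_upwards [hx] with n hn
        rw [indicator_of_mem hn]
    _ ≤ liminf (fun n => ∫⁻ x, (S n).indicator (f n) x ∂μ) atTop :=
        lintegral_liminf_le fun n => (hf n).indicator (hS n)
    _ ≤ K := by
        refine liminf_le_of_le (by isBoundedDefault) fun b hb => ?_
        obtain ⟨n, hn⟩ := hb.exists
        rw [lintegral_indicator (hS n)] at hn
        exact hn.trans (hK n)

lemma eventually_mem_ball_of_tendsto {ρ : ℕ → ℝ} {R : ℝ} (h : Tendsto ρ atTop (𝓝 R)) {x : E3}
    (hx : x ∈ ball (0 : E3) R) : ∀ᶠ n in atTop, x ∈ ball (0 : E3) (ρ n) := by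
  simp only [mem_ball_zero_iff] at hx ⊢
  exact h.eventually_const_lt hx

section WeakGradient

variable {u G : E3 → ℝ} {R : ℝ}

lemma lintegral_lintegral_sub_sq_le_of_weakGrad (hR : 0 < R)
    (hum : AEStronglyMeasurable u (volume.restrict (ball 0 R)))
    (hu2 : ∫⁻ x in ball 0 R, ‖u x‖ₑ ^ 2 ≠ ∞)
    (hGm : AEStronglyMeasurable G (volume.restrict (ball 0 R)))
    (hG2 : ∫⁻ x in ball 0 R, ‖G x‖ₑ ^ 2 ≠ ∞) (hw : HasWeakGradBound u G R) :
    ∫⁻ x in ball (0 : E3) R, ∫⁻ y in ball (0 : E3) R, ‖u y - u x‖ₑ ^ 2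
      ≤ 1152 * ENNReal.ofReal (R ^ 2) * volume (ball (0 : E3) R) *
        ∫⁻ x in ball (0 : E3) R, ‖G x‖ₑ ^ 2 := by
  obtain ⟨w, ρ, hwC, hρ, hρR, hlim, hwu, hwG⟩ := exists_smooth_approx hR hum hu2 hGm hG2 hw
  set μ := (volume : Measure E3).restrict (ball (0 : E3) R) with hμ
  have hprod : ∫⁻ x, ∫⁻ y, ‖u y - u x‖ₑ ^ 2 ∂μ ∂μ
      = ∫⁻ z, ‖u z.2 - u z.1‖ₑ ^ 2 ∂(μ.prod μ) := by
    rw [lintegral_prod]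
    have h1 := hum.comp_fst (ν := μ)
    have h2 := hum.comp_snd (μ := μ)
    exact ((h2.sub h1).enorm.pow_const 2)
  rw [hprod]
  have hball : ∀ n, ball (0 : E3) (ρ n) ⊆ ball 0 R := fun n => ball_subset_ball (hρ n).2.le
  refine lintegral_le_of_tendsto_of_eventually_mem (S := fun n => ball 0 (ρ n) ×ˢ ball 0 (ρ n))
    (f := fun n z => ‖w n z.2 - w n z.1‖ₑ ^ 2) (fun n => measurableSet_ball.prod measurableSet_ball)
    ?_ ?_ ?_ ?_
  · have h0 : ∀ᵐ x ∂μ, ∀ᶠ n in atTop, x ∈ ball (0 : E3) (ρ n) := by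
      filter_upwards [ae_restrict_mem measurableSet_ball] with x hx
      exact eventually_mem_ball_of_tendsto hρR hx
    filter_upwards [Measure.quasiMeasurePreserving_fst.ae h0,
      Measure.quasiMeasurePreserving_snd.ae h0] with z h1 h2
    filter_upwards [h1, h2] with n h1 h2 using ⟨h1, h2⟩
  · intro n
    have := (hwC n).continuous
    fun_prop
  · filter_upwards [Measure.quasiMeasurePreserving_fst.ae hlim,
      Measure.quasiMeasurePreserving_snd.ae hlim] with z h1 h2
    exact ENNReal.Tendsto.pow ((h2.sub h1).enorm)
  · intro n
    have hρ0 : 0 < ρ n := by linarith [(hρ n).1]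
    rw [← Measure.prod_restrict, hμ, Measure.restrict_restrict_of_subset (hball n),
      lintegral_prod _ (by have := (hwC n).continuous; fun_prop)]
    refine (lintegral_lintegral_sub_sq_le (hwC n) hρ0).trans ?_
    calc _ ≤ 128 * ENNReal.ofReal (R ^ 2) * volume (ball (0 : E3) R) *
          (9 * ∫⁻ x in ball (0 : E3) R, ‖G x‖ₑ ^ 2) := by
          refine mul_le_mul' (mul_le_mul' (mul_le_mul' le_rfl (ENNReal.ofReal_le_ofReal ?_))
            (measure_mono (hball n))) (hwG n)
          have := (hρ n).2.le
          gcongr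
      _ = _ := by ring

lemma volume_ball_le_eight_mul {r : ℝ} (hr : R / 2 ≤ r) :
    volume (ball (0 : E3) R) ≤ 8 * volume (ball (0 : E3) r) := by
  simp only [EuclideanSpace.volume_ball_fin_three]
  have : ENNReal.ofReal R ≤ 2 * ENNReal.ofReal r := by
    rw [show (2 : ℝ≥0∞) = ENNReal.ofReal 2 by simp, ← ENNReal.ofReal_mul (by norm_num)]
    exact ENNReal.ofReal_le_ofReal (by linarith)
  calc _ ≤ (2 * ENNReal.ofReal r) ^ 3 * ENNReal.ofReal (Real.pi * 4 / 3) := by gcongr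
    _ = _ := by ring

lemma volume_mul_lintegral_cube_le_of_weakGrad (hR : 0 < R)
    (hum : AEStronglyMeasurable u (volume.restrict (ball 0 R)))
    (hu2 : ∫⁻ x in ball 0 R, ‖u x‖ₑ ^ 2 ≠ ∞)
    (hGm : AEStronglyMeasurable G (volume.restrict (ball 0 R)))
    (hG2 : ∫⁻ x in ball 0 R, ‖G x‖ₑ ^ 2 ≠ ∞) (hw : HasWeakGradBound u G R)
    {τ : ℝ} (hτ : 0 < τ) (hτ1 : τ ≤ 1) :
    volume (ball (0 : E3) R) * ∫⁻ x in ball (0 : E3) R, ‖u x‖ₑ ^ 3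
      ≤ 8 * ((8 * volume (ball (0 : E3) R)) ^ (1 / 2 : ℝ) *
        (∫⁻ x in ball (0 : E3) R, ‖u x‖ₑ ^ 2) ^ (1 / 2 : ℝ) *
        (1152 * ENNReal.ofReal (R ^ 2) * ENNReal.ofReal (τ ^ (1 / 2 : ℝ)) *
          (∫⁻ x in ball (0 : E3) R, ‖G x‖ₑ ^ 2) +
        2 * ENNReal.ofReal (τ ^ (-(3 / 2) : ℝ)) * ∫⁻ x in ball (0 : E3) R, ‖u x‖ₑ ^ 2)) := by
  obtain ⟨w, ρ, hwC, hρ, hρR, hlim, hwu, hwG⟩ := exists_smooth_approx hR hum hu2 hGm hG2 hw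
  set μ := (volume : Measure E3).restrict (ball (0 : E3) R) with hμ
  have hball : ∀ n, ball (0 : E3) (ρ n) ⊆ ball 0 R := fun n => ball_subset_ball (hρ n).2.le
  set V := volume (ball (0 : E3) R) with hV
  have hVtop : V ≠ ∞ := measure_ball_lt_top.ne
  rw [← lintegral_const_mul' _ _ hVtop]
  refine lintegral_le_of_tendsto_of_eventually_mem (S := fun n => ball 0 (ρ n))
    (f := fun n x => V * ‖w n x‖ₑ ^ 3) (fun n => measurableSet_ball)
    ?_ ?_ ?_ ?_
  · filter_upwards [ae_restrict_mem measurableSet_ball] with x hx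
    exact eventually_mem_ball_of_tendsto hρR hx
  · intro n
    have := (hwC n).continuous
    fun_prop
  · filter_upwards [hlim] with x h1
    exact ENNReal.Tendsto.const_mul (ENNReal.Tendsto.pow h1.enorm) (Or.inr hVtop)
  · intro n
    have hρ0 : 0 < ρ n := by linarith [(hρ n).1]
    rw [hμ, Measure.restrict_restrict_of_subset (hball n), lintegral_const_mul' _ _ hVtop]
    calc _ ≤ 8 * volume (ball (0 : E3) (ρ n)) * ∫⁻ x in ball (0 : E3) (ρ n), ‖w n x‖ₑ ^ 3 :=
          mul_le_mul' (volume_ball_le_eight_mul (hρ n).1) le_rfl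
      _ = 8 * (volume (ball (0 : E3) (ρ n)) * ∫⁻ x in ball (0 : E3) (ρ n), ‖w n x‖ₑ ^ 3) := by
          ring
      _ ≤ 8 * ((8 * V) ^ (1 / 2 : ℝ) * (∫⁻ x, ‖u x‖ₑ ^ 2 ∂μ) ^ (1 / 2 : ℝ) *
        (128 * ENNReal.ofReal (R ^ 2) * ENNReal.ofReal (τ ^ (1 / 2 : ℝ)) *
          (9 * ∫⁻ x, ‖G x‖ₑ ^ 2 ∂μ) +
        2 * ENNReal.ofReal (τ ^ (-(3 / 2) : ℝ)) * ∫⁻ x, ‖u x‖ₑ ^ 2 ∂μ)) := by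
          refine mul_le_mul' le_rfl ((volume_mul_lintegral_cube_le (hwC n) hρ0 hτ hτ1).trans ?_)
          have hRR : ENNReal.ofReal (ρ n ^ 2) ≤ ENNReal.ofReal (R ^ 2) :=
            ENNReal.ofReal_le_ofReal (by have := (hρ n).2.le; gcongr)
          have hVV : volume (ball (0 : E3) (ρ n)) ≤ V := measure_mono (hball n)
          refine mul_le_mul' (mul_le_mul' ?_ ?_) (add_le_add ?_ ?_)
          · exact ENNReal.rpow_le_rpow (mul_le_mul' le_rfl hVV) (by norm_num)
          · exact ENNReal.rpow_le_rpow (hwu n) (by norm_num)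
          · exact mul_le_mul' (mul_le_mul' (mul_le_mul' le_rfl hRR) le_rfl) (hwG n)
          · exact mul_le_mul' le_rfl (hwu n)
      _ = _ := by ring

lemma volume_mul_enorm_avgB_sub_sq_le (hR : 0 < R) (hu : IntegrableOn u (ball 0 R)) (k : ℝ) :
    volume (ball (0 : E3) R) * ‖avgB R u - k‖ₑ ^ 2
      ≤ ∫⁻ y in ball (0 : E3) R, ‖u y - k‖ₑ ^ 2 := by
  set μ := (volume : Measure E3).restrict (ball (0 : E3) R) with hμ
  set V := volume (ball (0 : E3) R) with hV
  have hVtop : V ≠ ∞ := measure_ball_lt_top.ne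
  have hV0 : V ≠ 0 := (measure_ball_pos _ _ hR).ne'
  have hfin : IsFiniteMeasure μ := ⟨by
    rw [hμ, Measure.restrict_apply_univ]
    exact hVtop.lt_top⟩
  have hVr : μ.real univ = V.toReal := by simp [hμ, Measure.real, hV]
  have h1 : V.toReal * (avgB R u - k) = ∫ y, (u y - k) ∂μ := by
    have h0 : avgB R u = (μ.real univ)⁻¹ • ∫ y, u y ∂μ := average_eq _ _
    rw [integral_sub hu (integrable_const k), integral_const, h0, hVr, smul_eq_mul, smul_eq_mul]
    have := (ENNReal.toReal_pos hV0 hVtop).ne'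
    field_simp
    rw [hμ]
  have h2 : V * ‖avgB R u - k‖ₑ ≤ ∫⁻ y, ‖u y - k‖ₑ ∂μ := by
    have := enorm_integral_le_lintegral_enorm (μ := μ) (fun y => u y - k)
    rw [← h1, enorm_mul, Real.enorm_of_nonneg ENNReal.toReal_nonneg,
      ENNReal.ofReal_toReal hVtop] at this
    exact this
  have h3 := sq_lintegral_mul_le (μ := μ) (f := fun _ => 1) (g := fun y => ‖u y - k‖ₑ)
    (by fun_prop) ((hu.aestronglyMeasurable.sub aestronglyMeasurable_const).enorm)
  simp only [one_mul, one_pow, lintegral_const] at h3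
  have h4 : μ univ = V := by simp [hμ, hV]
  rw [h4] at h3
  have h5 : V * (V * ‖avgB R u - k‖ₑ ^ 2) ≤ V * ∫⁻ y, ‖u y - k‖ₑ ^ 2 ∂μ :=
    calc _ = (V * ‖avgB R u - k‖ₑ) ^ 2 := by ring
      _ ≤ _ := (pow_le_pow_left' h2 2).trans h3
  exact (ENNReal.mul_le_mul_iff_right hV0 hVtop).mp h5

lemma integrableOn_of_lintegral_sq {S : Set E3} (hS : volume S ≠ ∞)
    (hum : AEStronglyMeasurable u (volume.restrict S))
    (hu2 : ∫⁻ x in S, ‖u x‖ₑ ^ 2 ≠ ∞) : IntegrableOn u S := by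
  have : MemLp u 2 (volume.restrict S) := by
    refine ⟨hum, ?_⟩
    rw [eLpNorm_lt_top_iff_lintegral_rpow_enorm_lt_top (by norm_num) (by norm_num)]
    simpa using hu2.lt_top
  have hfin : IsFiniteMeasure ((volume : Measure E3).restrict S) := ⟨by simpa using hS.lt_top⟩
  exact this.integrable (by norm_num)

lemma lintegral_sub_avgB_sq_le (hR : 0 < R)
    (hum : AEStronglyMeasurable u (volume.restrict (ball 0 R)))
    (hu2 : ∫⁻ x in ball 0 R, ‖u x‖ₑ ^ 2 ≠ ∞)
    (hGm : AEStronglyMeasurable G (volume.restrict (ball 0 R)))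
    (hG2 : ∫⁻ x in ball 0 R, ‖G x‖ₑ ^ 2 ≠ ∞) (hw : HasWeakGradBound u G R) :
    ∫⁻ x in ball (0 : E3) R, ‖u x - avgB R u‖ₑ ^ 2
      ≤ 1152 * ENNReal.ofReal (R ^ 2) * ∫⁻ x in ball (0 : E3) R, ‖G x‖ₑ ^ 2 := by
  set V := volume (ball (0 : E3) R) with hV
  have hVtop : V ≠ ∞ := measure_ball_lt_top.ne
  have hV0 : V ≠ 0 := (measure_ball_pos _ _ hR).ne'
  refine (ENNReal.mul_le_mul_iff_right hV0 hVtop).mp ?_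
  rw [← lintegral_const_mul' _ _ hVtop]
  calc _ ≤ ∫⁻ x in ball (0 : E3) R, ∫⁻ y in ball (0 : E3) R, ‖u y - u x‖ₑ ^ 2 := by
        refine lintegral_mono fun x => ?_
        rw [← enorm_neg, neg_sub]
        exact volume_mul_enorm_avgB_sub_sq_le hR
          (integrableOn_of_lintegral_sq hVtop hum hu2) (u x)
    _ ≤ _ := lintegral_lintegral_sub_sq_le_of_weakGrad hR hum hu2 hGm hG2 hw
    _ = _ := by ring

lemma lintegral_sub_avgB_sq_le_four_mul (hR : 0 < R)
    (hum : AEStronglyMeasurable u (volume.restrict (ball 0 R)))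
    (hu2 : ∫⁻ x in ball 0 R, ‖u x‖ₑ ^ 2 ≠ ∞) :
    ∫⁻ x in ball (0 : E3) R, ‖u x - avgB R u‖ₑ ^ 2
      ≤ 4 * ∫⁻ x in ball (0 : E3) R, ‖u x‖ₑ ^ 2 := by
  have h := volume_mul_enorm_avgB_sub_sq_le hR
    (integrableOn_of_lintegral_sq measure_ball_lt_top.ne hum hu2) 0
  simp only [sub_zero] at h
  calc _ ≤ ∫⁻ x in ball (0 : E3) R, (2 * ‖u x‖ₑ ^ 2 + 2 * ‖avgB R u‖ₑ ^ 2) := by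
        refine lintegral_mono fun x => ?_
        refine (pow_le_pow_left' (enorm_sub_le) 2).trans (ENNReal.add_sq_le_two _ _)
    _ = 2 * (∫⁻ x in ball (0 : E3) R, ‖u x‖ₑ ^ 2) +
          2 * (volume (ball (0 : E3) R) * ‖avgB R u‖ₑ ^ 2) := by
        rw [lintegral_add_right _ measurable_const, lintegral_const_mul' _ _ (by norm_num)]
        simp
        ring
    _ ≤ 2 * (∫⁻ x in ball (0 : E3) R, ‖u x‖ₑ ^ 2) + 2 * ∫⁻ x in ball (0 : E3) R, ‖u x‖ₑ ^ 2 := by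
        gcongr
    _ = _ := by ring

end WeakGradient

lemma hasCompactSupport_of_tsupport_subset_ball {φ : E3 → ℝ} {R : ℝ}
    (h : tsupport φ ⊆ ball 0 R) : HasCompactSupport φ :=
  (isCompact_closedBall (0 : E3) R).of_isClosed_subset (isClosed_tsupport φ)
    (h.trans ball_subset_closedBall)

lemma setIntegral_fderiv_eq_zero {φ : E3 → ℝ} {S : Set E3} (hφ : ContDiff ℝ (⊤ : ℕ∞) φ)
    (hc : HasCompactSupport φ) (hs : tsupport φ ⊆ S) (e : E3) :
    ∫ x in S, fderiv ℝ φ x e = 0 := by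
  have hsub : Function.support (fun x => fderiv ℝ φ x e) ⊆ S := by
    refine fun x hx => hs (support_fderiv_subset ℝ (f := φ) ?_)
    intro h0
    exact hx (by simp [h0])
  rw [setIntegral_eq_integral_of_forall_compl_eq_zero (fun x hx => by
    by_contra h; exact hx (hsub h))]
  have hcont : Continuous (fun x => fderiv ℝ φ x e) :=
    (hφ.continuous_fderiv (by simp)).clm_apply continuous_const
  have hcc : HasCompactSupport (fun x => fderiv ℝ φ x e) :=
    hc.fderiv_apply (𝕜 := ℝ) e
  have h := integral_mul_fderiv_eq_neg_fderiv_mul_of_integrable (𝕜 := ℝ) (μ := volume)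
    (f := fun _ : E3 => (1 : ℝ)) (g := φ) (v := e)
    (by simp) (by simpa using hcont.integrable_of_hasCompactSupport hcc)
    (by simpa using hφ.continuous.integrable_of_hasCompactSupport hc)
    (fun x _ => by fun_prop) (fun x _ => (hφ.differentiable (by simp)).differentiableAt)
  simpa using h

section Sobolev

variable {u G : E3 → ℝ} {R : ℝ}

lemma HasWeakGradBound.sub_const (hu : IntegrableOn u (ball 0 R)) (hw : HasWeakGradBound u G R)
    (c : ℝ) : HasWeakGradBound (fun x => u x - c) G R := by
  intro φ hφ hs j
  have hc := hasCompactSupport_of_tsupport_subset_ball hs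
  have hcont : Continuous (fun x => fderiv ℝ φ x (EuclideanSpace.single j (1 : ℝ))) :=
    (hφ.continuous_fderiv (by simp)).clm_apply continuous_const
  have hcc : HasCompactSupport (fun x => fderiv ℝ φ x (EuclideanSpace.single j (1 : ℝ))) :=
    hc.fderiv_apply (𝕜 := ℝ) _
  obtain ⟨K, hK⟩ := hcont.bounded_above_of_compact_support hcc
  have h1 : IntegrableOn (fun x => u x * fderiv ℝ φ x (EuclideanSpace.single j (1 : ℝ)))
      (ball 0 R) :=
    Integrable.mul_bdd (c := K) hu hcont.aestronglyMeasurable (Eventually.of_forall hK)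
  have h2 : IntegrableOn (fun x => c * fderiv ℝ φ x (EuclideanSpace.single j (1 : ℝ)))
      (ball 0 R) :=
    ((hcont.integrable_of_hasCompactSupport hcc).const_mul c).integrableOn
  have h3 : ∫ x in ball 0 R, (u x - c) * fderiv ℝ φ x (EuclideanSpace.single j (1 : ℝ))
      = ∫ x in ball 0 R, u x * fderiv ℝ φ x (EuclideanSpace.single j (1 : ℝ)) := by
    simp_rw [sub_mul]
    rw [integral_sub h1 h2, integral_const_mul, setIntegral_fderiv_eq_zero hφ hc hs]
    simp
  rw [h3]
  exact hw φ hφ hs j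

lemma ofReal_rpow_le_volume_ball (hR : 0 < R) :
    ENNReal.ofReal (R ^ 2) ^ (3 / 4 : ℝ) ≤ volume (ball (0 : E3) R) ^ (1 / 2 : ℝ) := by
  have h1 : ENNReal.ofReal (R ^ 2) ^ (3 / 4 : ℝ) = (ENNReal.ofReal R ^ 3) ^ (1 / 2 : ℝ) := by
    rw [ENNReal.ofReal_pow hR.le, ← ENNReal.rpow_natCast, ← ENNReal.rpow_natCast,
      ← ENNReal.rpow_mul, ← ENNReal.rpow_mul]
    norm_num
  rw [h1, EuclideanSpace.volume_ball_fin_three]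
  refine ENNReal.rpow_le_rpow ?_ (by norm_num)
  refine le_mul_of_one_le_right' ?_
  rw [ENNReal.one_le_ofReal]
  linarith [Real.pi_gt_three]

lemma interpolation_identity {a D : ℝ} (ha : 0 < a) (hD : 0 < D) :
    ((a / D) ^ (1 / 2 : ℝ)) ^ (1 / 2 : ℝ) * D + 2 * ((a / D) ^ (1 / 2 : ℝ)) ^ (-(3 / 2) : ℝ) * a
      = 3 * (a ^ (1 / 4 : ℝ) * D ^ (3 / 4 : ℝ)) := by
  rw [← Real.rpow_mul (by positivity), ← Real.rpow_mul (by positivity),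
    Real.div_rpow ha.le hD.le, Real.div_rpow ha.le hD.le]
  norm_num
  rw [Real.rpow_neg ha.le, Real.rpow_neg hD.le]
  have hA : a = a ^ (1 / 4 : ℝ) * a ^ (3 / 4 : ℝ) := by rw [← Real.rpow_add ha]; norm_num
  have hB : D = D ^ (1 / 4 : ℝ) * D ^ (3 / 4 : ℝ) := by rw [← Real.rpow_add hD]; norm_num
  have h1 : 0 < a ^ (1 / 4 : ℝ) := by positivity
  have h2 : 0 < a ^ (3 / 4 : ℝ) := by positivity
  have h3 : 0 < D ^ (1 / 4 : ℝ) := by positivity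
  have h4 : 0 < D ^ (3 / 4 : ℝ) := by positivity
  set x := a ^ (1 / 4 : ℝ)
  set y := a ^ (3 / 4 : ℝ)
  set z := D ^ (1 / 4 : ℝ)
  set w := D ^ (3 / 4 : ℝ)
  have e1 : x / z * D = x * w := by rw [hB]; field_simp
  have e2 : 2 * (y⁻¹ / w⁻¹) * a = 2 * (x * w) := by rw [hA]; field_simp
  rw [e1, e2]
  ring

lemma lintegral_sub_avgB_cube_le (hR : 0 < R)
    (hum : AEStronglyMeasurable u (volume.restrict (ball 0 R)))
    (hu2 : ∫⁻ x in ball 0 R, ‖u x‖ₑ ^ 2 ≠ ∞)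
    (hGm : AEStronglyMeasurable G (volume.restrict (ball 0 R)))
    (hG2 : ∫⁻ x in ball 0 R, ‖G x‖ₑ ^ 2 ≠ ∞) (hw : HasWeakGradBound u G R) :
    ∫⁻ x in ball (0 : E3) R, ‖u x - avgB R u‖ₑ ^ 3
      ≤ 331776 * (∫⁻ x in ball (0 : E3) R, ‖u x‖ₑ ^ 2) ^ (3 / 4 : ℝ) *
        (∫⁻ x in ball (0 : E3) R, ‖G x‖ₑ ^ 2) ^ (3 / 4 : ℝ) := by
  set V := volume (ball (0 : E3) R) with hV
  have hVtop : V ≠ ∞ := measure_ball_lt_top.ne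
  have hV0 : V ≠ 0 := (measure_ball_pos _ _ hR).ne'
  have hwm : AEStronglyMeasurable (fun x => u x - avgB R u) (volume.restrict (ball 0 R)) :=
    hum.sub aestronglyMeasurable_const
  have hwp := lintegral_sub_avgB_sq_le hR hum hu2 hGm hG2 hw
  have hwu := lintegral_sub_avgB_sq_le_four_mul hR hum hu2
  have hwg := hw.sub_const (integrableOn_of_lintegral_sq hVtop hum hu2) (avgB R u)
  set a := ∫⁻ x in ball (0 : E3) R, ‖u x - avgB R u‖ₑ ^ 2 with ha
  set b := ∫⁻ x in ball (0 : E3) R, ‖G x‖ₑ ^ 2 with hb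
  set α := ∫⁻ x in ball (0 : E3) R, ‖u x‖ₑ ^ 2 with hα
  have hatop : a ≠ ∞ := ne_top_of_le_ne_top (ENNReal.mul_ne_top (by norm_num) hu2) hwu
  rcases eq_or_ne a 0 with h0 | h0
  · have h1 : (fun x => ‖u x - avgB R u‖ₑ ^ 2) =ᵐ[volume.restrict (ball (0 : E3) R)] 0 :=
      (lintegral_eq_zero_iff' (hwm.enorm.pow_const 2)).mp h0
    have h2 : ∫⁻ x in ball (0 : E3) R, ‖u x - avgB R u‖ₑ ^ 3 = 0 := by
      rw [lintegral_eq_zero_iff' (hwm.enorm.pow_const 3)]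
      filter_upwards [h1] with x hx
      simpa using hx
    rw [h2]
    exact zero_le
  set D := 1152 * ENNReal.ofReal (R ^ 2) * b with hD
  have hDtop : D ≠ ∞ := by finiteness
  have hD0 : D ≠ 0 := fun h => h0 (by simpa [h] using hwp)
  set a' := a.toReal
  set D' := D.toReal
  have haa : a = ENNReal.ofReal a' := (ENNReal.ofReal_toReal hatop).symm
  have hDD : D = ENNReal.ofReal D' := (ENNReal.ofReal_toReal hDtop).symm
  have ha0 : 0 < a' := ENNReal.toReal_pos h0 hatop
  have hD00 : 0 < D' := ENNReal.toReal_pos hD0 hDtop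
  have hle : a' ≤ D' := ENNReal.toReal_mono hDtop hwp
  have key := volume_mul_lintegral_cube_le_of_weakGrad hR hwm hatop hGm hG2 hwg
    (τ := (a' / D') ^ (1 / 2 : ℝ)) (by positivity)
    (Real.rpow_le_one (by positivity) ((div_le_one hD00).mpr hle) (by norm_num))
  rw [← ha, ← hb, ← hV] at key
  set T := (a' / D') ^ (1 / 2 : ℝ) with hT
  have hpar : 1152 * ENNReal.ofReal (R ^ 2) * ENNReal.ofReal (T ^ (1 / 2 : ℝ)) * b
      + 2 * ENNReal.ofReal (T ^ (-(3 / 2) : ℝ)) * a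
      = 3 * (a ^ (1 / 4 : ℝ) * D ^ (3 / 4 : ℝ)) := by
    have e1 : 1152 * ENNReal.ofReal (R ^ 2) * ENNReal.ofReal (T ^ (1 / 2 : ℝ)) * b
        = ENNReal.ofReal (T ^ (1 / 2 : ℝ)) * D := by rw [hD]; ring
    have hT0 : 0 < T := by positivity
    rw [e1, hDD, haa, ENNReal.ofReal_rpow_of_pos ha0, ENNReal.ofReal_rpow_of_pos hD00,
      show (2 : ℝ≥0∞) = ENNReal.ofReal 2 by simp, show (3 : ℝ≥0∞) = ENNReal.ofReal 3 by simp,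
      ← ENNReal.ofReal_mul (by positivity), ← ENNReal.ofReal_mul (by positivity),
      ← ENNReal.ofReal_mul (by positivity), ← ENNReal.ofReal_mul (by positivity),
      ← ENNReal.ofReal_mul (by positivity), ← ENNReal.ofReal_add (by positivity) (by positivity),
      hT, interpolation_identity ha0 hD00]
  rw [hpar] at key
  have h8 : (8 * V) ^ (1 / 2 : ℝ) ≤ 3 * V ^ (1 / 2 : ℝ) := by
    rw [ENNReal.mul_rpow_of_nonneg _ _ (by norm_num)]
    refine mul_le_mul' ?_ le_rfl
    calc (8 : ℝ≥0∞) ^ (1 / 2 : ℝ) ≤ (3 ^ 2) ^ (1 / 2 : ℝ) :=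
          ENNReal.rpow_le_rpow (by norm_num) (by norm_num)
      _ = 3 := ENNReal.sq_rpow_half 3
  have hDV : D ^ (3 / 4 : ℝ) ≤ 1152 * V ^ (1 / 2 : ℝ) * b ^ (3 / 4 : ℝ) := by
    rw [hD, ENNReal.mul_rpow_of_nonneg _ _ (by norm_num),
      ENNReal.mul_rpow_of_nonneg _ _ (by norm_num)]
    refine mul_le_mul' (mul_le_mul' ?_ (ofReal_rpow_le_volume_ball hR)) le_rfl
    calc (1152 : ℝ≥0∞) ^ (3 / 4 : ℝ) ≤ 1152 ^ (1 : ℝ) :=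
          ENNReal.rpow_le_rpow_of_exponent_le (by norm_num) (by norm_num)
      _ = 1152 := ENNReal.rpow_one _
  have haα : a ^ (1 / 2 : ℝ) * a ^ (1 / 4 : ℝ) ≤ 4 * α ^ (3 / 4 : ℝ) := by
    rw [← ENNReal.rpow_add _ _ h0 hatop]
    calc a ^ (1 / 2 + 1 / 4 : ℝ) ≤ (4 * α) ^ (3 / 4 : ℝ) := by
          norm_num
          exact ENNReal.rpow_le_rpow hwu (by norm_num)
      _ = 4 ^ (3 / 4 : ℝ) * α ^ (3 / 4 : ℝ) := ENNReal.mul_rpow_of_nonneg _ _ (by norm_num)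
      _ ≤ _ := by
        refine mul_le_mul' ?_ le_rfl
        calc (4 : ℝ≥0∞) ^ (3 / 4 : ℝ) ≤ 4 ^ (1 : ℝ) :=
            ENNReal.rpow_le_rpow_of_exponent_le (by norm_num) (by norm_num)
          _ = 4 := ENNReal.rpow_one _
  refine (ENNReal.mul_le_mul_iff_right hV0 hVtop).mp (key.trans ?_)
  have hVV : V ^ (1 / 2 : ℝ) * V ^ (1 / 2 : ℝ) = V := by
    rw [← sq, ENNReal.rpow_half_sq]
  calc 8 * ((8 * V) ^ (1 / 2 : ℝ) * a ^ (1 / 2 : ℝ) * (3 * (a ^ (1 / 4 : ℝ) * D ^ (3 / 4 : ℝ))))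
      = 24 * (8 * V) ^ (1 / 2 : ℝ) * (a ^ (1 / 2 : ℝ) * a ^ (1 / 4 : ℝ)) * D ^ (3 / 4 : ℝ) := by
        ring
    _ ≤ 24 * (3 * V ^ (1 / 2 : ℝ)) * (4 * α ^ (3 / 4 : ℝ)) *
          (1152 * V ^ (1 / 2 : ℝ) * b ^ (3 / 4 : ℝ)) :=
        mul_le_mul' (mul_le_mul' (mul_le_mul' le_rfl h8) haα) hDV
    _ = (V ^ (1 / 2 : ℝ) * V ^ (1 / 2 : ℝ)) *
          (331776 * α ^ (3 / 4 : ℝ) * b ^ (3 / 4 : ℝ)) := by ring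
    _ = _ := by rw [hVV]

end Sobolev

lemma ENNReal.cube_rpow_third (a : ℝ≥0∞) : (a ^ 3) ^ (1 / 3 : ℝ) = a := by
  rw [← ENNReal.rpow_natCast, ← ENNReal.rpow_mul]; norm_num

lemma ENNReal.cube_rpow_two_thirds (a : ℝ≥0∞) : (a ^ 3) ^ (2 / 3 : ℝ) = a ^ 2 := by
  rw [← ENNReal.rpow_natCast, ← ENNReal.rpow_mul, ← ENNReal.rpow_natCast]; norm_num

lemma enorm_apply_le (x : E3) (i : Fin 3) : ‖x i‖ₑ ≤ ‖x‖ₑ := by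
  rw [← ofReal_norm, ← ofReal_norm]
  exact ENNReal.ofReal_le_ofReal (PiLp.norm_apply_le x i)

lemma enorm_le_sum_enorm_apply (x : E3) : ‖x‖ₑ ≤ ∑ i, ‖x i‖ₑ := by
  have h : ‖x‖ ≤ ∑ i, ‖x i‖ := by
    rw [EuclideanSpace.norm_eq]
    refine Real.sqrt_le_iff.mpr ⟨by positivity, ?_⟩
    simp only [Fin.sum_univ_three]
    have h0 := norm_nonneg (x 0)
    have h1 := norm_nonneg (x 1)
    have h2 := norm_nonneg (x 2)
    nlinarith [mul_nonneg h0 h1, mul_nonneg h0 h2, mul_nonneg h1 h2]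
  simp_rw [← ofReal_norm]
  rw [← ENNReal.ofReal_sum_of_nonneg fun i _ => norm_nonneg _]
  exact ENNReal.ofReal_le_ofReal h

lemma enorm_pow_le_sum (x : E3) (k : ℕ) :
    ‖x‖ₑ ^ (k + 1) ≤ 3 ^ k * ∑ i, ‖x i‖ₑ ^ (k + 1) := by
  refine (pow_le_pow_left' (enorm_le_sum_enorm_apply x) (k + 1)).trans ?_
  have h := ENNReal.rpow_sum_le_const_mul_sum_rpow (s := (Finset.univ : Finset (Fin 3)))
    (f := fun i => ‖x i‖ₑ) (p := (k + 1 : ℕ)) (by simp)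
  have hk : ((k + 1 : ℕ) : ℝ) - 1 = (k : ℕ) := by push_cast; ring
  rw [hk] at h
  simp only [ENNReal.rpow_natCast] at h
  simpa using h

/-- The vector of component averages over the ball of radius `R`. -/
def meanVec (R : ℝ) (v : E3 → E3) : E3 := WithLp.toLp 2 fun i => avgB R fun x => v x i

/-- A square integrable vector field on the ball of radius `R` with a square integrable
weak gradient. -/
structure SliceRegular (v : E3 → E3) (g : E3 → Fin 3 → Fin 3 → ℝ) (R : ℝ) : Prop where
  meas : AEStronglyMeasurable v (volume.restrict (ball 0 R))
  sq_ne_top : ∫⁻ x in ball 0 R, ‖v x‖ₑ ^ 2 ≠ ∞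
  grad_int : IntegrableOn (fun x => ∑ i, ∑ j, g x i j ^ 2) (ball 0 R)
  grad : ∀ φ : E3 → ℝ, ContDiff ℝ (⊤ : ℕ∞) φ → tsupport φ ⊆ ball 0 R →
      ∀ i j, ∫ x in ball 0 R, v x i * fderiv ℝ φ x (EuclideanSpace.single j (1 : ℝ))
        = - ∫ x in ball 0 R, g x i j * φ x

namespace SliceRegular

variable {v : E3 → E3} {g : E3 → Fin 3 → Fin 3 → ℝ} {R : ℝ}

lemma meas_apply (h : SliceRegular v g R) (i : Fin 3) :
    AEStronglyMeasurable (fun x => v x i) (volume.restrict (ball 0 R)) := by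
  have : Continuous fun y : E3 => y i := by fun_prop
  exact this.comp_aestronglyMeasurable h.meas

lemma sq_apply_le (v : E3 → E3) (R : ℝ) (i : Fin 3) :
    ∫⁻ x in ball 0 R, ‖v x i‖ₑ ^ 2 ≤ ∫⁻ x in ball 0 R, ‖v x‖ₑ ^ 2 :=
  lintegral_mono fun x => pow_le_pow_left' (enorm_apply_le (v x) i) 2

lemma sqrt_meas (h : SliceRegular v g R) :
    AEStronglyMeasurable (fun x => √(∑ i, ∑ j, g x i j ^ 2)) (volume.restrict (ball 0 R)) :=
  Real.continuous_sqrt.comp_aestronglyMeasurable h.grad_int.aestronglyMeasurable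

lemma enorm_sqrt_sq (x : E3) :
    ‖√(∑ i, ∑ j, g x i j ^ 2)‖ₑ ^ 2 = ENNReal.ofReal (∑ i, ∑ j, g x i j ^ 2) := by
  rw [Real.enorm_of_nonneg (Real.sqrt_nonneg _), ← ENNReal.ofReal_pow (Real.sqrt_nonneg _),
    Real.sq_sqrt (by positivity)]

lemma sqrt_ne_top (h : SliceRegular v g R) :
    ∫⁻ x in ball 0 R, ‖√(∑ i, ∑ j, g x i j ^ 2)‖ₑ ^ 2 ≠ ∞ := by
  simp_rw [enorm_sqrt_sq]
  exact h.grad_int.lintegral_lt_top.ne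

lemma weakGrad (h : SliceRegular v g R) (i : Fin 3) :
    HasWeakGradBound (fun x => v x i) (fun x => √(∑ i, ∑ j, g x i j ^ 2)) R := by
  intro φ hφ hs j
  have hc := hasCompactSupport_of_tsupport_subset_ball hs
  obtain ⟨K, hK⟩ := hφ.continuous.bounded_above_of_compact_support hc
  have hG := integrableOn_of_lintegral_sq measure_ball_lt_top.ne h.sqrt_meas h.sqrt_ne_top
  have hint : IntegrableOn (fun x => √(∑ i, ∑ j, g x i j ^ 2) * |φ x|) (ball 0 R) :=
    Integrable.mul_bdd (c := K) hG hφ.continuous.abs.aestronglyMeasurable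
      (Eventually.of_forall fun x => by simpa using hK x)
  rw [h.grad φ hφ hs i j, abs_neg, ← Real.norm_eq_abs]
  refine norm_integral_le_of_norm_le hint (Eventually.of_forall fun x => ?_)
  rw [norm_mul]
  refine mul_le_mul_of_nonneg_right (Real.abs_le_sqrt ?_) (abs_nonneg _)
  calc g x i j ^ 2 ≤ ∑ j, g x i j ^ 2 :=
        Finset.single_le_sum (f := fun j => g x i j ^ 2) (fun _ _ => sq_nonneg _)
          (Finset.mem_univ j)
    _ ≤ _ := Finset.single_le_sum (f := fun i => ∑ j, g x i j ^ 2)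
          (fun _ _ => Finset.sum_nonneg fun _ _ => sq_nonneg _) (Finset.mem_univ i)

lemma lintegral_enorm_pow_le_sum (h : SliceRegular v g R) (m : E3) (k : ℕ) :
    ∫⁻ x in ball 0 R, ‖v x - m‖ₑ ^ (k + 1)
      ≤ 3 ^ k * ∑ i, ∫⁻ x in ball 0 R, ‖v x i - m i‖ₑ ^ (k + 1) := by
  have hm : ∀ i, AEMeasurable (fun x => ‖v x i - m i‖ₑ ^ (k + 1)) (volume.restrict (ball 0 R)) :=
    fun i => ((h.meas_apply i).sub aestronglyMeasurable_const).enorm.pow_const _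
  rw [← lintegral_finsetSum' _ fun i _ => hm i, ← lintegral_const_mul' _ _ (by finiteness)]
  exact lintegral_mono fun x => enorm_pow_le_sum (v x - m) k

lemma lintegral_sub_meanVec_sq_le (h : SliceRegular v g R) (hR : 0 < R) :
    ∫⁻ x in ball 0 R, ‖v x - meanVec R v‖ₑ ^ 2
      ≤ 10368 * (ENNReal.ofReal (R ^ 2) *
        ∫⁻ x in ball 0 R, ENNReal.ofReal (∑ i, ∑ j, g x i j ^ 2)) := by
  refine (h.lintegral_enorm_pow_le_sum _ 1).trans ?_
  have hi : ∀ i, ∫⁻ x in ball 0 R, ‖v x i - meanVec R v i‖ₑ ^ 2 ≤ 1152 * ENNReal.ofReal (R ^ 2) *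
      ∫⁻ x in ball 0 R, ENNReal.ofReal (∑ i, ∑ j, g x i j ^ 2) := fun i => by
    have := lintegral_sub_avgB_sq_le hR (h.meas_apply i)
      (ne_top_of_le_ne_top h.sq_ne_top (sq_apply_le v R i)) h.sqrt_meas h.sqrt_ne_top (h.weakGrad i)
    simp only [enorm_sqrt_sq] at this
    exact this
  calc _ ≤ 3 ^ 1 * ∑ i : Fin 3, 1152 * ENNReal.ofReal (R ^ 2) *
      ∫⁻ x in ball 0 R, ENNReal.ofReal (∑ i, ∑ j, g x i j ^ 2) :=
        mul_le_mul' le_rfl (Finset.sum_le_sum fun i _ => hi i)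
    _ = _ := by
      rw [Finset.sum_const, Finset.card_univ, Fintype.card_fin, nsmul_eq_mul]
      push_cast
      ring

lemma lintegral_sub_meanVec_cube_le (h : SliceRegular v g R) (hR : 0 < R) :
    ∫⁻ x in ball 0 R, ‖v x - meanVec R v‖ₑ ^ 3
      ≤ 8957952 * ((∫⁻ x in ball 0 R, ‖v x‖ₑ ^ 2) ^ (3 / 4 : ℝ) *
        (∫⁻ x in ball 0 R, ENNReal.ofReal (∑ i, ∑ j, g x i j ^ 2)) ^ (3 / 4 : ℝ)) := by
  refine (h.lintegral_enorm_pow_le_sum _ 2).trans ?_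
  have hi : ∀ i, ∫⁻ x in ball 0 R, ‖v x i - meanVec R v i‖ₑ ^ 3
      ≤ 331776 * (∫⁻ x in ball 0 R, ‖v x‖ₑ ^ 2) ^ (3 / 4 : ℝ) *
      (∫⁻ x in ball 0 R, ENNReal.ofReal (∑ i, ∑ j, g x i j ^ 2)) ^ (3 / 4 : ℝ) := fun i => by
    have := lintegral_sub_avgB_cube_le hR (h.meas_apply i)
      (ne_top_of_le_ne_top h.sq_ne_top (sq_apply_le v R i)) h.sqrt_meas h.sqrt_ne_top (h.weakGrad i)
    simp only [enorm_sqrt_sq] at this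
    refine this.trans (mul_le_mul' (mul_le_mul' le_rfl ?_) le_rfl)
    exact ENNReal.rpow_le_rpow (sq_apply_le v R i) (by norm_num)
  calc _ ≤ 3 ^ 2 * ∑ i : Fin 3, 331776 * (∫⁻ x in ball 0 R, ‖v x‖ₑ ^ 2) ^ (3 / 4 : ℝ) *
      (∫⁻ x in ball 0 R, ENNReal.ofReal (∑ i, ∑ j, g x i j ^ 2)) ^ (3 / 4 : ℝ) :=
        mul_le_mul' le_rfl (Finset.sum_le_sum fun i _ => hi i)
    _ = _ := by
      rw [Finset.sum_const, Finset.card_univ, Fintype.card_fin, nsmul_eq_mul]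
      push_cast
      ring

lemma _root_.volume_mul_enorm_avgB_le {u : E3 → ℝ} (hR : 0 < R) :
    volume (ball (0 : E3) R) * ‖avgB R u‖ₑ ≤ ∫⁻ y in ball (0 : E3) R, ‖u y‖ₑ := by
  set μ := (volume : Measure E3).restrict (ball (0 : E3) R) with hμ
  set V := volume (ball (0 : E3) R) with hV
  have hVtop : V ≠ ∞ := measure_ball_lt_top.ne
  have hV0 : V ≠ 0 := (measure_ball_pos _ _ hR).ne'
  have hVr : μ.real univ = V.toReal := by simp [hμ, Measure.real, hV]
  have h0 : avgB R u = (μ.real univ)⁻¹ • ∫ y, u y ∂μ := average_eq _ _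
  have h1 : V.toReal * avgB R u = ∫ y, u y ∂μ := by
    rw [h0, hVr, smul_eq_mul]
    have := (ENNReal.toReal_pos hV0 hVtop).ne'
    field_simp
  have := enorm_integral_le_lintegral_enorm (μ := μ) u
  rwa [← h1, enorm_mul, Real.enorm_of_nonneg ENNReal.toReal_nonneg,
      ENNReal.ofReal_toReal hVtop] at this

lemma _root_.ofReal_le_volume_ball_rpow :
    ENNReal.ofReal R ≤ volume (ball (0 : E3) R) ^ (1 / 3 : ℝ) := by
  rw [EuclideanSpace.volume_ball_fin_three, ← ENNReal.cube_rpow_third (ENNReal.ofReal R)]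
  refine ENNReal.rpow_le_rpow ?_ (by norm_num)
  rw [ENNReal.cube_rpow_third]
  refine le_mul_of_one_le_right' ?_
  rw [ENNReal.one_le_ofReal]
  linarith [Real.pi_gt_three]

lemma _root_.volume_ball_rpow_le :
    volume (ball (0 : E3) R) ^ (1 / 3 : ℝ) ≤ 2 * ENNReal.ofReal R := by
  rw [EuclideanSpace.volume_ball_fin_three, ← ENNReal.cube_rpow_third (2 * ENNReal.ofReal R)]
  refine ENNReal.rpow_le_rpow ?_ (by norm_num)
  rw [mul_pow, mul_comm]
  refine mul_le_mul' ?_ le_rfl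
  rw [show (2 : ℝ≥0∞) ^ 3 = ENNReal.ofReal 8 by norm_num]
  exact ENNReal.ofReal_le_ofReal (by linarith [Real.pi_lt_four])

lemma volume_mul_enorm_meanVec_le (v : E3 → E3) (hR : 0 < R) :
    volume (ball (0 : E3) R) * ‖meanVec R v‖ₑ ≤ 3 * ∫⁻ y in ball (0 : E3) R, ‖v y‖ₑ := by
  calc _ ≤ volume (ball (0 : E3) R) * ∑ i, ‖meanVec R v i‖ₑ :=
        mul_le_mul' le_rfl (enorm_le_sum_enorm_apply _)
    _ = ∑ i, volume (ball (0 : E3) R) * ‖avgB R fun x => v x i‖ₑ := by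
        rw [Finset.mul_sum]; rfl
    _ ≤ ∑ i : Fin 3, ∫⁻ y in ball (0 : E3) R, ‖v y‖ₑ := by
        refine Finset.sum_le_sum fun i _ => (volume_mul_enorm_avgB_le hR).trans ?_
        exact lintegral_mono fun x => enorm_apply_le (v x) i
    _ = _ := by simp

lemma lintegral_enorm_le_cube (h : SliceRegular v g R) :
    ∫⁻ y in ball (0 : E3) R, ‖v y‖ₑ
      ≤ (∫⁻ y in ball (0 : E3) R, ‖v y‖ₑ ^ 3) ^ (1 / 3 : ℝ) *
        volume (ball (0 : E3) R) ^ (2 / 3 : ℝ) := by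
  have := ENNReal.lintegral_mul_norm_pow_le (μ := volume.restrict (ball (0 : E3) R))
    (f := fun y => ‖v y‖ₑ ^ 3) (g := fun _ => 1) (p := 1 / 3) (q := 2 / 3)
    (h.meas.enorm.pow_const 3) aemeasurable_const (by norm_num) (by norm_num) (by norm_num)
  simpa [ENNReal.cube_rpow_third, -one_div] using this

lemma lintegral_sq_le_cube (h : SliceRegular v g R) :
    ∫⁻ y in ball (0 : E3) R, ‖v y‖ₑ ^ 2
      ≤ 2 * ENNReal.ofReal R * (∫⁻ y in ball (0 : E3) R, ‖v y‖ₑ ^ 3) ^ (2 / 3 : ℝ) := by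
  have := ENNReal.lintegral_mul_norm_pow_le (μ := volume.restrict (ball (0 : E3) R))
    (f := fun y => ‖v y‖ₑ ^ 3) (g := fun _ => 1) (p := 2 / 3) (q := 1 / 3)
    (h.meas.enorm.pow_const 3) aemeasurable_const (by norm_num) (by norm_num) (by norm_num)
  simp only [ENNReal.cube_rpow_two_thirds, ENNReal.one_rpow, mul_one, lintegral_const,
    Measure.restrict_apply_univ, one_mul] at this
  rw [mul_comm]
  exact this.trans (mul_le_mul' le_rfl volume_ball_rpow_le)

lemma ofReal_mul_enorm_meanVec_le (h : SliceRegular v g R) (hR : 0 < R) :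
    ENNReal.ofReal R * ‖meanVec R v‖ₑ
      ≤ 3 * (∫⁻ y in ball (0 : E3) R, ‖v y‖ₑ ^ 3) ^ (1 / 3 : ℝ) := by
  set V := volume (ball (0 : E3) R) with hV
  have hVtop : V ≠ ∞ := measure_ball_lt_top.ne
  have hV0 : V ≠ 0 := (measure_ball_pos _ _ hR).ne'
  have h23 : V ^ (2 / 3 : ℝ) ≠ 0 := by
    simp [ENNReal.rpow_eq_zero_iff, hV0, hVtop]
  have h23' : V ^ (2 / 3 : ℝ) ≠ ∞ := ENNReal.rpow_ne_top_of_nonneg (by norm_num) hVtop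
  refine (ENNReal.mul_le_mul_iff_right h23 h23').mp ?_
  calc V ^ (2 / 3 : ℝ) * (ENNReal.ofReal R * ‖meanVec R v‖ₑ)
      ≤ V ^ (2 / 3 : ℝ) * (V ^ (1 / 3 : ℝ) * ‖meanVec R v‖ₑ) :=
        mul_le_mul' le_rfl (mul_le_mul' ofReal_le_volume_ball_rpow le_rfl)
    _ = V * ‖meanVec R v‖ₑ := by
        rw [← mul_assoc, ← ENNReal.rpow_add _ _ hV0 hVtop]
        norm_num
    _ ≤ 3 * ((∫⁻ y in ball (0 : E3) R, ‖v y‖ₑ ^ 3) ^ (1 / 3 : ℝ) * V ^ (2 / 3 : ℝ)) :=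
        (volume_mul_enorm_meanVec_le v hR).trans (mul_le_mul' le_rfl h.lintegral_enorm_le_cube)
    _ = _ := by ring

lemma _root_.enorm_sq_sub_sq_le (x m : E3) :
    ‖‖x‖ ^ 2 - ‖m‖ ^ 2‖ₑ ≤ ‖x - m‖ₑ ^ 2 + 2 * (‖m‖ₑ * ‖x - m‖ₑ) := by
  have h : |‖x‖ ^ 2 - ‖m‖ ^ 2| ≤ ‖x - m‖ ^ 2 + 2 * (‖m‖ * ‖x - m‖) := by
    have h1 := abs_norm_sub_norm_le x m
    have h2 : ‖x‖ ≤ ‖x - m‖ + ‖m‖ := by simpa using norm_add_le (x - m) m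
    rw [show ‖x‖ ^ 2 - ‖m‖ ^ 2 = (‖x‖ - ‖m‖) * (‖x‖ + ‖m‖) by ring, abs_mul,
      abs_of_nonneg (by positivity : 0 ≤ ‖x‖ + ‖m‖)]
    calc _ ≤ ‖x - m‖ * (‖x - m‖ + ‖m‖ + ‖m‖) := by gcongr
      _ = _ := by ring
  simp_rw [← ofReal_norm]
  refine (ENNReal.ofReal_le_ofReal h).trans_eq ?_
  rw [ENNReal.ofReal_add (by positivity) (by positivity), ENNReal.ofReal_mul (by positivity),
    ENNReal.ofReal_mul (by positivity), ENNReal.ofReal_pow (by positivity)]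
  simp

lemma lintegral_enorm_mul_sq_sub_sq_le (h : SliceRegular v g R) (hR : 0 < R) :
    ∫⁻ x in ball 0 R, ‖v x‖ₑ * ‖‖v x‖ ^ 2 - ‖meanVec R v‖ ^ 2‖ₑ
      ≤ 9020160 * ((∫⁻ x in ball 0 R, ‖v x‖ₑ ^ 3) ^ (1 / 3 : ℝ) *
        ((∫⁻ x in ball 0 R, ‖v x‖ₑ ^ 2) ^ (1 / 2 : ℝ) *
        (∫⁻ x in ball 0 R, ENNReal.ofReal (∑ i, ∑ j, g x i j ^ 2)) ^ (1 / 2 : ℝ))) := by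
  have hW2 := h.lintegral_sub_meanVec_sq_le hR
  have hW3 := h.lintegral_sub_meanVec_cube_le hR
  have hm := h.ofReal_mul_enorm_meanVec_le hR
  have hvm := h.meas.enorm
  have hwm : AEMeasurable (fun x => ‖v x - meanVec R v‖ₑ) (volume.restrict (ball 0 R)) :=
    (h.meas.sub aestronglyMeasurable_const).enorm
  set μ := (volume : Measure E3).restrict (ball (0 : E3) R) with hμ
  set m := meanVec R v
  set c := ∫⁻ x, ‖v x‖ₑ ^ 3 ∂μ
  set a := ∫⁻ x, ‖v x‖ₑ ^ 2 ∂μ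
  set b := ∫⁻ x, ENNReal.ofReal (∑ i, ∑ j, g x i j ^ 2) ∂μ
  have h1 : ∫⁻ x, ‖v x‖ₑ * ‖v x - m‖ₑ ^ 2 ∂μ
      ≤ c ^ (1 / 3 : ℝ) * (8957952 * (a ^ (1 / 2 : ℝ) * b ^ (1 / 2 : ℝ))) := by
    have := ENNReal.lintegral_mul_norm_pow_le (μ := μ)
      (f := fun y => ‖v y‖ₑ ^ 3) (g := fun y => ‖v y - m‖ₑ ^ 3) (p := 1 / 3) (q := 2 / 3)
      (hvm.pow_const 3) (hwm.pow_const 3) (by norm_num) (by norm_num) (by norm_num)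
    simp only [ENNReal.cube_rpow_two_thirds, ENNReal.cube_rpow_third] at this
    refine this.trans (mul_le_mul' le_rfl ?_)
    calc _ ≤ (8957952 * (a ^ (3 / 4 : ℝ) * b ^ (3 / 4 : ℝ))) ^ (2 / 3 : ℝ) :=
          ENNReal.rpow_le_rpow hW3 (by norm_num)
      _ = 8957952 ^ (2 / 3 : ℝ) * (a ^ (1 / 2 : ℝ) * b ^ (1 / 2 : ℝ)) := by
          rw [ENNReal.mul_rpow_of_nonneg _ _ (by norm_num),
            ENNReal.mul_rpow_of_nonneg _ _ (by norm_num), ← ENNReal.rpow_mul, ← ENNReal.rpow_mul]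
          norm_num
      _ ≤ _ := by
          refine mul_le_mul' ?_ le_rfl
          calc (8957952 : ℝ≥0∞) ^ (2 / 3 : ℝ) ≤ 8957952 ^ (1 : ℝ) :=
              ENNReal.rpow_le_rpow_of_exponent_le (by norm_num) (by norm_num)
            _ = 8957952 := ENNReal.rpow_one _
  have h2 : ∫⁻ x, ‖v x‖ₑ * ‖v x - m‖ₑ ∂μ
      ≤ 10368 * (ENNReal.ofReal R * (a ^ (1 / 2 : ℝ) * b ^ (1 / 2 : ℝ))) := by
    have := ENNReal.lintegral_mul_norm_pow_le (μ := μ)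
      (f := fun y => ‖v y‖ₑ ^ 2) (g := fun y => ‖v y - m‖ₑ ^ 2) (p := 1 / 2) (q := 1 / 2)
      (hvm.pow_const 2) (hwm.pow_const 2) (by norm_num) (by norm_num) (by norm_num)
    simp only [ENNReal.sq_rpow_half] at this
    refine this.trans ?_
    calc _ ≤ a ^ (1 / 2 : ℝ) * (10368 * (ENNReal.ofReal (R ^ 2) * b)) ^ (1 / 2 : ℝ) :=
          mul_le_mul' le_rfl (ENNReal.rpow_le_rpow hW2 (by norm_num))
      _ = 10368 ^ (1 / 2 : ℝ) * (ENNReal.ofReal R * (a ^ (1 / 2 : ℝ) * b ^ (1 / 2 : ℝ))) := by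
          rw [ENNReal.mul_rpow_of_nonneg _ _ (by norm_num),
            ENNReal.mul_rpow_of_nonneg _ _ (by norm_num), ENNReal.ofReal_pow hR.le,
            ENNReal.sq_rpow_half]
          ring
      _ ≤ _ := by
          refine mul_le_mul' ?_ le_rfl
          calc (10368 : ℝ≥0∞) ^ (1 / 2 : ℝ) ≤ 10368 ^ (1 : ℝ) :=
              ENNReal.rpow_le_rpow_of_exponent_le (by norm_num) (by norm_num)
            _ = 10368 := ENNReal.rpow_one _
  calc _ ≤ ∫⁻ x, (‖v x‖ₑ * ‖v x - m‖ₑ ^ 2 + 2 * ‖m‖ₑ * (‖v x‖ₑ * ‖v x - m‖ₑ)) ∂μ := by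
        refine lintegral_mono fun x => ?_
        calc _ ≤ ‖v x‖ₑ * (‖v x - m‖ₑ ^ 2 + 2 * (‖m‖ₑ * ‖v x - m‖ₑ)) :=
              mul_le_mul' le_rfl (enorm_sq_sub_sq_le _ _)
          _ = _ := by ring
    _ = ∫⁻ x, ‖v x‖ₑ * ‖v x - m‖ₑ ^ 2 ∂μ + 2 * ‖m‖ₑ * ∫⁻ x, ‖v x‖ₑ * ‖v x - m‖ₑ ∂μ := by
        have hm2 : AEMeasurable (fun x => ‖v x‖ₑ * ‖v x - m‖ₑ ^ 2) μ := hvm.mul (hwm.pow_const 2)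
        rw [lintegral_add_left' hm2,
          lintegral_const_mul' _ _ (by finiteness)]
    _ ≤ c ^ (1 / 3 : ℝ) * (8957952 * (a ^ (1 / 2 : ℝ) * b ^ (1 / 2 : ℝ))) +
          2 * ‖m‖ₑ * (10368 * (ENNReal.ofReal R * (a ^ (1 / 2 : ℝ) * b ^ (1 / 2 : ℝ)))) :=
        add_le_add h1 (mul_le_mul' le_rfl h2)
    _ = c ^ (1 / 3 : ℝ) * (8957952 * (a ^ (1 / 2 : ℝ) * b ^ (1 / 2 : ℝ))) +
          20736 * (ENNReal.ofReal R * ‖m‖ₑ) * (a ^ (1 / 2 : ℝ) * b ^ (1 / 2 : ℝ)) := by ring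
    _ ≤ c ^ (1 / 3 : ℝ) * (8957952 * (a ^ (1 / 2 : ℝ) * b ^ (1 / 2 : ℝ))) +
          20736 * (3 * c ^ (1 / 3 : ℝ)) * (a ^ (1 / 2 : ℝ) * b ^ (1 / 2 : ℝ)) :=
        add_le_add le_rfl (mul_le_mul' (mul_le_mul' le_rfl hm) le_rfl)
    _ = _ := by ring

end SliceRegular

lemma lintegral_enorm_mul_pressure_le {v : E3 → E3} {q : E3 → ℝ} {μ : Measure E3}
    (hv : AEStronglyMeasurable v μ) (hq : AEStronglyMeasurable q μ) :
    ∫⁻ x, ‖v x‖ₑ * ‖q x‖ₑ ∂μ ≤ (∫⁻ x, ‖v x‖ₑ ^ 3 ∂μ) ^ (1 / 3 : ℝ) *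
      (∫⁻ x, ‖q x‖ₑ ^ (3 / 2 : ℝ) ∂μ) ^ (2 / 3 : ℝ) := by
  have := ENNReal.lintegral_mul_norm_pow_le (μ := μ)
    (f := fun y => ‖v y‖ₑ ^ 3) (g := fun y => ‖q y‖ₑ ^ (3 / 2 : ℝ)) (p := 1 / 3) (q := 2 / 3)
    (hv.enorm.pow_const 3) (hq.enorm.pow_const _) (by norm_num) (by norm_num) (by norm_num)
  simp only [ENNReal.cube_rpow_third, ← ENNReal.rpow_mul] at this
  norm_num at this
  exact this

lemma enorm_setIntegral_flux_le {v : E3 → E3} {p θ ℓ : E3 → ℝ} {μ : Measure E3} {a b : ℝ≥0∞}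
    {k q : ℝ} (ha : a ≠ ∞) (hb : b ≠ ∞) (hv : AEStronglyMeasurable v μ)
    (hp : AEStronglyMeasurable p μ)
    (hθ : ∀ x, ‖θ x‖ₑ ≤ a) (hℓ : ∀ x, ‖ℓ x‖ₑ ≤ b * ‖v x‖ₑ)
    (hint : Integrable ℓ μ) (hdiv : ∫ x, ℓ x ∂μ = 0) :
    ‖∫ x, (‖v x‖ ^ 2 * θ x + ℓ x * (‖v x‖ ^ 2 + 2 * p x)) ∂μ‖ₑ
      ≤ a * ∫⁻ x, ‖v x‖ₑ ^ 2 ∂μ + b * ∫⁻ x, ‖v x‖ₑ * ‖‖v x‖ ^ 2 - k‖ₑ ∂μ +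
        2 * b * ∫⁻ x, ‖v x‖ₑ * ‖p x - q‖ₑ ∂μ := by
  by_cases hI : Integrable (fun x => ‖v x‖ ^ 2 * θ x + ℓ x * (‖v x‖ ^ 2 + 2 * p x)) μ
  swap
  · rw [integral_undef hI]; simp
  have h1 : ∫ x, (‖v x‖ ^ 2 * θ x + ℓ x * (‖v x‖ ^ 2 + 2 * p x)) ∂μ
      = ∫ x, (‖v x‖ ^ 2 * θ x + ℓ x * (‖v x‖ ^ 2 - k) + ℓ x * (2 * (p x - q))) ∂μ := by
    have h2 := integral_sub hI (hint.mul_const (k + 2 * q))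
    rw [integral_mul_const, hdiv, zero_mul, sub_zero] at h2
    rw [← h2]
    congr 1 with x
    ring
  rw [h1]
  refine (enorm_integral_le_lintegral_enorm _).trans ?_
  have m1 : AEMeasurable (fun x => ‖v x‖ₑ * ‖‖v x‖ ^ 2 - k‖ₑ) μ :=
    hv.enorm.mul ((hv.norm.pow 2).sub aestronglyMeasurable_const).enorm
  have m2 : AEMeasurable (fun x => ‖v x‖ₑ * ‖p x - q‖ₑ) μ :=
    hv.enorm.mul (hp.sub aestronglyMeasurable_const).enorm
  calc _ ≤ ∫⁻ x, (a * ‖v x‖ₑ ^ 2 + b * (‖v x‖ₑ * ‖‖v x‖ ^ 2 - k‖ₑ) +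
        2 * b * (‖v x‖ₑ * ‖p x - q‖ₑ)) ∂μ := by
        refine lintegral_mono fun x => ?_
        refine (enorm_add_le _ _).trans (add_le_add ((enorm_add_le _ _).trans
          (add_le_add ?_ ?_)) ?_)
        · rw [enorm_mul, enorm_pow, enorm_norm, mul_comm]
          exact mul_le_mul' (hθ x) le_rfl
        · rw [enorm_mul, ← mul_assoc]
          exact mul_le_mul' (hℓ x) le_rfl
        · rw [enorm_mul, enorm_mul]
          calc _ ≤ (b * ‖v x‖ₑ) * (‖(2 : ℝ)‖ₑ * ‖p x - q‖ₑ) := mul_le_mul' (hℓ x) le_rfl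
            _ = _ := by
              rw [show ‖(2 : ℝ)‖ₑ = 2 by rw [Real.enorm_of_nonneg (by norm_num)]; simp]
              ring
    _ = _ := by
        rw [lintegral_add_right' _ (m2.const_mul _), lintegral_add_right' _ (m1.const_mul _),
          lintegral_const_mul' _ _ ha, lintegral_const_mul' _ _ hb,
          lintegral_const_mul' _ _ (by finiteness)]

/-- The density in time that controls the right-hand side of the local energy inequality. -/
def fluxBound (R : ℝ) (v : E3 → E3) (g : E3 → Fin 3 → Fin 3 → ℝ) (p : E3 → ℝ) : ℝ≥0∞ :=
  (∫⁻ x in ball 0 R, ‖v x‖ₑ ^ 3) ^ (2 / 3 : ℝ) +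
    (∫⁻ x in ball 0 R, ‖v x‖ₑ ^ 3) ^ (1 / 3 : ℝ) *
      ((∫⁻ x in ball 0 R, ‖v x‖ₑ ^ 2) ^ (1 / 2 : ℝ) *
        (∫⁻ x in ball 0 R, ENNReal.ofReal (∑ i, ∑ j, g x i j ^ 2)) ^ (1 / 2 : ℝ)) +
    (∫⁻ x in ball 0 R, ‖v x‖ₑ ^ 3) ^ (1 / 3 : ℝ) *
      (∫⁻ x in ball 0 R, ‖p x - avgB R p‖ₑ ^ (3 / 2 : ℝ)) ^ (2 / 3 : ℝ)

lemma SliceRegular.enorm_setIntegral_flux_le {v : E3 → E3} {g : E3 → Fin 3 → Fin 3 → ℝ} {R K : ℝ}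
    {p θ ℓ : E3 → ℝ} (h : SliceRegular v g R) (hR : 0 < R) (hK : 0 ≤ K)
    (hp : AEStronglyMeasurable p (volume.restrict (ball 0 R)))
    (hθ : ∀ x, |θ x| ≤ K / R ^ 2) (hℓ : ∀ x, |ℓ x| ≤ K / R * ‖v x‖)
    (hint : IntegrableOn ℓ (ball 0 R)) (hdiv : ∫ x in ball 0 R, ℓ x = 0) :
    ‖∫ x in ball 0 R, (‖v x‖ ^ 2 * θ x + ℓ x * (‖v x‖ ^ 2 + 2 * p x))‖ₑ
      ≤ ENNReal.ofReal (9020160 * K / R) * fluxBound R v g p := by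
  have key := _root_.enorm_setIntegral_flux_le (a := ENNReal.ofReal (K / R ^ 2))
    (b := ENNReal.ofReal (K / R)) (k := ‖meanVec R v‖ ^ 2) (q := avgB R p) (by finiteness)
    (by finiteness) h.meas hp
    (fun x => by
      rw [← ofReal_norm, Real.norm_eq_abs]
      exact ENNReal.ofReal_le_ofReal (hθ x))
    (fun x => by
      rw [← ofReal_norm, ← ofReal_norm, Real.norm_eq_abs, ← ENNReal.ofReal_mul (by positivity)]
      exact ENNReal.ofReal_le_ofReal (hℓ x)) hint hdiv
  refine key.trans ?_
  have h1 := h.lintegral_sq_le_cube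
  have h2 := h.lintegral_enorm_mul_sq_sub_sq_le hR
  have h3 := lintegral_enorm_mul_pressure_le h.meas
    (hp.sub (aestronglyMeasurable_const (b := avgB R p)))
  simp only [Pi.sub_apply] at h3
  rw [fluxBound]
  set b := ENNReal.ofReal (K / R) with hb
  set X := (∫⁻ x in ball 0 R, ‖v x‖ₑ ^ 3) ^ (2 / 3 : ℝ)
  have e1 : ENNReal.ofReal (K / R ^ 2) * ENNReal.ofReal R = b := by
    rw [← ENNReal.ofReal_mul (by positivity), hb]
    congr 1
    field_simp
  have e2 : ENNReal.ofReal (9020160 * K / R) = 9020160 * b := by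
    rw [mul_div_assoc, ENNReal.ofReal_mul (by norm_num)]
    simp [hb]
  rw [e2]
  refine (add_le_add (add_le_add (mul_le_mul' le_rfl h1) (mul_le_mul' le_rfl h2))
    (mul_le_mul' le_rfl h3)).trans ?_
  rw [mul_add, mul_add]
  refine add_le_add (add_le_add ?_ ?_) ?_
  · calc _ = 2 * (ENNReal.ofReal (K / R ^ 2) * ENNReal.ofReal R) * X := by ring
      _ = 2 * b * X := by rw [e1]
      _ ≤ _ := mul_le_mul' (mul_le_mul' (by norm_num) le_rfl) le_rfl
  · exact le_of_eq (by ring)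
  · exact mul_le_mul' (mul_le_mul' (by norm_num) le_rfl) le_rfl

lemma fderiv_mul_prod {ζ : E3 → ℝ} {χ : ℝ → ℝ} (hζ : Differentiable ℝ ζ)
    (hχ : Differentiable ℝ χ) (x e : E3) (s τ : ℝ) :
    fderiv ℝ (fun z : E3 × ℝ => ζ z.1 * χ z.2) (x, s) (e, τ)
      = fderiv ℝ ζ x e * χ s + ζ x * (τ * deriv χ s) := by
  have h1 : HasFDerivAt (fun z : E3 × ℝ => ζ z.1) ((fderiv ℝ ζ x).comp
      (ContinuousLinearMap.fst ℝ E3 ℝ)) (x, s) :=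
    HasFDerivAt.comp (x, s) (hζ x).hasFDerivAt hasFDerivAt_fst
  have h2 : HasFDerivAt (fun z : E3 × ℝ => χ z.2) ((fderiv ℝ χ s).comp
      (ContinuousLinearMap.snd ℝ E3 ℝ)) (x, s) :=
    HasFDerivAt.comp (x, s) (hχ s).hasFDerivAt hasFDerivAt_snd
  have h3 : fderiv ℝ (fun z : E3 × ℝ => ζ z.1 * χ z.2) (x, s) = _ := (h1.mul h2).fderiv
  rw [h3]
  have : fderiv ℝ χ s τ = τ * deriv χ s := by
    rw [← fderiv_apply_one_eq_deriv, ← smul_eq_mul, ← map_smul, smul_eq_mul, mul_one]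
  simp [this]
  ring

/-- A product cutoff `ζ(x) χ(t)` adapted to the cylinders `Q(R/2) ⊆ Q(R)`. -/
structure IsCutoff (K R : ℝ) (ζ : E3 → ℝ) (χ : ℝ → ℝ) : Prop where
  smooth_space : ContDiff ℝ (⊤ : ℕ∞) ζ
  smooth_time : ContDiff ℝ (⊤ : ℕ∞) χ
  space_nonneg : ∀ x, 0 ≤ ζ x
  space_le_one : ∀ x, ζ x ≤ 1
  time_nonneg : ∀ t, 0 ≤ χ t
  time_le_one : ∀ t, χ t ≤ 1
  space_eq_one : ∀ x ∈ ball (0 : E3) (R / 2), ζ x = 1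
  tsupport_space : tsupport ζ ⊆ closedBall 0 (3 / 4 * R)
  time_eq_one : ∀ t ∈ Icc (-(R / 2) ^ 2) 0, χ t = 1
  time_eq_zero : ∀ t ≤ -(9 / 16 * R ^ 2), χ t = 0
  fderiv_le : ∀ x i, |fderiv ℝ ζ x (EuclideanSpace.single i (1 : ℝ))| ≤ K / R
  lap_le : ∀ x, |∑ j, fderiv ℝ (fun y => fderiv ℝ ζ y (EuclideanSpace.single j (1 : ℝ))) x
      (EuclideanSpace.single j (1 : ℝ))| ≤ K / R ^ 2
  deriv_le : ∀ t, |deriv χ t| ≤ K / R ^ 2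

lemma exists_isCutoff : ∃ K : ℝ, 0 < K ∧ ∀ R : ℝ, 0 < R →
    ∃ (ζ : E3 → ℝ) (χ : ℝ → ℝ), IsCutoff K R ζ χ := by
  let f : ContDiffBump (0 : E3) := ⟨1 / 2, 3 / 4, by norm_num, by norm_num⟩
  let k : ContDiffBump (0 : ℝ) := ⟨1 / 4, 9 / 16, by norm_num, by norm_num⟩
  have hf : ContDiff ℝ (⊤ : ℕ∞) f := f.contDiff
  have hk : ContDiff ℝ (⊤ : ℕ∞) k := k.contDiff
  have hf1 : ∀ j : Fin 3, ContDiff ℝ (⊤ : ℕ∞)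
      (fun y => fderiv ℝ f y (EuclideanSpace.single j (1 : ℝ))) := fun j =>
    (hf.fderiv_right (m := (⊤ : ℕ∞)) (by simp)).clm_apply contDiff_const
  have hf1c : ∀ j : Fin 3, HasCompactSupport
      (fun y => fderiv ℝ f y (EuclideanSpace.single j (1 : ℝ))) := fun j =>
    f.hasCompactSupport.fderiv_apply (𝕜 := ℝ) _
  have hf2 : ∀ j : Fin 3, Continuous (fun x =>
      fderiv ℝ (fun y => fderiv ℝ f y (EuclideanSpace.single j (1 : ℝ))) x
      (EuclideanSpace.single j (1 : ℝ))) := fun j =>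
    ((hf1 j).continuous_fderiv (by simp)).clm_apply continuous_const
  have b1 : ∀ j : Fin 3, ∃ C, ∀ y, ‖fderiv ℝ f y (EuclideanSpace.single j (1 : ℝ))‖ ≤ C :=
    fun j => (hf1 j).continuous.bounded_above_of_compact_support (hf1c j)
  have b2 : ∀ j : Fin 3, ∃ C, ∀ x,
      ‖fderiv ℝ (fun y => fderiv ℝ f y (EuclideanSpace.single j (1 : ℝ))) x
      (EuclideanSpace.single j (1 : ℝ))‖ ≤ C := fun j =>
    (hf2 j).bounded_above_of_compact_support ((hf1c j).fderiv_apply (𝕜 := ℝ) _)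
  have b3 : ∃ C, ∀ t, ‖deriv k t‖ ≤ C :=
    (hk.continuous_deriv (by simp)).bounded_above_of_compact_support k.hasCompactSupport.deriv
  choose C1 hC1 using b1
  choose C2 hC2 using b2
  obtain ⟨C3, hC3⟩ := b3
  refine ⟨∑ j, |C1 j| + ∑ j, |C2 j| + |C3| + 1, by positivity, fun R hR => ?_⟩
  set K := ∑ j, |C1 j| + ∑ j, |C2 j| + |C3| + 1 with hK
  have hs1 : (0 : ℝ) ≤ ∑ j, |C1 j| := by positivity
  have hs2 : (0 : ℝ) ≤ ∑ j, |C2 j| := by positivity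
  have hs3 := abs_nonneg C3
  have hd : ∀ x (e : E3), fderiv ℝ (fun x : E3 => f (R⁻¹ • x)) x e
      = R⁻¹ * fderiv ℝ f (R⁻¹ • x) e := by
    intro x e
    rw [fderiv_comp_smul]
    simp
  refine ⟨fun x => f (R⁻¹ • x), fun t => k ((R ^ 2)⁻¹ * t), ?_⟩
  constructor
  · exact hf.comp (contDiff_const_smul _)
  · exact hk.comp (contDiff_const.mul contDiff_id)
  · exact fun x => f.nonneg
  · exact fun x => f.le_one
  · exact fun x => k.nonneg
  · exact fun x => k.le_one
  · intro x hx
    refine f.one_of_mem_closedBall ?_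
    rw [mem_ball_zero_iff] at hx
    rw [mem_closedBall_zero_iff, norm_smul, norm_inv, Real.norm_of_nonneg hR.le]
    change R⁻¹ * ‖x‖ ≤ 1 / 2
    rw [inv_mul_le_iff₀ hR]
    linarith
  · refine closure_minimal (fun x hx => ?_) isClosed_closedBall
    have : R⁻¹ • x ∈ Function.support f := hx
    rw [f.support_eq, mem_ball_zero_iff, norm_smul, norm_inv, Real.norm_of_nonneg hR.le] at this
    change R⁻¹ * ‖x‖ < 3 / 4 at this
    rw [inv_mul_lt_iff₀ hR] at this
    rw [mem_closedBall_zero_iff]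
    linarith
  · intro t ht
    refine k.one_of_mem_closedBall ?_
    rw [mem_closedBall_zero_iff, norm_mul, norm_inv, Real.norm_of_nonneg (sq_nonneg R)]
    change (R ^ 2)⁻¹ * ‖t‖ ≤ 1 / 4
    rw [inv_mul_le_iff₀ (by positivity), Real.norm_of_nonpos ht.2]
    linarith [ht.1]
  · intro t ht
    refine k.zero_of_le_dist ?_
    rw [dist_zero_right, norm_mul, norm_inv, Real.norm_of_nonneg (sq_nonneg R)]
    change 9 / 16 ≤ (R ^ 2)⁻¹ * ‖t‖
    rw [le_inv_mul_iff₀ (by positivity)]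
    have := neg_le_abs t
    rw [Real.norm_eq_abs]
    linarith
  · intro x i
    rw [hd, abs_mul, abs_of_pos (inv_pos.mpr hR), div_eq_inv_mul]
    refine mul_le_mul_of_nonneg_left ?_ (by positivity)
    have h1 := hC1 i (R⁻¹ • x)
    have h2 := Finset.single_le_sum (f := fun j => |C1 j|) (fun _ _ => abs_nonneg _)
      (Finset.mem_univ i)
    rw [Real.norm_eq_abs] at h1
    linarith [le_abs_self (C1 i)]
  · intro x
    simp_rw [hd]
    have : ∀ j : Fin 3, fderiv ℝ (fun y : E3 => R⁻¹ * fderiv ℝ f (R⁻¹ • y)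
        (EuclideanSpace.single j (1 : ℝ))) x (EuclideanSpace.single j (1 : ℝ))
        = (R ^ 2)⁻¹ * fderiv ℝ (fun y => fderiv ℝ f y (EuclideanSpace.single j (1 : ℝ)))
          (R⁻¹ • x) (EuclideanSpace.single j (1 : ℝ)) := by
      intro j
      rw [fderiv_const_mul]
      · rw [fderiv_comp_smul (f := fun y => fderiv ℝ f y (EuclideanSpace.single j (1 : ℝ)))]
        simp
        ring
      · exact (((hf1 j).differentiable (by simp)).comp (differentiable_id.const_smul (R⁻¹ : ℝ))) x
    simp_rw [this]
    rw [← Finset.mul_sum, abs_mul, abs_of_pos (by positivity), div_eq_inv_mul]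
    refine mul_le_mul_of_nonneg_left ?_ (by positivity)
    refine (Finset.abs_sum_le_sum_abs _ _).trans ?_
    calc _ ≤ ∑ j, |C2 j| := Finset.sum_le_sum fun j _ => (hC2 j _).trans (le_abs_self _)
      _ ≤ _ := by linarith
  · intro t
    have : deriv (fun t => k ((R ^ 2)⁻¹ * t)) t = (R ^ 2)⁻¹ * deriv k ((R ^ 2)⁻¹ * t) := by
      rw [deriv_comp_mul_left (R ^ 2)⁻¹ k t]
      simp
    rw [this, abs_mul, abs_of_pos (by positivity), div_eq_inv_mul]
    refine mul_le_mul_of_nonneg_left ?_ (by positivity)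
    have h1 := hC3 ((R ^ 2)⁻¹ * t)
    rw [Real.norm_eq_abs] at h1
    linarith [le_abs_self C3]

namespace IsCutoff

variable {K R : ℝ} {ζ : E3 → ℝ} {χ : ℝ → ℝ}

lemma fderiv_spaceDir (h : IsCutoff K R ζ χ) (x : E3) (s : ℝ) (i : Fin 3) :
    fderiv ℝ (fun z : E3 × ℝ => ζ z.1 * χ z.2) (x, s) (spaceDir i)
      = fderiv ℝ ζ x (EuclideanSpace.single i (1 : ℝ)) * χ s := by
  rw [spaceDir, fderiv_mul_prod (h.smooth_space.differentiable (by simp))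
    (h.smooth_time.differentiable (by simp))]
  simp

lemma fderiv_timeDir (h : IsCutoff K R ζ χ) (x : E3) (s : ℝ) :
    fderiv ℝ (fun z : E3 × ℝ => ζ z.1 * χ z.2) (x, s) timeDir = ζ x * deriv χ s := by
  rw [timeDir, fderiv_mul_prod (h.smooth_space.differentiable (by simp))
    (h.smooth_time.differentiable (by simp))]
  simp

lemma lapSpace_eq (h : IsCutoff K R ζ χ) (x : E3) (s : ℝ) :
    lapSpace (fun z : E3 × ℝ => ζ z.1 * χ z.2) (x, s)
      = (∑ j, fderiv ℝ (fun y => fderiv ℝ ζ y (EuclideanSpace.single j (1 : ℝ))) x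
      (EuclideanSpace.single j (1 : ℝ))) * χ s := by
  rw [lapSpace, Finset.sum_mul]
  refine Finset.sum_congr rfl fun j _ => ?_
  have h1 : (fun w => fderiv ℝ (fun z : E3 × ℝ => ζ z.1 * χ z.2) w (spaceDir j))
      = fun w : E3 × ℝ => fderiv ℝ ζ w.1 (EuclideanSpace.single j (1 : ℝ)) * χ w.2 := by
    funext w
    exact h.fderiv_spaceDir w.1 w.2 j
  have hs : ContDiff ℝ (⊤ : ℕ∞) (fun y => fderiv ℝ ζ y (EuclideanSpace.single j (1 : ℝ))) :=
    (h.smooth_space.fderiv_right (m := (⊤ : ℕ∞)) (by simp)).clm_apply contDiff_const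
  rw [h1, spaceDir, fderiv_mul_prod (ζ := fun y => fderiv ℝ ζ y
    (EuclideanSpace.single j (1 : ℝ))) (hs.differentiable (by simp))
    (h.smooth_time.differentiable (by simp))]
  simp

lemma smooth (h : IsCutoff K R ζ χ) :
    ContDiff ℝ (⊤ : ℕ∞) (fun z : E3 × ℝ => ζ z.1 * χ z.2) :=
  (h.smooth_space.comp contDiff_fst).mul (h.smooth_time.comp contDiff_snd)

lemma tsupport_subset (h : IsCutoff K R ζ χ) (hR : 0 < R) : tsupport ζ ⊆ ball 0 R :=
  h.tsupport_space.trans (closedBall_subset_ball (by linarith))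

lemma space_eq_zero (h : IsCutoff K R ζ χ) {x : E3} (hx : 3 / 4 * R < ‖x‖) : ζ x = 0 := by
  refine image_eq_zero_of_notMem_tsupport fun hm => ?_
  have := h.tsupport_space hm
  rw [mem_closedBall_zero_iff] at this
  linarith

lemma eq_zero_near_parabBdry (h : IsCutoff K R ζ χ) (hR : 0 < R) (hR1 : R ≤ 1) :
    ∃ U : Set (E3 × ℝ), IsOpen U ∧ parabBdry ⊆ U ∧ ∀ z ∈ U, ζ z.1 * χ z.2 = 0 := by
  refine ⟨{z | 3 / 4 * R < ‖z.1‖} ∪ {z | z.2 < -(9 / 16 * R ^ 2)}, ?_, ?_, ?_⟩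
  · exact (isOpen_lt continuous_const (by fun_prop)).union (isOpen_lt (by fun_prop) continuous_const)
  · rintro ⟨x, t⟩ (⟨hx, -⟩ | ⟨-, ht⟩)
    · left
      rw [mem_sphere_zero_iff_norm] at hx
      change 3 / 4 * R < ‖x‖
      rw [hx]; linarith
    · right
      change t < _
      rw [mem_singleton_iff] at ht
      change t = -1 at ht
      rw [ht]
      nlinarith
  · rintro ⟨x, t⟩ (hx | ht)
    · exact mul_eq_zero_of_left (h.space_eq_zero hx) _
    · exact mul_eq_zero_of_right _ (h.time_eq_zero t (le_of_lt ht))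

lemma abs_coeff_le (h : IsCutoff K R ζ χ) (x : E3) (s : ℝ) :
    |lapSpace (fun z : E3 × ℝ => ζ z.1 * χ z.2) (x, s)
      + fderiv ℝ (fun z : E3 × ℝ => ζ z.1 * χ z.2) (x, s) timeDir| ≤ 3 * K / R ^ 2 := by
  rw [h.lapSpace_eq, h.fderiv_timeDir]
  have h1 := h.lap_le x
  have h2 := h.deriv_le s
  have h3 : 0 ≤ K / R ^ 2 := (abs_nonneg _).trans h2
  refine (abs_add_le _ _).trans ?_
  rw [abs_mul, abs_mul, abs_of_nonneg (h.time_nonneg s), abs_of_nonneg (h.space_nonneg x)]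
  have h4 := mul_le_mul h1 (h.time_le_one s) (h.time_nonneg s) h3
  have h5 := mul_le_mul (h.space_le_one x) h2 (abs_nonneg _) zero_le_one
  calc _ ≤ K / R ^ 2 * 1 + 1 * (K / R ^ 2) := add_le_add h4 h5
    _ ≤ 3 * (K / R ^ 2) := by linarith
    _ = _ := by ring

lemma abs_flux_le (h : IsCutoff K R ζ χ) (y x : E3) (s : ℝ) :
    |∑ i, y i * fderiv ℝ (fun z : E3 × ℝ => ζ z.1 * χ z.2) (x, s) (spaceDir i)|
      ≤ 3 * K / R * ‖y‖ := by
  refine (Finset.abs_sum_le_sum_abs _ _).trans ?_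
  have hi : ∀ i : Fin 3, |y i * fderiv ℝ (fun z : E3 × ℝ => ζ z.1 * χ z.2) (x, s) (spaceDir i)|
      ≤ ‖y‖ * (K / R) := fun i => by
    rw [h.fderiv_spaceDir, abs_mul, abs_mul, abs_of_nonneg (h.time_nonneg s)]
    refine mul_le_mul (PiLp.norm_apply_le y i) ?_
      (mul_nonneg (abs_nonneg _) (h.time_nonneg s)) (norm_nonneg _)
    exact (mul_le_of_le_one_right (abs_nonneg _) (h.time_le_one s)).trans (h.fderiv_le x i)
  calc _ ≤ ∑ i : Fin 3, ‖y‖ * (K / R) := Finset.sum_le_sum fun i _ => hi i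
    _ = _ := by simp; ring

end IsCutoff

lemma integral_integral_eq_toReal_lintegral {α β : Type*} [MeasurableSpace α] [MeasurableSpace β]
    {μ : Measure α} {ν : Measure β} [SFinite μ] [SFinite ν] {f : α → β → ℝ}
    (hf0 : ∀ a b, 0 ≤ f a b)
    (hf : AEStronglyMeasurable (fun z : α × β => f z.1 z.2) (μ.prod ν))
    (hfin : ∫⁻ a, ∫⁻ b, ENNReal.ofReal (f a b) ∂ν ∂μ ≠ ∞) :
    ∫ a, ∫ b, f a b ∂ν ∂μ = (∫⁻ a, ∫⁻ b, ENNReal.ofReal (f a b) ∂ν ∂μ).toReal := by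
  have hm : AEMeasurable (fun a => ∫⁻ b, ENNReal.ofReal (f a b) ∂ν) μ :=
    AEMeasurable.lintegral_prod_right' (f := fun z : α × β => ENNReal.ofReal (f z.1 z.2))
      hf.aemeasurable.ennreal_ofReal
  rw [← integral_toReal hm (ae_lt_top' hm hfin)]
  refine integral_congr_ae ?_
  filter_upwards [hf.prodMk_left] with a ha
  exact integral_eq_lintegral_of_nonneg_ae (Eventually.of_forall (hf0 a)) ha

lemma restrict_QSet (R : ℝ) : (volume.restrict (QSet R) : Measure (E3 × ℝ))
    = (volume.restrict (ball (0 : E3) R)).prod (volume.restrict (timeI R)) := by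
  rw [Measure.volume_eq_prod, QSet, ballB, Measure.prod_restrict]

lemma timeI_subset {r R : ℝ} (hr : 0 ≤ r) (h : r ≤ R) : timeI r ⊆ timeI R :=
  Ioo_subset_Ioo_left (by nlinarith)

lemma QSet_subset {r R : ℝ} (hr : 0 ≤ r) (h : r ≤ R) : QSet r ⊆ QSet R :=
  prod_mono (ball_subset_ball h) (timeI_subset hr h)

lemma AEStronglyMeasurable.swap_QSet {F : Type*} [TopologicalSpace F] {f : E3 → ℝ → F}
    {R : ℝ} (hR : 0 ≤ R) (hR1 : R ≤ 1)
    (hf : AEStronglyMeasurable (fun z : E3 × ℝ => f z.1 z.2) (volume.restrict (QSet 1))) :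
    AEStronglyMeasurable (fun z : ℝ × E3 => f z.2 z.1)
      ((volume.restrict (timeI R)).prod (volume.restrict (ball 0 R))) := by
  have h := hf.mono_measure (Measure.restrict_mono (QSet_subset hR hR1) le_rfl)
  rw [restrict_QSet] at h
  exact h.prod_swap

lemma IntegrableOn.swap_QSet {f : E3 → ℝ → ℝ} {R : ℝ} (hR : 0 ≤ R) (hR1 : R ≤ 1)
    (hf : IntegrableOn (fun z : E3 × ℝ => f z.1 z.2) (QSet 1)) :
    Integrable (fun z : ℝ × E3 => f z.2 z.1)
      ((volume.restrict (timeI R)).prod (volume.restrict (ball 0 R))) := by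
  have h := hf.mono_set (QSet_subset hR hR1)
  rw [IntegrableOn, restrict_QSet] at h
  exact h.swap

lemma lintegral_lintegral_ofReal_ne_top {α β : Type*} [MeasurableSpace α] [MeasurableSpace β]
    {μ : Measure α} {ν : Measure β} [SFinite μ] [SFinite ν] {f : α → β → ℝ}
    (hf : Integrable (fun z : α × β => f z.1 z.2) (μ.prod ν)) :
    ∫⁻ a, ∫⁻ b, ENNReal.ofReal (f a b) ∂ν ∂μ ≠ ∞ := by
  rw [← lintegral_prod (fun z : α × β => ENNReal.ofReal (f z.1 z.2))
    hf.aemeasurable.ennreal_ofReal]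
  exact hf.lintegral_lt_top.ne

lemma setIntegral_mul_eq_of_subset {R S : ℝ} (h : R ≤ S) {f φ : E3 → ℝ}
    (hφ : ∀ x, x ∉ ball (0 : E3) R → φ x = 0) :
    ∫ x in ball (0 : E3) S, f x * φ x = ∫ x in ball (0 : E3) R, f x * φ x := by
  refine setIntegral_eq_of_subset_of_forall_sdiff_eq_zero measurableSet_ball
    (ball_subset_ball h) fun x hx => ?_
  rw [hφ x hx.2, mul_zero]

lemma fderiv_eq_zero_of_notMem {R : ℝ} {φ : E3 → ℝ} (hφ : tsupport φ ⊆ ball 0 R) {x : E3}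
    (hx : x ∉ ball (0 : E3) R) : fderiv ℝ φ x = 0 := by
  by_contra h
  exact hx (hφ (support_fderiv_subset ℝ h))

namespace VelocityClass

variable {v : E3 → ℝ → E3} {gv : E3 → ℝ → Fin 3 → Fin 3 → ℝ} {R : ℝ}

lemma ae_sliceRegular (h : VelocityClass v gv 1) (hR : 0 ≤ R) (hR1 : R ≤ 1) :
    ∀ᵐ t ∂(volume.restrict (timeI R)),
      SliceRegular (fun x => v x t) (fun x => gv x t) R := by
  have h1 := (AEStronglyMeasurable.swap_QSet hR hR1 h.v_meas.aestronglyMeasurable).prodMk_left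
  have h2 := (IntegrableOn.swap_QSet (f := fun x t => ‖v x t‖ ^ 2) hR hR1 h.v_L2).prod_right_ae
  have h3 := (IntegrableOn.swap_QSet (f := fun x t => ∑ i, ∑ j, gv x t i j ^ 2) hR hR1
    h.grad_L2).prod_right_ae
  have h4 : ∀ᵐ t ∂(volume.restrict (timeI R)), _ :=
    ae_mono (Measure.restrict_mono (timeI_subset hR hR1) le_rfl) h.isGrad
  filter_upwards [h1, h2, h3, h4] with t h1 h2 h3 h4
  refine ⟨h1, ?_, h3, fun φ hφ hs i j => ?_⟩
  · have := h2.lintegral_lt_top.ne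
    refine ne_of_eq_of_ne (lintegral_congr fun x => ?_) this
    rw [ENNReal.ofReal_pow (norm_nonneg _), ofReal_norm]
  · have := h4 φ hφ (hs.trans (ball_subset_ball hR1)) i j
    rw [ballB, setIntegral_mul_eq_of_subset hR1, setIntegral_mul_eq_of_subset hR1] at this
    · exact this
    · exact fun x hx => image_eq_zero_of_notMem_tsupport fun hm => hx (hs hm)
    · exact fun x hx => by rw [fderiv_eq_zero_of_notMem hs hx]; rfl

lemma exists_ae_lintegral_sq_le (h : VelocityClass v gv 1) (hR : 0 ≤ R) (hR1 : R ≤ 1) :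
    ∃ M : ℝ, ∀ᵐ t ∂(volume.restrict (timeI R)),
      ∫⁻ x in ball (0 : E3) R, ‖v x t‖ₑ ^ 2 ≤ ENNReal.ofReal M := by
  obtain ⟨M, hM⟩ := h.v_Linfty
  refine ⟨M, ae_mono (Measure.restrict_mono (timeI_subset hR hR1) le_rfl) ?_⟩
  have h2 := (IntegrableOn.swap_QSet (f := fun x t => ‖v x t‖ ^ 2) zero_le_one le_rfl
    h.v_L2).prod_right_ae
  filter_upwards [hM, h2] with t ht h2
  refine (lintegral_mono_set (ball_subset_ball hR1)).trans ?_
  refine le_trans (le_of_eq ?_) (ENNReal.ofReal_le_ofReal ht)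
  rw [ballB, ofReal_integral_eq_lintegral_ofReal h2 (Eventually.of_forall fun x => by positivity)]
  refine lintegral_congr fun x => ?_
  rw [ENNReal.ofReal_pow (norm_nonneg _), ofReal_norm]

lemma aemeasurable_lintegral_pow (h : VelocityClass v gv 1) (hR : 0 ≤ R) (hR1 : R ≤ 1) (n : ℕ) :
    AEMeasurable (fun t => ∫⁻ x in ball (0 : E3) R, ‖v x t‖ₑ ^ n)
      (volume.restrict (timeI R)) :=
  AEMeasurable.lintegral_prod_right' (f := fun z : ℝ × E3 => ‖v z.2 z.1‖ₑ ^ n)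
    ((AEStronglyMeasurable.swap_QSet hR hR1 h.v_meas.aestronglyMeasurable).enorm.pow_const n)

lemma aemeasurable_lintegral_grad (h : VelocityClass v gv 1) (hR : 0 ≤ R) (hR1 : R ≤ 1) :
    AEMeasurable (fun t => ∫⁻ x in ball (0 : E3) R, ENNReal.ofReal (∑ i, ∑ j, gv x t i j ^ 2))
      (volume.restrict (timeI R)) :=
  AEMeasurable.lintegral_prod_right' (f := fun z : ℝ × E3 =>
      ENNReal.ofReal (∑ i, ∑ j, gv z.2 z.1 i j ^ 2))
    (IntegrableOn.swap_QSet (f := fun x t => ∑ i, ∑ j, gv x t i j ^ 2) hR hR1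
      h.grad_L2).aemeasurable.ennreal_ofReal

lemma lintegral_grad_ne_top (h : VelocityClass v gv 1) (hR : 0 ≤ R) (hR1 : R ≤ 1) :
    ∫⁻ t in timeI R, ∫⁻ x in ball (0 : E3) R, ENNReal.ofReal (∑ i, ∑ j, gv x t i j ^ 2) ≠ ∞ :=
  lintegral_lintegral_ofReal_ne_top (f := fun t x => ∑ i, ∑ j, gv x t i j ^ 2)
    (IntegrableOn.swap_QSet (f := fun x t => ∑ i, ∑ j, gv x t i j ^ 2) hR hR1 h.grad_L2)

lemma lintegral_cube_ne_top (h : VelocityClass v gv 1) (hR : 0 < R) (hR1 : R ≤ 1) :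
    ∫⁻ t in timeI R, ∫⁻ x in ball (0 : E3) R, ‖v x t‖ₑ ^ 3 ≠ ∞ := by
  obtain ⟨M, hM⟩ := h.exists_ae_lintegral_sq_le hR.le hR1
  set b : ℝ → ℝ≥0∞ := fun t =>
    ∫⁻ x in ball (0 : E3) R, ENNReal.ofReal (∑ i, ∑ j, gv x t i j ^ 2) with hb
  set V : ℝ≥0∞ := volume (ball (0 : E3) R) with hV
  have hV0 : V ≠ 0 := (measure_ball_pos volume _ hR).ne'
  have hVt : V ≠ ∞ := measure_ball_lt_top.ne
  set m : ℝ≥0∞ := V⁻¹ * (3 * (ENNReal.ofReal M + V)) with hm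
  have hmt : m ≠ ∞ := by rw [hm]; finiteness
  have key : ∀ᵐ t ∂(volume.restrict (timeI R)), ∫⁻ x in ball (0 : E3) R, ‖v x t‖ₑ ^ 3
      ≤ 4 * (8957952 * (ENNReal.ofReal M ^ (3 / 4 : ℝ) * (1 + b t)) + m ^ 3 * V) := by
    filter_upwards [hM, h.ae_sliceRegular hR.le hR1] with t ht hs
    set w := meanVec R (fun x => v x t) with hw
    have h1 : ∀ x, ‖v x t‖ₑ ^ 3 ≤ 4 * (‖v x t - w‖ₑ ^ 3 + ‖w‖ₑ ^ 3) := fun x => by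
      have h2 : ‖v x t‖ₑ ≤ ‖v x t - w‖ₑ + ‖w‖ₑ := by
        simpa using enorm_add_le (v x t - w) w
      refine (pow_le_pow_left' h2 3).trans ?_
      have := ENNReal.rpow_add_le_mul_rpow_add_rpow ‖v x t - w‖ₑ ‖w‖ₑ (p := 3) (by norm_num)
      norm_num at this
      exact_mod_cast this
    have h3 : ‖w‖ₑ ≤ m := by
      have h4 := SliceRegular.volume_mul_enorm_meanVec_le (fun x => v x t) hR
      have h5 : ∫⁻ x in ball (0 : E3) R, ‖v x t‖ₑ ≤ ENNReal.ofReal M + V := by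
        calc _ ≤ ∫⁻ x in ball (0 : E3) R, (‖v x t‖ₑ ^ 2 + 1) := by
              refine lintegral_mono fun x => ?_
              rcases le_total ‖v x t‖ₑ 1 with h | h
              · exact h.trans le_add_self
              · exact (le_self_pow₀ h two_ne_zero).trans le_self_add
          _ = (∫⁻ x in ball (0 : E3) R, ‖v x t‖ₑ ^ 2) + V := by
              rw [lintegral_add_right _ measurable_const]; simp [hV]
          _ ≤ _ := by gcongr
      rw [hm, ← ENNReal.mul_le_mul_iff_right hV0 hVt, ← mul_assoc, ENNReal.mul_inv_cancel hV0 hVt,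
        one_mul]
      exact h4.trans (mul_le_mul' le_rfl h5)
    have h6 : b t ^ (3 / 4 : ℝ) ≤ 1 + b t := by
      rcases le_total (b t) 1 with h | h
      · exact (ENNReal.rpow_le_one h (by norm_num)).trans le_self_add
      · exact (ENNReal.rpow_le_rpow_of_exponent_le h (z := 1) (by norm_num)).trans
          (by rw [ENNReal.rpow_one]; exact le_add_self)
    calc _ ≤ ∫⁻ x in ball (0 : E3) R, 4 * (‖v x t - w‖ₑ ^ 3 + ‖w‖ₑ ^ 3) := lintegral_mono h1
      _ = 4 * ((∫⁻ x in ball (0 : E3) R, ‖v x t - w‖ₑ ^ 3) + ‖w‖ₑ ^ 3 * V) := by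
        rw [lintegral_const_mul' _ _ (by simp), lintegral_add_right _ measurable_const]
        simp [hV]
      _ ≤ _ := by
        gcongr
        refine (hs.lintegral_sub_meanVec_cube_le hR).trans ?_
        gcongr
  refine ne_top_of_le_ne_top ?_ (lintegral_mono_ae key)
  have hbt : ∫⁻ t in timeI R, b t ≠ ∞ := h.lintegral_grad_ne_top hR.le hR1
  have hMt : ENNReal.ofReal M ^ (3 / 4 : ℝ) ≠ ∞ :=
    ENNReal.rpow_ne_top_of_nonneg (by norm_num) ENNReal.ofReal_ne_top
  have hI : volume (timeI R) ≠ ∞ := by rw [timeI]; simp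
  rw [lintegral_const_mul' _ _ (by simp), lintegral_add_right _ measurable_const,
    lintegral_const_mul' _ _ (by simp),
    lintegral_const_mul' _ _ hMt,
    lintegral_add_left measurable_const]
  simp only [lintegral_const, Measure.restrict_apply_univ]
  finiteness

end VelocityClass

lemma enorm_abs_rpow (a : ℝ) {q : ℝ} (hq : 0 ≤ q) :
    ENNReal.ofReal (|a| ^ q) = ‖a‖ₑ ^ q := by
  rw [← ENNReal.ofReal_rpow_of_nonneg (abs_nonneg a) hq, ← Real.norm_eq_abs, ofReal_norm]

lemma lintegral_sub_avgB_rpow_le {R : ℝ} (hR : 0 < R) {p : E3 → ℝ}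
    (hp : AEStronglyMeasurable p (volume.restrict (ball 0 R))) :
    ∫⁻ x in ball (0 : E3) R, ‖p x - avgB R p‖ₑ ^ (3 / 2 : ℝ)
      ≤ 4 * ∫⁻ x in ball (0 : E3) R, ‖p x‖ₑ ^ (3 / 2 : ℝ) := by
  set V : ℝ≥0∞ := volume (ball (0 : E3) R) with hV
  have hV0 : V ≠ 0 := (measure_ball_pos volume _ hR).ne'
  have hVt : V ≠ ∞ := measure_ball_lt_top.ne
  set D := ∫⁻ x in ball (0 : E3) R, ‖p x‖ₑ ^ (3 / 2 : ℝ) with hD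
  have h1 : V * ‖avgB R p‖ₑ ≤ D ^ (2 / 3 : ℝ) * V ^ (1 / 3 : ℝ) := by
    refine (volume_mul_enorm_avgB_le hR).trans ?_
    have := ENNReal.lintegral_mul_norm_pow_le (μ := volume.restrict (ball (0 : E3) R))
      (f := fun x => ‖p x‖ₑ ^ (3 / 2 : ℝ)) (g := fun _ => 1) (hp.enorm.pow_const _)
      aemeasurable_const (p := 2 / 3) (q := 1 / 3) (by norm_num) (by norm_num) (by norm_num)
    simp only [← ENNReal.rpow_mul, ENNReal.one_rpow, mul_one, lintegral_const,
      Measure.restrict_apply_univ, one_mul] at this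
    norm_num at this
    simpa [hD, hV] using this
  have h2 : V * ‖avgB R p‖ₑ ^ (3 / 2 : ℝ) ≤ D := by
    have h3 := ENNReal.rpow_le_rpow h1 (z := 3 / 2) (by norm_num)
    rw [ENNReal.mul_rpow_of_nonneg _ _ (by norm_num), ENNReal.mul_rpow_of_nonneg _ _ (by norm_num),
      ← ENNReal.rpow_mul, ← ENNReal.rpow_mul] at h3
    norm_num at h3
    have h4 : V ^ (3 / 2 : ℝ) = V ^ (1 / 2 : ℝ) * V := by
      conv_rhs => rw [← ENNReal.rpow_one V, ← ENNReal.rpow_mul, ← ENNReal.rpow_add _ _ hV0 hVt]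
      norm_num
    rw [h4, mul_assoc, mul_comm D] at h3
    refine (ENNReal.mul_le_mul_iff_right ?_ ?_).mp h3
    · exact (ENNReal.rpow_pos (pos_iff_ne_zero.mpr hV0) hVt).ne'
    · exact ENNReal.rpow_ne_top_of_nonneg (by norm_num) hVt
  have h5 : ∀ x, ‖p x - avgB R p‖ₑ ^ (3 / 2 : ℝ)
      ≤ 2 * (‖p x‖ₑ ^ (3 / 2 : ℝ) + ‖avgB R p‖ₑ ^ (3 / 2 : ℝ)) := fun x => by
    refine (ENNReal.rpow_le_rpow enorm_sub_le (by norm_num)).trans ?_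
    refine (ENNReal.rpow_add_le_mul_rpow_add_rpow _ _ (by norm_num)).trans ?_
    gcongr
    calc (2 : ℝ≥0∞) ^ (3 / 2 - 1 : ℝ) ≤ 2 ^ (1 : ℝ) :=
          ENNReal.rpow_le_rpow_of_exponent_le (by norm_num) (by norm_num)
      _ = 2 := ENNReal.rpow_one 2
  calc _ ≤ ∫⁻ x in ball (0 : E3) R, 2 * (‖p x‖ₑ ^ (3 / 2 : ℝ) + ‖avgB R p‖ₑ ^ (3 / 2 : ℝ)) :=
        lintegral_mono h5
    _ = 2 * (D + V * ‖avgB R p‖ₑ ^ (3 / 2 : ℝ)) := by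
        rw [lintegral_const_mul' _ _ (by simp), lintegral_add_right _ measurable_const]
        simp [hD, hV, mul_comm]
    _ ≤ 2 * (D + D) := by gcongr
    _ = _ := by ring

namespace SuitableWeakSolution

variable {v : E3 → ℝ → E3} {gv : E3 → ℝ → Fin 3 → Fin 3 → ℝ} {p : E3 → ℝ → ℝ} {R : ℝ}

lemma aestronglyMeasurable_pressure_sub (h : SuitableWeakSolution v gv p) (hR : 0 ≤ R)
    (hR1 : R ≤ 1) :
    AEStronglyMeasurable (fun z : ℝ × E3 => p z.2 z.1 - avgB R (fun y => p y z.1))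
      ((volume.restrict (timeI R)).prod (volume.restrict (ball 0 R))) := by
  have h1 := AEStronglyMeasurable.swap_QSet hR hR1 h.p_meas.aestronglyMeasurable
  refine h1.sub ?_
  have h2 := h1.integral_prod_right'
  have h3 : AEStronglyMeasurable (fun t => avgB R (fun y => p y t))
      (volume.restrict (timeI R)) := by
    simp only [avgB, setAverage_eq]
    exact h2.const_smul (volume.real (ball (0 : E3) R))⁻¹
  exact h3.comp_fst

lemma ae_aestronglyMeasurable_pressure (h : SuitableWeakSolution v gv p) (hR : 0 ≤ R)
    (hR1 : R ≤ 1) : ∀ᵐ t ∂(volume.restrict (timeI R)),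
      AEStronglyMeasurable (fun x => p x t) (volume.restrict (ball 0 R)) :=
  (AEStronglyMeasurable.swap_QSet hR hR1 h.p_meas.aestronglyMeasurable).prodMk_left

lemma aemeasurable_lintegral_pressure (h : SuitableWeakSolution v gv p) (hR : 0 ≤ R)
    (hR1 : R ≤ 1) :
    AEMeasurable (fun t => ∫⁻ x in ball (0 : E3) R,
      ‖p x t - avgB R (fun y => p y t)‖ₑ ^ (3 / 2 : ℝ)) (volume.restrict (timeI R)) :=
  AEMeasurable.lintegral_prod_right'
    (f := fun z : ℝ × E3 => ‖p z.2 z.1 - avgB R (fun y => p y z.1)‖ₑ ^ (3 / 2 : ℝ))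
    ((h.aestronglyMeasurable_pressure_sub hR hR1).enorm.pow_const _)

lemma lintegral_pressure_ne_top (h : SuitableWeakSolution v gv p) (hR : 0 < R) (hR1 : R ≤ 1) :
    ∫⁻ t in timeI R, ∫⁻ x in ball (0 : E3) R,
      ‖p x t - avgB R (fun y => p y t)‖ₑ ^ (3 / 2 : ℝ) ≠ ∞ := by
  have h1 := lintegral_lintegral_ofReal_ne_top (f := fun t x => |p x t| ^ (3 / 2 : ℝ))
    (IntegrableOn.swap_QSet (f := fun x t => |p x t| ^ (3 / 2 : ℝ)) hR.le hR1 h.p_L32)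
  have h2 : ∫⁻ t in timeI R, ∫⁻ x in ball (0 : E3) R,
      ‖p x t - avgB R (fun y => p y t)‖ₑ ^ (3 / 2 : ℝ)
      ≤ ∫⁻ t in timeI R, 4 * ∫⁻ x in ball (0 : E3) R, ENNReal.ofReal (|p x t| ^ (3 / 2 : ℝ)) := by
    refine lintegral_mono_ae ?_
    filter_upwards [h.ae_aestronglyMeasurable_pressure hR.le hR1] with t ht
    simp_rw [enorm_abs_rpow _ (show (0 : ℝ) ≤ 3 / 2 by norm_num)]
    exact lintegral_sub_avgB_rpow_le hR ht
  refine ne_top_of_le_ne_top ?_ h2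
  rw [lintegral_const_mul' _ _ (by simp)]
  finiteness

lemma ae_div_free (h : SuitableWeakSolution v gv p) {ζ : E3 → ℝ} (hζ : ContDiff ℝ (⊤ : ℕ∞) ζ)
    (hs : tsupport ζ ⊆ ball 0 1) :
    ∀ᵐ t ∂(volume.restrict (timeI 1)),
      ∫ x in ball (0 : E3) 1, ∑ i, v x t i * fderiv ℝ ζ x (EuclideanSpace.single i (1 : ℝ)) = 0 := by
  set F : ℝ × E3 → ℝ := fun z =>
    ∑ i, v z.2 z.1 i * fderiv ℝ ζ z.2 (EuclideanSpace.single i (1 : ℝ)) with hF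
  have hc : HasCompactSupport ζ := hasCompactSupport_of_tsupport_subset_ball hs
  have hgc : ∀ i : Fin 3, Continuous fun x => fderiv ℝ ζ x (EuclideanSpace.single i (1 : ℝ)) :=
    fun i => (hζ.continuous_fderiv (by simp)).clm_apply continuous_const
  have hb : ∀ i : Fin 3, ∃ C, ∀ x, ‖fderiv ℝ ζ x (EuclideanSpace.single i (1 : ℝ))‖ ≤ C :=
    fun i => (hgc i).bounded_above_of_compact_support (hc.fderiv_apply (𝕜 := ℝ) _)
  choose C hC using hb
  have hvm := AEStronglyMeasurable.swap_QSet zero_le_one le_rfl h.vel.v_meas.aestronglyMeasurable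
  have hv2 := IntegrableOn.swap_QSet (f := fun x t => ‖v x t‖ ^ 2) zero_le_one le_rfl h.vel.v_L2
  have hfin : IsFiniteMeasure ((volume.restrict (timeI 1)).prod
      (volume.restrict (ball (0 : E3) 1))) := by
    have : IsFiniteMeasure (volume.restrict (timeI 1)) := ⟨by simp [timeI]⟩
    have : IsFiniteMeasure (volume.restrict (ball (0 : E3) 1)) :=
      ⟨by simp⟩
    infer_instance
  have hFi : Integrable F ((volume.restrict (timeI 1)).prod (volume.restrict (ball 0 1))) := by
    refine integrable_finsetSum _ fun i _ => ?_
    refine Integrable.mul_bdd (c := C i) ?_ ?_ (Eventually.of_forall fun z => hC i z.2)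
    · refine Integrable.mono' (hv2.add (integrable_const 1)) ?_ (Eventually.of_forall fun z => ?_)
      · exact (EuclideanSpace.proj i : E3 →L[ℝ] ℝ).continuous.comp_aestronglyMeasurable hvm
      · have h1 := PiLp.norm_apply_le (v z.2 z.1) i
        simp only [Pi.add_apply]
        nlinarith [norm_nonneg (v z.2 z.1), sq_nonneg (‖v z.2 z.1‖ - 1)]
    · exact ((hgc i).comp continuous_snd).aestronglyMeasurable
  have hI := hFi.integral_prod_left
  rw [ae_restrict_iff' (show MeasurableSet (timeI 1) from measurableSet_Ioo)]
  refine (show IsOpen (timeI 1) from isOpen_Ioo).ae_eq_zero_of_integral_contDiff_smul_eq_zero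
    (IntegrableOn.locallyIntegrableOn hI) fun η hη hηc hηs => ?_
  have hq : ContDiff ℝ (⊤ : ℕ∞) (fun z : E3 × ℝ => ζ z.1 * η z.2) :=
    (hζ.comp contDiff_fst).mul (hη.comp contDiff_snd)
  have hqs : tsupport (fun z : E3 × ℝ => ζ z.1 * η z.2) ⊆ QSet 1 := by
    have : tsupport (fun z : E3 × ℝ => ζ z.1 * η z.2) ⊆ tsupport ζ ×ˢ tsupport η := by
      refine closure_minimal (fun z hz => ?_) ((isClosed_tsupport _).prod (isClosed_tsupport _))
      exact ⟨subset_tsupport _ (left_ne_zero_of_mul hz), subset_tsupport _ (right_ne_zero_of_mul hz)⟩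
    exact this.trans (prod_mono hs hηs)
  have h0 := h.nse.2 _ hq hqs
  have e1 : ∀ z : E3 × ℝ, ∑ i, v z.1 z.2 i *
      fderiv ℝ (fun z : E3 × ℝ => ζ z.1 * η z.2) z (spaceDir i) = η z.2 * F (z.2, z.1) := by
    rintro ⟨x, s⟩
    rw [hF, Finset.mul_sum]
    refine Finset.sum_congr rfl fun i _ => ?_
    rw [spaceDir, fderiv_mul_prod (hζ.differentiable (by simp)) (hη.differentiable (by simp))]
    ring
  simp_rw [e1] at h0
  obtain ⟨Cη, hCη⟩ := hη.continuous.bounded_above_of_compact_support hηc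
  have hηF : Integrable (fun z => η z.1 * F z)
      ((volume.restrict (timeI 1)).prod (volume.restrict (ball 0 1))) :=
    hFi.bdd_mul (c := Cη) (hη.continuous.comp continuous_fst).aestronglyMeasurable
      (Eventually.of_forall fun z => hCη z.1)
  rw [restrict_QSet] at h0
  have h2 := integral_prod_swap (μ := volume.restrict (timeI 1))
    (ν := volume.restrict (ball (0 : E3) 1)) (fun z : ℝ × E3 => η z.1 * F z)
  simp only [Prod.swap] at h2
  rw [h0, integral_prod _ hηF] at h2
  simp_rw [integral_const_mul] at h2
  rw [← setIntegral_eq_integral_of_forall_compl_eq_zero (s := timeI 1)]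
  · exact h2.symm
  · intro t ht
    rw [image_eq_zero_of_notMem_tsupport fun hm => ht (hηs hm), zero_smul]

end SuitableWeakSolution

lemma lintegral_fluxTerms_le {β : Type*} [MeasurableSpace β] {μ : Measure β}
    {α b c d : β → ℝ≥0∞} {a : ℝ≥0∞} (hb : AEMeasurable b μ) (hc : AEMeasurable c μ)
    (hd : AEMeasurable d μ) (ha : a ≠ ∞) (hα : ∀ᵐ t ∂μ, α t ≤ a) :
    ∫⁻ t, (c t ^ (2 / 3 : ℝ) + c t ^ (1 / 3 : ℝ) * (α t ^ (1 / 2 : ℝ) * b t ^ (1 / 2 : ℝ))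
        + c t ^ (1 / 3 : ℝ) * d t ^ (2 / 3 : ℝ)) ∂μ
      ≤ (∫⁻ t, c t ∂μ) ^ (2 / 3 : ℝ) * μ univ ^ (1 / 3 : ℝ)
        + a ^ (1 / 2 : ℝ) * (((∫⁻ t, c t ∂μ) ^ (2 / 3 : ℝ) * μ univ ^ (1 / 3 : ℝ)) ^ (1 / 2 : ℝ)
          * (∫⁻ t, b t ∂μ) ^ (1 / 2 : ℝ))
        + (∫⁻ t, c t ∂μ) ^ (1 / 3 : ℝ) * (∫⁻ t, d t ∂μ) ^ (2 / 3 : ℝ) := by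
  have h1 : ∫⁻ t, c t ^ (2 / 3 : ℝ) ∂μ
      ≤ (∫⁻ t, c t ∂μ) ^ (2 / 3 : ℝ) * μ univ ^ (1 / 3 : ℝ) := by
    have := ENNReal.lintegral_mul_norm_pow_le hc (aemeasurable_const (b := (1 : ℝ≥0∞)))
      (p := 2 / 3) (q := 1 / 3) (by norm_num) (by norm_num) (by norm_num)
    simpa using this
  have h2 : ∫⁻ t, c t ^ (1 / 3 : ℝ) * b t ^ (1 / 2 : ℝ) ∂μ
      ≤ (∫⁻ t, c t ^ (2 / 3 : ℝ) ∂μ) ^ (1 / 2 : ℝ) * (∫⁻ t, b t ∂μ) ^ (1 / 2 : ℝ) := by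
    have := ENNReal.lintegral_mul_norm_pow_le (hc.pow_const (2 / 3 : ℝ)) hb
      (p := 1 / 2) (q := 1 / 2) (by norm_num) (by norm_num) (by norm_num)
    simp only [← ENNReal.rpow_mul] at this
    norm_num at this ⊢
    exact this
  have h3 : ∫⁻ t, c t ^ (1 / 3 : ℝ) * d t ^ (2 / 3 : ℝ) ∂μ
      ≤ (∫⁻ t, c t ∂μ) ^ (1 / 3 : ℝ) * (∫⁻ t, d t ∂μ) ^ (2 / 3 : ℝ) :=
    ENNReal.lintegral_mul_norm_pow_le hc hd (by norm_num) (by norm_num) (by norm_num)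
  have hat : a ^ (1 / 2 : ℝ) ≠ ∞ := ENNReal.rpow_ne_top_of_nonneg (by norm_num) ha
  have hm1 : AEMeasurable (fun t => c t ^ (2 / 3 : ℝ)) μ := hc.pow_const _
  have hm3 : AEMeasurable (fun t => c t ^ (1 / 3 : ℝ) * d t ^ (2 / 3 : ℝ)) μ :=
    (hc.pow_const _).mul (hd.pow_const _)
  calc _ ≤ ∫⁻ t, (c t ^ (2 / 3 : ℝ)
          + a ^ (1 / 2 : ℝ) * (c t ^ (1 / 3 : ℝ) * b t ^ (1 / 2 : ℝ))
          + c t ^ (1 / 3 : ℝ) * d t ^ (2 / 3 : ℝ)) ∂μ := by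
        refine lintegral_mono_ae ?_
        filter_upwards [hα] with t ht
        rw [mul_left_comm]
        gcongr
    _ = (∫⁻ t, c t ^ (2 / 3 : ℝ) ∂μ)
          + a ^ (1 / 2 : ℝ) * (∫⁻ t, c t ^ (1 / 3 : ℝ) * b t ^ (1 / 2 : ℝ) ∂μ)
          + ∫⁻ t, c t ^ (1 / 3 : ℝ) * d t ^ (2 / 3 : ℝ) ∂μ := by
        rw [lintegral_add_right' _ hm3, lintegral_add_left' hm1, lintegral_const_mul' _ _ hat]
    _ ≤ _ := by
        gcongr
        exact h2.trans (by gcongr)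

/-- The right-hand side of the local energy estimate. -/
def energyRHS (v : E3 → ℝ → E3) (gv : E3 → ℝ → Fin 3 → Fin 3 → ℝ) (p : E3 → ℝ → ℝ) (R : ℝ) : ℝ :=
  funC v R ^ ((2 : ℝ) / 3) + funC v R ^ ((1 : ℝ) / 3) * funD0 p R ^ ((2 : ℝ) / 3)
    + funA v R ^ ((1 : ℝ) / 2) * funC v R ^ ((1 : ℝ) / 3) * funE gv R ^ ((1 : ℝ) / 2)

lemma volume_timeI (R : ℝ) : volume (timeI R) = ENNReal.ofReal (R ^ 2) := by
  simp [timeI]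

lemma restrict_timeI_ne_zero {R : ℝ} (hR : 0 < R) : volume.restrict (timeI R) ≠ 0 := by
  rw [Ne, Measure.restrict_eq_zero, volume_timeI, ENNReal.ofReal_eq_zero, not_le]
  positivity

namespace SuitableWeakSolution

variable {v : E3 → ℝ → E3} {gv : E3 → ℝ → Fin 3 → Fin 3 → ℝ} {p : E3 → ℝ → ℝ} {R : ℝ}

lemma lintegral_cube_eq (h : SuitableWeakSolution v gv p) (hR : 0 < R) (hR1 : R ≤ 1) :
    ∫⁻ t in timeI R, ∫⁻ x in ball (0 : E3) R, ‖v x t‖ₑ ^ 3 = ENNReal.ofReal (R ^ 2 * funC v R) := by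
  have h1 := h.vel.lintegral_cube_ne_top hR hR1
  have e : ∀ x t, ‖v x t‖ₑ ^ 3 = ENNReal.ofReal (‖v x t‖ ^ 3) := fun x t => by
    rw [ENNReal.ofReal_pow (norm_nonneg _), ofReal_norm]
  simp_rw [e] at h1 ⊢
  have h2 := integral_integral_eq_toReal_lintegral (f := fun t x => ‖v x t‖ ^ 3)
    (fun _ _ => by positivity)
    ((AEStronglyMeasurable.swap_QSet hR.le hR1 h.vel.v_meas.aestronglyMeasurable).norm.pow 3) h1
  have h3 : R ^ 2 * funC v R = (∫⁻ t in timeI R, ∫⁻ x in ball (0 : E3) R,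
      ENNReal.ofReal (‖v x t‖ ^ 3)).toReal := by
    rw [← h2, funC, ballB]
    field_simp
  rw [h3, ENNReal.ofReal_toReal h1]

lemma lintegral_grad_eq (h : SuitableWeakSolution v gv p) (hR : 0 < R) (hR1 : R ≤ 1) :
    ∫⁻ t in timeI R, ∫⁻ x in ball (0 : E3) R, ENNReal.ofReal (∑ i, ∑ j, gv x t i j ^ 2)
      = ENNReal.ofReal (R * funE gv R) := by
  have h1 := h.vel.lintegral_grad_ne_top hR.le hR1
  have h2 := integral_integral_eq_toReal_lintegral (f := fun t x => ∑ i, ∑ j, gv x t i j ^ 2)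
    (fun _ _ => by positivity)
    (IntegrableOn.swap_QSet (f := fun x t => ∑ i, ∑ j, gv x t i j ^ 2) hR.le hR1
      h.vel.grad_L2).aestronglyMeasurable h1
  have h3 : R * funE gv R = (∫⁻ t in timeI R, ∫⁻ x in ball (0 : E3) R,
      ENNReal.ofReal (∑ i, ∑ j, gv x t i j ^ 2)).toReal := by
    rw [← h2, funE, ballB]
    field_simp
  rw [h3, ENNReal.ofReal_toReal h1]

lemma lintegral_pressure_eq (h : SuitableWeakSolution v gv p) (hR : 0 < R) (hR1 : R ≤ 1) :
    ∫⁻ t in timeI R, ∫⁻ x in ball (0 : E3) R, ‖p x t - avgB R (fun y => p y t)‖ₑ ^ (3 / 2 : ℝ)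
      = ENNReal.ofReal (R ^ 2 * funD0 p R) := by
  have h1 := h.lintegral_pressure_ne_top hR hR1
  simp_rw [← enorm_abs_rpow _ (show (0 : ℝ) ≤ 3 / 2 by norm_num)] at h1 ⊢
  have h2 := integral_integral_eq_toReal_lintegral
    (f := fun t x => |p x t - avgB R (fun y => p y t)| ^ (3 / 2 : ℝ))
    (fun _ _ => by positivity)
    ((h.aestronglyMeasurable_pressure_sub hR.le hR1).norm.aemeasurable.pow_const
      _).aestronglyMeasurable h1
  have h3 : R ^ 2 * funD0 p R = (∫⁻ t in timeI R, ∫⁻ x in ball (0 : E3) R,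
      ENNReal.ofReal (|p x t - avgB R (fun y => p y t)| ^ (3 / 2 : ℝ))).toReal := by
    rw [← h2, funD0, ballB]
    field_simp
  rw [h3, ENNReal.ofReal_toReal h1]

lemma ae_setIntegral_sq_eq (h : SuitableWeakSolution v gv p) (hR : 0 ≤ R) (hR1 : R ≤ 1) :
    ∀ᵐ t ∂(volume.restrict (timeI R)),
      ENNReal.ofReal (∫ x in ballB R, ‖v x t‖ ^ 2) = ∫⁻ x in ball (0 : E3) R, ‖v x t‖ₑ ^ 2 := by
  filter_upwards [(IntegrableOn.swap_QSet (f := fun x t => ‖v x t‖ ^ 2) hR hR1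
    h.vel.v_L2).prod_right_ae] with t ht
  rw [ballB, ofReal_integral_eq_lintegral_ofReal ht (Eventually.of_forall fun x => by positivity)]
  refine lintegral_congr fun x => ?_
  rw [ENNReal.ofReal_pow (norm_nonneg _), ofReal_norm]

lemma ae_le_funA (h : SuitableWeakSolution v gv p) (hR : 0 < R) (hR1 : R ≤ 1) :
    ∀ᵐ t ∂(volume.restrict (timeI R)), (1 / R) * ∫ x in ballB R, ‖v x t‖ ^ 2 ≤ funA v R := by
  obtain ⟨M, hM⟩ := h.vel.exists_ae_lintegral_sq_le hR.le hR1
  refine ae_le_essSup ⟨1 / R * max M 0, ?_⟩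
  rw [eventually_map]
  filter_upwards [hM, h.ae_setIntegral_sq_eq hR.le hR1] with t ht ht'
  refine mul_le_mul_of_nonneg_left ?_ (by positivity)
  rw [← ht'] at ht
  have h0 : 0 ≤ ∫ x in ballB R, ‖v x t‖ ^ 2 := by positivity
  rcases le_total 0 M with hM0 | hM0
  · exact ((ENNReal.ofReal_le_ofReal_iff hM0).mp ht).trans (le_max_left _ _)
  · rw [ENNReal.ofReal_of_nonpos hM0, nonpos_iff_eq_zero, ENNReal.ofReal_eq_zero] at ht
    exact ht.trans (le_max_right _ _)

lemma funA_nonneg (h : SuitableWeakSolution v gv p) (hR : 0 < R) (hR1 : R ≤ 1) :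
    0 ≤ funA v R := by
  have : (ae (volume.restrict (timeI R))).NeBot := ae_neBot.mpr (restrict_timeI_ne_zero hR)
  obtain ⟨t, ht⟩ := (h.ae_le_funA hR hR1).exists
  exact le_trans (by positivity) ht

lemma ae_lintegral_sq_le (h : SuitableWeakSolution v gv p) (hR : 0 < R) (hR1 : R ≤ 1) :
    ∀ᵐ t ∂(volume.restrict (timeI R)),
      ∫⁻ x in ball (0 : E3) R, ‖v x t‖ₑ ^ 2 ≤ ENNReal.ofReal (R * funA v R) := by
  filter_upwards [h.ae_le_funA hR hR1, h.ae_setIntegral_sq_eq hR.le hR1] with t ht ht'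
  rw [← ht']
  refine ENNReal.ofReal_le_ofReal ?_
  rw [one_div, inv_mul_le_iff₀ hR] at ht
  exact ht

lemma lintegral_fluxBound_le (h : SuitableWeakSolution v gv p) (hR : 0 < R) (hR1 : R ≤ 1) :
    ∫⁻ t in timeI R, fluxBound R (fun x => v x t) (fun x => gv x t) (fun x => p x t)
      ≤ ENNReal.ofReal (R ^ 2 * energyRHS v gv p R) := by
  have hC : 0 ≤ funC v R := by rw [funC]; positivity
  have hE : 0 ≤ funE gv R := by rw [funE]; positivity
  have hD : 0 ≤ funD0 p R := by rw [funD0]; positivity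
  have hA := h.funA_nonneg hR hR1
  refine (lintegral_fluxTerms_le (h.vel.aemeasurable_lintegral_grad hR.le hR1)
    (h.vel.aemeasurable_lintegral_pow hR.le hR1 3) (h.aemeasurable_lintegral_pressure hR.le hR1)
    ENNReal.ofReal_ne_top (h.ae_lintegral_sq_le hR hR1)).trans (le_of_eq ?_)
  rw [h.lintegral_cube_eq hR hR1, h.lintegral_grad_eq hR hR1, h.lintegral_pressure_eq hR hR1,
    Measure.restrict_apply_univ, volume_timeI]
  set A := funA v R
  set C := funC v R with hCdef
  set E := funE gv R with hEdef
  set D := funD0 p R with hDdef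
  have hR2 : (0 : ℝ) ≤ R ^ 2 := by positivity
  have e1 : ∀ {x q : ℝ}, 0 ≤ x → 0 ≤ q →
      ENNReal.ofReal x ^ q = ENNReal.ofReal (x ^ q) := fun hx hq =>
    ENNReal.ofReal_rpow_of_nonneg hx hq
  have hRR : (R ^ 2) ^ (2 / 3 : ℝ) * (R ^ 2) ^ (1 / 3 : ℝ) = R ^ 2 := by
    rw [← Real.rpow_add (by positivity)]; norm_num
  have t1 : (R ^ 2 * C) ^ (2 / 3 : ℝ) * (R ^ 2) ^ (1 / 3 : ℝ) = R ^ 2 * C ^ (2 / 3 : ℝ) := by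
    rw [Real.mul_rpow hR2 hC, mul_right_comm, hRR]
  have t2 : (R * A) ^ (1 / 2 : ℝ) * ((R ^ 2 * C ^ (2 / 3 : ℝ)) ^ (1 / 2 : ℝ)
      * (R * E) ^ (1 / 2 : ℝ))
      = R ^ 2 * (A ^ (1 / 2 : ℝ) * C ^ (1 / 3 : ℝ) * E ^ (1 / 2 : ℝ)) := by
    rw [Real.mul_rpow hR.le hA, Real.mul_rpow hR2 (by positivity), Real.mul_rpow hR.le hE,
      ← Real.rpow_mul hC, ← Real.sqrt_eq_rpow (R ^ 2), Real.sqrt_sq hR.le]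
    have : R ^ (1 / 2 : ℝ) * R ^ (1 / 2 : ℝ) = R := by
      rw [← Real.rpow_add hR]; norm_num
    have h23 : (2 / 3 * (1 / 2) : ℝ) = 1 / 3 := by norm_num
    rw [h23]
    linear_combination (A ^ (1 / 2 : ℝ) * C ^ (1 / 3 : ℝ) * E ^ (1 / 2 : ℝ)) * R * this
  have t3 : (R ^ 2 * C) ^ (1 / 3 : ℝ) * (R ^ 2 * D) ^ (2 / 3 : ℝ)
      = R ^ 2 * (C ^ (1 / 3 : ℝ) * D ^ (2 / 3 : ℝ)) := by
    rw [Real.mul_rpow hR2 hC, Real.mul_rpow hR2 hD]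
    linear_combination (C ^ (1 / 3 : ℝ) * D ^ (2 / 3 : ℝ)) * hRR
  rw [e1 (by positivity) (by norm_num), e1 (by positivity) (by norm_num),
    e1 (by positivity) (by norm_num), e1 (by positivity) (by norm_num),
    e1 (by positivity) (by norm_num), e1 (by positivity) (by norm_num),
    ← ENNReal.ofReal_mul (by positivity), t1, e1 (by positivity) (by norm_num),
    ← ENNReal.ofReal_mul (by positivity), ← ENNReal.ofReal_mul (by positivity), t2,
    ← ENNReal.ofReal_mul (by positivity), t3, ← ENNReal.ofReal_add (by positivity) (by positivity),
    ← ENNReal.ofReal_add (by positivity) (by positivity), energyRHS]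
  congr 1
  ring

end SuitableWeakSolution

lemma IsCutoff.fderiv_eq_zero {K R : ℝ} {ζ : E3 → ℝ} {χ : ℝ → ℝ}
    (hc : IsCutoff K R ζ χ) (hR : 0 < R) {x : E3}
    (hx : x ∉ ball (0 : E3) R) (s : ℝ) : fderiv ℝ (fun z : E3 × ℝ => ζ z.1 * χ z.2) (x, s) = 0 := by
  have h1 : (fun z : E3 × ℝ => ζ z.1 * χ z.2) =ᶠ[𝓝 (x, s)] fun _ => 0 := by
    have : {z : E3 × ℝ | 3 / 4 * R < ‖z.1‖} ∈ 𝓝 (x, s) := by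
      refine (isOpen_lt continuous_const (by fun_prop)).mem_nhds ?_
      rw [mem_ball_zero_iff, not_lt] at hx
      change 3 / 4 * R < ‖x‖
      linarith
    filter_upwards [this] with z hz
    rw [hc.space_eq_zero hz, zero_mul]
  rw [h1.fderiv_eq]
  simp

lemma IsCutoff.lapSpace_eq_zero {K R : ℝ} {ζ : E3 → ℝ} {χ : ℝ → ℝ}
    (hc : IsCutoff K R ζ χ) (hR : 0 < R) {x : E3}
    (hx : x ∉ ball (0 : E3) R) (s : ℝ) : lapSpace (fun z : E3 × ℝ => ζ z.1 * χ z.2) (x, s) = 0 := by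
  have hs := hc.tsupport_subset hR
  rw [hc.lapSpace_eq, Finset.sum_eq_zero, zero_mul]
  intro j _
  rw [fderiv_eq_zero_of_notMem (R := R) ((tsupport_fderiv_apply_subset ℝ _).trans hs) hx]
  rfl

/-- The integrand on the right-hand side of the local energy inequality. -/
def fluxIntegrand (v : E3 → ℝ → E3) (p : E3 → ℝ → ℝ) (φ : E3 × ℝ → ℝ) (x : E3) (s : ℝ) : ℝ :=
  ‖v x s‖ ^ 2 * (lapSpace φ (x, s) + fderiv ℝ φ (x, s) timeDir)
    + (∑ i, v x s i * fderiv ℝ φ (x, s) (spaceDir i)) * (‖v x s‖ ^ 2 + 2 * p x s)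

namespace SuitableWeakSolution

variable {v : E3 → ℝ → E3} {gv : E3 → ℝ → Fin 3 → Fin 3 → ℝ} {p : E3 → ℝ → ℝ} {R : ℝ}
  {K : ℝ} {ζ : E3 → ℝ} {χ : ℝ → ℝ}

lemma fluxIntegrand_eq_zero_of_time (hc : IsCutoff K R ζ χ) {s : ℝ} (hs : s < -(9 / 16 * R ^ 2))
    (x : E3) : fluxIntegrand v p (fun z => ζ z.1 * χ z.2) x s = 0 := by
  have h1 : χ =ᶠ[𝓝 s] fun _ => 0 := by
    filter_upwards [Iio_mem_nhds hs] with t ht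
    exact hc.time_eq_zero t (le_of_lt ht)
  have h2 : deriv χ s = 0 := by rw [h1.deriv_eq]; simp
  simp [fluxIntegrand, hc.lapSpace_eq, hc.fderiv_timeDir, hc.fderiv_spaceDir, h2, h1.self_of_nhds]

lemma setIntegral_fluxIntegrand (hc : IsCutoff K R ζ χ) (hR : 0 < R) (hR1 : R ≤ 1) (s : ℝ) :
    ∫ x in ball (0 : E3) 1, fluxIntegrand v p (fun z => ζ z.1 * χ z.2) x s
      = ∫ x in ball (0 : E3) R, fluxIntegrand v p (fun z => ζ z.1 * χ z.2) x s := by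
  refine setIntegral_eq_of_subset_of_forall_sdiff_eq_zero measurableSet_ball
    (ball_subset_ball hR1) fun x hx => ?_
  simp [fluxIntegrand, hc.lapSpace_eq_zero hR hx.2, hc.fderiv_eq_zero hR hx.2]

lemma ae_enorm_flux_le (h : SuitableWeakSolution v gv p) (hK : 0 ≤ K) (hc : IsCutoff K R ζ χ)
    (hR : 0 < R) (hR1 : R ≤ 1) :
    ∀ᵐ s ∂(volume.restrict (timeI R)),
      ‖∫ x in ball (0 : E3) 1, fluxIntegrand v p (fun z => ζ z.1 * χ z.2) x s‖ₑ
      ≤ ENNReal.ofReal (9020160 * (3 * K) / R)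
        * fluxBound R (fun x => v x s) (fun x => gv x s) (fun x => p x s) := by
  have hd : ∀ᵐ t ∂(volume.restrict (timeI R)), _ :=
    ae_mono (Measure.restrict_mono (timeI_subset hR.le hR1) le_rfl)
    (h.ae_div_free hc.smooth_space ((hc.tsupport_subset hR).trans (ball_subset_ball hR1)))
  filter_upwards [h.vel.ae_sliceRegular hR.le hR1, h.ae_aestronglyMeasurable_pressure hR.le hR1,
    hd] with s hs hp hd
  rw [setIntegral_fluxIntegrand hc hR hR1]
  set ℓ : E3 → ℝ := fun x => ∑ i, v x s i *
    fderiv ℝ (fun z : E3 × ℝ => ζ z.1 * χ z.2) (x, s) (spaceDir i) with hℓ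
  have hℓb : ∀ x, |ℓ x| ≤ 3 * K / R * ‖v x s‖ := fun x => hc.abs_flux_le _ x s
  have hvi : IntegrableOn (fun x => ‖v x s‖) (ball (0 : E3) R) := by
    refine integrableOn_of_lintegral_sq measure_ball_lt_top.ne hs.meas.norm ?_
    simpa using hs.sq_ne_top
  refine hs.enorm_setIntegral_flux_le hR (K := 3 * K) (by positivity) hp
    (θ := fun x => lapSpace (fun z : E3 × ℝ => ζ z.1 * χ z.2) (x, s)
      + fderiv ℝ (fun z : E3 × ℝ => ζ z.1 * χ z.2) (x, s) timeDir) (ℓ := ℓ)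
    (fun x => hc.abs_coeff_le x s) hℓb ?_ ?_
  · refine Integrable.mono' (hvi.const_mul (3 * K / R)) ?_ (Eventually.of_forall fun x => ?_)
    · refine Finset.aestronglyMeasurable_fun_sum _ fun i _ => ?_
      refine AEStronglyMeasurable.mul ?_ ?_
      · exact (EuclideanSpace.proj i : E3 →L[ℝ] ℝ).continuous.comp_aestronglyMeasurable hs.meas
      · simp_rw [hc.fderiv_spaceDir]
        exact (((hc.smooth_space.continuous_fderiv (by simp)).clm_apply
          continuous_const).mul_const _).aestronglyMeasurable
    · rw [Real.norm_eq_abs]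
      exact hℓb x
  · have e : ∀ x, ℓ x = (∑ i, v x s i * fderiv ℝ ζ x (EuclideanSpace.single i (1 : ℝ))) * χ s := by
      intro x
      simp_rw [hℓ, hc.fderiv_spaceDir, Finset.sum_mul, mul_assoc]
    have h1 : ∫ x in ball (0 : E3) 1, ℓ x = ∫ x in ball (0 : E3) R, ℓ x := by
      refine setIntegral_eq_of_subset_of_forall_sdiff_eq_zero measurableSet_ball
        (ball_subset_ball hR1) fun x hx => ?_
      simp [hℓ, hc.fderiv_eq_zero hR hx.2]
    rw [← h1]
    simp_rw [e]
    rw [integral_mul_const, hd, zero_mul]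

lemma energyRHS_nonneg (h : SuitableWeakSolution v gv p) (hR : 0 < R) (hR1 : R ≤ 1) :
    0 ≤ energyRHS v gv p R := by
  have hC : 0 ≤ funC v R := by rw [funC]; positivity
  have hE : 0 ≤ funE gv R := by rw [funE]; positivity
  have hD : 0 ≤ funD0 p R := by rw [funD0]; positivity
  have hA := h.funA_nonneg hR hR1
  rw [energyRHS]
  positivity

lemma integral_flux_le (h : SuitableWeakSolution v gv p) (hK : 0 ≤ K)
    (hc : IsCutoff K R ζ χ) (hR : 0 < R) (hR1 : R ≤ 1) {t : ℝ} (ht : t ≤ 0) :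
    ∫ s in Ioo (-1 : ℝ) t, ∫ x in ball (0 : E3) 1, fluxIntegrand v p (fun z => ζ z.1 * χ z.2) x s
      ≤ 9020160 * (3 * K) * R * energyRHS v gv p R := by
  set J : ℝ → ℝ := fun s =>
    ∫ x in ball (0 : E3) 1, fluxIntegrand v p (fun z => ζ z.1 * χ z.2) x s with hJ
  have hX := h.energyRHS_nonneg hR hR1
  have h1 : ∫⁻ s in Ioo (-1 : ℝ) t, ‖J s‖ₑ ≤ ∫⁻ s in timeI R, ‖J s‖ₑ := by
    have hz : ∀ s ∈ Iic (-R ^ 2), ‖J s‖ₑ = 0 := fun s hs => by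
      rw [enorm_eq_zero, hJ]
      refine integral_eq_zero_of_ae (Eventually.of_forall fun x => ?_)
      refine fluxIntegrand_eq_zero_of_time hc ?_ x
      have : s ≤ -R ^ 2 := hs
      nlinarith [sq_pos_of_pos hR]
    have hsub : Ioo (-1 : ℝ) t ⊆ Iic (-R ^ 2) ∪ timeI R := fun s hs => by
      rcases le_or_gt s (-R ^ 2) with h | h
      · exact Or.inl h
      · exact Or.inr ⟨h, hs.2.trans_le ht⟩
    refine (lintegral_mono_set hsub).trans ((lintegral_union_le _ _ _).trans ?_)
    rw [setLIntegral_congr_fun measurableSet_Iic hz]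
    simp
  have h2 : ‖∫ s in Ioo (-1 : ℝ) t, J s‖ₑ
      ≤ ENNReal.ofReal (9020160 * (3 * K) * R * energyRHS v gv p R) := by
    refine (enorm_integral_le_lintegral_enorm _).trans (h1.trans ?_)
    refine (lintegral_mono_ae (h.ae_enorm_flux_le hK hc hR hR1)).trans ?_
    rw [lintegral_const_mul' _ _ ENNReal.ofReal_ne_top]
    refine (mul_le_mul' le_rfl (h.lintegral_fluxBound_le hR hR1)).trans (le_of_eq ?_)
    rw [← ENNReal.ofReal_mul (by positivity)]
    congr 1
    field_simp
  rw [← ofReal_norm, ENNReal.ofReal_le_ofReal_iff (by positivity)] at h2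
  exact (le_abs_self _).trans h2

end SuitableWeakSolution

lemma lintegral_Ioo_le_of_ae {a b : ℝ} (hab : a < b) {G : ℝ → ℝ≥0∞} {N : ℝ≥0∞}
    (h : ∀ᵐ t ∂(volume.restrict (Ioo a b)), ∫⁻ s in Ioo a t, G s ≤ N) :
    ∫⁻ s in Ioo a b, G s ≤ N := by
  have h1 : ∀ t ∈ Ioo a b, ∫⁻ s in Ioo a t, G s ≤ N := fun t ht => by
    have h2 : ∀ᵐ τ ∂(volume.restrict (Ioo t b)), ∫⁻ s in Ioo a τ, G s ≤ N :=
      ae_mono (Measure.restrict_mono (Ioo_subset_Ioo_left ht.1.le) le_rfl) h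
    have : (ae (volume.restrict (Ioo t b))).NeBot := by
      rw [ae_neBot, Ne, Measure.restrict_eq_zero]
      simp [ht.2]
    obtain ⟨τ, hτ, hτ2⟩ := (h2.and (ae_restrict_mem measurableSet_Ioo)).exists
    exact (lintegral_mono_set (Ioo_subset_Ioo_right hτ2.1.le)).trans hτ
  obtain ⟨u, hu, hua, hut⟩ := exists_seq_strictMono_tendsto' hab
  have h3 : ⋃ n, Ioo a (u n) = Ioo a b := by
    ext x
    simp only [mem_iUnion, mem_Ioo]
    constructor
    · rintro ⟨n, hn⟩
      exact ⟨hn.1, hn.2.trans (hua n).2⟩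
    · rintro ⟨hx1, hx2⟩
      obtain ⟨n, hn⟩ := (hut.eventually (lt_mem_nhds hx2)).exists
      exact ⟨n, hx1, hn⟩
  rw [← h3, setLIntegral_iUnion_of_directed]
  · exact iSup_le fun n => h1 _ (hua n)
  · exact (monotone_nat_of_le_succ fun n =>
      Ioo_subset_Ioo_right (hu (Nat.lt_succ_self n)).le).directed_le

namespace SuitableWeakSolution

variable {v : E3 → ℝ → E3} {gv : E3 → ℝ → Fin 3 → Fin 3 → ℝ} {p : E3 → ℝ → ℝ} {R : ℝ}
  {K : ℝ} {ζ : E3 → ℝ} {χ : ℝ → ℝ}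

lemma setIntegral_sq_le_cutoff (hc : IsCutoff K R ζ χ) (hR1 : R ≤ 1) {t : ℝ}
    (ht : t ∈ timeI (R / 2)) (hv : IntegrableOn (fun x => ‖v x t‖ ^ 2) (ball (0 : E3) 1)) :
    ∫ x in ball (0 : E3) (R / 2), ‖v x t‖ ^ 2
      ≤ ∫ x in ball (0 : E3) 1, ζ x * χ t * ‖v x t‖ ^ 2 := by
  have hχ : χ t = 1 := hc.time_eq_one t ⟨ht.1.le, ht.2.le⟩
  have h1 : IntegrableOn (fun x => ζ x * χ t * ‖v x t‖ ^ 2) (ball (0 : E3) 1) := by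
    refine Integrable.bdd_mul (c := 1) hv ?_ (Eventually.of_forall fun x => ?_)
    · exact (hc.smooth_space.continuous.mul_const _).aestronglyMeasurable
    · rw [hχ, mul_one, Real.norm_of_nonneg (hc.space_nonneg x)]
      exact hc.space_le_one x
  calc _ = ∫ x in ball (0 : E3) (R / 2), ζ x * χ t * ‖v x t‖ ^ 2 := by
        refine setIntegral_congr_fun measurableSet_ball fun x hx => ?_
        simp [hc.space_eq_one x hx, hχ]
    _ ≤ _ := by
        refine setIntegral_mono_set h1 (Eventually.of_forall fun x => ?_)
          (ball_subset_ball (by linarith)).eventuallyLE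
        exact mul_nonneg (mul_nonneg (hc.space_nonneg x) (hc.time_nonneg t)) (sq_nonneg _)

lemma lintegral_grad_le_cutoff (h : VelocityClass v gv 1) (hc : IsCutoff K R ζ χ) (hR : 0 < R)
    (hR1 : R ≤ 1) {t : ℝ} (ht : t ∈ timeI (R / 2)) :
    ∫⁻ s in Ioo (-(R / 2) ^ 2) t, ∫⁻ x in ball (0 : E3) (R / 2),
        ENNReal.ofReal (∑ i, ∑ j, gv x s i j ^ 2)
      ≤ ENNReal.ofReal (∫ s in Ioo (-1 : ℝ) t, ∫ x in ball (0 : E3) 1,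
        ζ x * χ s * ∑ i, ∑ j, gv x s i j ^ 2) := by
  have hsub : Ioo (-1 : ℝ) t ⊆ timeI 1 := by
    rw [timeI]
    exact Ioo_subset_Ioo (by norm_num) ht.2.le
  have hG : ∀ x s, 0 ≤ ∑ i, ∑ j, gv x s i j ^ 2 := fun x s => by positivity
  have hφ0 : ∀ x s, 0 ≤ ζ x * χ s := fun x s => mul_nonneg (hc.space_nonneg x) (hc.time_nonneg s)
  have hφ1 : ∀ x s, ζ x * χ s ≤ 1 := fun x s =>
    mul_le_one₀ (hc.space_le_one x) (hc.time_nonneg s) (hc.time_le_one s)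
  have hfin : ∫⁻ s in Ioo (-1 : ℝ) t, ∫⁻ x in ball (0 : E3) 1,
      ENNReal.ofReal (ζ x * χ s * ∑ i, ∑ j, gv x s i j ^ 2) ≠ ∞ := by
    refine ne_top_of_le_ne_top (h.lintegral_grad_ne_top zero_le_one le_rfl)
      ((lintegral_mono_set hsub).trans ?_)
    refine lintegral_mono fun s => lintegral_mono fun x => ENNReal.ofReal_le_ofReal ?_
    exact mul_le_of_le_one_left (hG x s) (hφ1 x s)
  have hm : AEStronglyMeasurable
      (fun z : ℝ × E3 => ζ z.2 * χ z.1 * ∑ i, ∑ j, gv z.2 z.1 i j ^ 2)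
      ((volume.restrict (Ioo (-1 : ℝ) t)).prod (volume.restrict (ball 0 1))) := by
    refine AEStronglyMeasurable.mul ?_ ?_
    · exact ((hc.smooth_space.continuous.comp continuous_snd).mul
        (hc.smooth_time.continuous.comp continuous_fst)).aestronglyMeasurable
    · have := (IntegrableOn.swap_QSet (f := fun x t => ∑ i, ∑ j, gv x t i j ^ 2) zero_le_one
        le_rfl h.grad_L2).aestronglyMeasurable
      refine this.mono_measure ?_
      exact Measure.prod_mono (Measure.restrict_mono hsub le_rfl) le_rfl
  rw [integral_integral_eq_toReal_lintegral
    (f := fun s x => ζ x * χ s * ∑ i, ∑ j, gv x s i j ^ 2)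
    (fun s x => mul_nonneg (hφ0 x s) (hG x s)) hm hfin, ENNReal.ofReal_toReal hfin]
  calc _ = ∫⁻ s in Ioo (-(R / 2) ^ 2) t, ∫⁻ x in ball (0 : E3) (R / 2),
        ENNReal.ofReal (ζ x * χ s * ∑ i, ∑ j, gv x s i j ^ 2) := by
        refine setLIntegral_congr_fun measurableSet_Ioo fun s hs => ?_
        refine setLIntegral_congr_fun measurableSet_ball fun x hx => ?_
        have hχ : χ s = 1 := hc.time_eq_one s ⟨hs.1.le, hs.2.le.trans ht.2.le⟩
        simp [hc.space_eq_one x hx, hχ]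
    _ ≤ ∫⁻ s in Ioo (-1 : ℝ) t, ∫⁻ x in ball (0 : E3) (R / 2),
        ENNReal.ofReal (ζ x * χ s * ∑ i, ∑ j, gv x s i j ^ 2) := by
        refine lintegral_mono_set (Ioo_subset_Ioo_left ?_)
        nlinarith
    _ ≤ _ := lintegral_mono fun s => lintegral_mono_set (ball_subset_ball (by linarith))

lemma ae_energy_le (h : SuitableWeakSolution v gv p) (hK : 0 ≤ K) (hc : IsCutoff K R ζ χ)
    (hR : 0 < R) (hR1 : R ≤ 1) :
    ∀ᵐ t ∂(volume.restrict (timeI (R / 2))),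
      (∫ x in ball (0 : E3) (R / 2), ‖v x t‖ ^ 2)
          ≤ 9020160 * (3 * K) * R * energyRHS v gv p R ∧
        ∫⁻ s in Ioo (-(R / 2) ^ 2) t, ∫⁻ x in ball (0 : E3) (R / 2),
          ENNReal.ofReal (∑ i, ∑ j, gv x s i j ^ 2)
          ≤ ENNReal.ofReal (9020160 * (3 * K) * R * energyRHS v gv p R) := by
  have hle : volume.restrict (timeI (R / 2)) ≤ volume.restrict (Ioo (-1 : ℝ) 0) :=
    Measure.restrict_mono (Ioo_subset_Ioo_left (by nlinarith)) le_rfl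
  have hle' : volume.restrict (timeI (R / 2)) ≤ volume.restrict (timeI 1) :=
    Measure.restrict_mono (timeI_subset (by positivity) (by linarith)) le_rfl
  filter_upwards [ae_mono hle h.lei, ae_restrict_mem measurableSet_Ioo,
    ae_mono hle' (IntegrableOn.swap_QSet (f := fun x t => ‖v x t‖ ^ 2) zero_le_one le_rfl
      h.vel.v_L2).prod_right_ae] with t ht htm hv
  have h1 := ht _ hc.smooth (fun z => mul_nonneg (hc.space_nonneg _) (hc.time_nonneg _))
    (hc.eq_zero_near_parabBdry hR hR1)
  have h2 := h1.trans (h.integral_flux_le hK hc hR hR1 htm.2.le)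
  have h3 := setIntegral_sq_le_cutoff hc hR1 htm hv
  have h4 := lintegral_grad_le_cutoff h.vel hc hR hR1 htm
  have h5 : 0 ≤ ∫ s in Ioo (-1 : ℝ) t, ∫ x in ball (0 : E3) 1,
        ζ x * χ s * ∑ i, ∑ j, gv x s i j ^ 2 :=
    integral_nonneg fun s => integral_nonneg fun x =>
      mul_nonneg (mul_nonneg (hc.space_nonneg x) (hc.time_nonneg s)) (by positivity)
  have h6 : 0 ≤ ∫ x in ball (0 : E3) (R / 2), ‖v x t‖ ^ 2 := by positivity
  simp only [ballB] at h2
  refine ⟨by linarith, h4.trans (ENNReal.ofReal_le_ofReal (by linarith))⟩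

lemma funA_half_le (h : SuitableWeakSolution v gv p) (hK : 0 ≤ K) (hc : IsCutoff K R ζ χ)
    (hR : 0 < R) (hR1 : R ≤ 1) :
    funA v (R / 2) ≤ 2 * (9020160 * (3 * K)) * energyRHS v gv p R := by
  have : (ae (volume.restrict (timeI (R / 2)))).NeBot :=
    ae_neBot.mpr (restrict_timeI_ne_zero (by positivity))
  refine essSup_le_of_ae_le _ ?_ ?_
  · filter_upwards [h.ae_energy_le hK hc hR hR1] with t ht
    rw [ballB, one_div, inv_mul_le_iff₀ (by positivity)]
    linarith [ht.1]
  · refine IsBoundedUnder.isCoboundedUnder_le ⟨0, ?_⟩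
    rw [eventually_map]
    exact Eventually.of_forall fun t => by positivity

lemma funE_half_le (h : SuitableWeakSolution v gv p) (hK : 0 ≤ K) (hc : IsCutoff K R ζ χ)
    (hR : 0 < R) (hR1 : R ≤ 1) :
    funE gv (R / 2) ≤ 2 * (9020160 * (3 * K)) * energyRHS v gv p R := by
  have h1 := lintegral_Ioo_le_of_ae (by nlinarith : -(R / 2) ^ 2 < 0)
    ((h.ae_energy_le hK hc hR hR1).mono fun t ht => ht.2)
  have h2 := h.lintegral_grad_eq (R := R / 2) (by positivity) (by linarith)
  rw [timeI] at h2
  rw [h2, ENNReal.ofReal_le_ofReal_iff'] at h1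
  have hX := h.energyRHS_nonneg hR hR1
  rcases h1 with h1 | h1
  · nlinarith
  · have : funE gv (R / 2) ≤ 0 := by nlinarith
    exact this.trans (by positivity)

end SuitableWeakSolution

/-- Local energy estimate (2.3): there is a universal `c > 0` such that for every suitable
weak solution and every `0 < R ≤ 1`,
`A(R/2) + E(R/2) ≤ c [C^{2/3}(R) + C^{1/3}(R) D₀^{2/3}(R) + A^{1/2}(R) C^{1/3}(R) E^{1/2}(R)]`. -/
theorem local_energy_estimate_23 :
    ∃ c : ℝ, 0 < c ∧
      ∀ (v : E3 → ℝ → E3) (gv : E3 → ℝ → Fin 3 → Fin 3 → ℝ) (p : E3 → ℝ → ℝ),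
        SuitableWeakSolution v gv p →
        ∀ R : ℝ, 0 < R → R ≤ 1 →
          funA v (R / 2) + funE gv (R / 2)
            ≤ c * (funC v R ^ ((2 : ℝ) / 3)
                + funC v R ^ ((1 : ℝ) / 3) * funD0 p R ^ ((2 : ℝ) / 3)
                + funA v R ^ ((1 : ℝ) / 2) * funC v R ^ ((1 : ℝ) / 3)
                    * funE gv R ^ ((1 : ℝ) / 2)) := by
  obtain ⟨K, hK, hcut⟩ := exists_isCutoff
  refine ⟨4 * (9020160 * (3 * K)), by positivity, fun v gv p h R hR hR1 => ?_⟩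
  obtain ⟨ζ, χ, hc⟩ := hcut R hR
  have hA := h.funA_half_le hK.le hc hR hR1
  have hE := h.funE_half_le hK.le hc hR hR1
  rw [energyRHS] at hA hE
  linarith
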